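/- arXiv:0908.0637 — 3 statements merged into one kernel-verified Lean document; each statement's English description precedes it below -/
import Mathlib

section
/- Let V be a finite-dimensional vector space over a non-archimedean local field F, and G a compactly generated subgroup of GL(V) such that for every g ∈ G and v ∈ V the two-sided orbit {gⁿ v : n ∈ ℤ} is relatively compact. Then the closure of G in GL(V) is compact. -/
open Filter Topology
open Module

/-- A family of vectors is weakly bounded if every linear functional is bounded on it. -/
def WeaklyBounded (K : Type*) [NormedField K] {E : Type*} [AddCommGroup E] [Module K E]
    {ι : Type*} (x : ι → E) : Prop :=
  ∀ φ : Dual K E, ∃ C : ℝ, ∀ i, ‖φ (x i)‖ ≤ C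

namespace WeaklyBounded

variable {K : Type*} [NormedField K] {E E' E'' : Type*} [AddCommGroup E] [Module K E]
  [AddCommGroup E'] [Module K E'] [AddCommGroup E''] [Module K E''] {ι κ : Type*}

theorem map {x : ι → E} (hx : WeaklyBounded K x) (L : E →ₗ[K] E') :
    WeaklyBounded K (fun i => L (x i)) :=
  fun φ => hx (φ ∘ₗ L)

theorem map₂ [FiniteDimensional K E] {x : ι → E} {y : κ → E'} (hx : WeaklyBounded K x)
    (hy : WeaklyBounded K y) (B : E →ₗ[K] E' →ₗ[K] E'') :
    WeaklyBounded K (fun p : ι × κ => B (x p.1) (y p.2)) := by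
  intro φ
  let b := finBasis K E
  choose C hC using fun k => hx (b.coord k)
  choose D hD using fun k => hy (φ ∘ₗ B (b k))
  refine ⟨∑ k, C k * D k, fun p => ?_⟩
  have key : φ (B (x p.1) (y p.2)) = ∑ k, b.coord k (x p.1) * φ (B (b k) (y p.2)) := by
    conv_lhs => rw [← b.sum_repr (x p.1)]
    simp only [map_sum, map_smul, LinearMap.sum_apply, LinearMap.smul_apply, smul_eq_mul,
      Basis.coord_apply]
  rw [key]
  refine (norm_sum_le _ _).trans (Finset.sum_le_sum fun k _ => ?_)
  rw [norm_mul]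
  exact mul_le_mul (hC k _) (hD k _) (norm_nonneg _) ((norm_nonneg _).trans (hC k p.1))

theorem comp_comp {A B : Type*} [AddCommGroup A] [Module K A] [AddCommGroup B] [Module K B]
    {x : ι → E →ₗ[K] E'} (hx : WeaklyBounded K x) (R : A →ₗ[K] E) (L : E' →ₗ[K] B) :
    WeaklyBounded K (fun i => L ∘ₗ x i ∘ₗ R) :=
  hx.map (LinearMap.compRight K L ∘ₗ LinearMap.lcomp K E' R)

/-- Weak boundedness passes through a linear map into a space over a normed extension. -/
theorem map_of_normedAlgebra {L : Type*} [NormedField L] [NormedAlgebra K L]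
    [FiniteDimensional K E] {W : Type*} [AddCommGroup W] [Module K W] [Module L W]
    [IsScalarTower K L W] {x : ι → E} (hx : WeaklyBounded K x) (T : E →ₗ[K] W) :
    WeaklyBounded L (fun i => T (x i)) := by
  intro φ
  let b := finBasis K E
  choose C hC using fun k => hx (b.coord k)
  refine ⟨∑ k, C k * ‖φ (T (b k))‖, fun i => ?_⟩
  have key : φ (T (x i)) = ∑ k, b.coord k (x i) • φ (T (b k)) := by
    conv_lhs => rw [← b.sum_repr (x i)]
    simp only [map_sum, map_smul, Basis.coord_apply]
    exact Finset.sum_congr rfl fun k _ => φ.map_smul_of_tower _ _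
  rw [key]
  refine (norm_sum_le _ _).trans (Finset.sum_le_sum fun k _ => ?_)
  rw [norm_smul]
  exact mul_le_mul_of_nonneg_right (hC k _) (norm_nonneg _)

end WeaklyBounded

section Burnside

variable {K V : Type*} [Field K] [IsAlgClosed K] [AddCommGroup V] [Module K V]
  [FiniteDimensional K V]

/-- **Burnside's theorem** on irreducible matrix algebras. -/
theorem Subalgebra.eq_top_of_forall_invariant [Nontrivial V] (A : Subalgebra K (End K V))
    (hA : ∀ W : Submodule K V, (∀ a ∈ A, ∀ w ∈ W, a w ∈ W) → W = ⊥ ∨ W = ⊤) : A = ⊤ := by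
  have hs : IsSimpleModule A V := by
    rw [isSimpleModule_iff]
    refine { exists_pair_ne := ⟨⊥, ⊤, bot_ne_top⟩, eq_bot_or_eq_top := fun W => ?_ }
    rcases hA (W.restrictScalars K) (fun a ha w hw => W.smul_mem (⟨a, ha⟩ : A) hw) with h | h
    · exact Or.inl ((Submodule.restrictScalars_eq_bot_iff K A V).1 h)
    · exact Or.inr ((Submodule.restrictScalars_eq_top_iff K A V).1 h)
  rw [eq_top_iff]
  intro f _
  let F : End (End A V) V :=
    { toFun := f
      map_add' := f.map_add
      map_smul' := fun c v => by
        obtain ⟨t, rfl⟩ := (IsSimpleModule.algebraMap_end_bijective_of_isAlgClosed K).2 c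
        simp }
  classical
  let b := finBasis K V
  obtain ⟨a, ha⟩ := jacobson_density F (Finset.univ.image b)
  have : f = a := b.ext fun i => ha (b i) (by simp)
  rw [this]
  exact a.2

/-- Every linear functional on `End V` is of the form `x ↦ tr (x y)`. -/
theorem exists_dual_end_eq_trace_mul {K V : Type*} [Field K] [AddCommGroup V] [Module K V]
    [FiniteDimensional K V] (φ : Dual K (End K V)) :
    ∃ y : End K V, ∀ x, φ x = LinearMap.trace K V (x * y) := by
  let T : End K V →ₗ[K] Dual K (End K V) :=
    ((LinearMap.mul K (End K V)).flip).compr₂ (LinearMap.trace K V)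
  have hT : ∀ y x, T y x = LinearMap.trace K V (x * y) := fun _ _ => rfl
  have hinj : Function.Injective T := by
    rw [injective_iff_map_eq_zero]
    intro y hy
    ext v
    rw [LinearMap.zero_apply, ← Module.forall_dual_apply_eq_zero_iff K]
    intro f
    have h := hT y (f.smulRight v)
    rw [hy, LinearMap.trace_mul_comm] at h
    have h2 : y * f.smulRight v = f.smulRight (y v) := by ext w; simp
    rw [h2, LinearMap.trace_smulRight] at h
    exact h.symm
  have hsurj : Function.Surjective T :=
    (LinearMap.injective_iff_surjective_of_finrank_eq_finrank
      Subspace.dual_finrank_eq.symm).1 hinj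
  obtain ⟨y, rfl⟩ := hsurj φ
  exact ⟨y, fun x => rfl⟩

end Burnside

section Ultrametric

variable {K : Type*} [NormedField K] [IsUltrametricDist K]

theorem norm_trace_le_one_of_weaklyBounded_pow [IsAlgClosed K] {V : Type*} [AddCommGroup V] [Module K V]
    [FiniteDimensional K V] {f : End K V} (hf : WeaklyBounded K (fun n : ℕ => f ^ n)) :
    ‖LinearMap.trace K V f‖ ≤ 1 := by
  rw [End.trace_eq_sum_roots_charpoly_of_splits (IsAlgClosed.splits _)]
  refine Multiset.sum_induction (fun x : K => ‖x‖ ≤ 1) _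
    (fun a b ha hb => (IsUltrametricDist.norm_add_le_max a b).trans (max_le ha hb)) (by simp)
    fun μ hμ => ?_
  have hev : f.HasEigenvalue μ :=
    (End.hasEigenvalue_iff_isRoot_charpoly f μ).2 (Polynomial.isRoot_of_mem_roots hμ)
  obtain ⟨v, hv⟩ := hev.exists_hasEigenvector
  obtain ⟨g, hg⟩ := Projective.exists_dual_eq_one K hv.2
  obtain ⟨C, hC⟩ := hf (g ∘ₗ LinearMap.applyₗ v)
  by_contra! hlt
  obtain ⟨n, hn⟩ := pow_unbounded_of_one_lt C hlt
  have h := hC n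
  simp [hv.pow_apply, hg] at h
  exact absurd h (not_le.2 hn)

/-- A monoid acting irreducibly by power bounded operators is bounded. -/
theorem weaklyBounded_of_irreducible [IsAlgClosed K] {V : Type*} [AddCommGroup V] [Module K V]
    [FiniteDimensional K V] [Nontrivial V] {M : Type*} [Monoid M] (ρ : M →* End K V)
    (hpow : ∀ m, WeaklyBounded K (fun n : ℕ => ρ (m ^ n)))
    (hirr : ∀ W : Submodule K V, (∀ m, ∀ w ∈ W, ρ m w ∈ W) → W = ⊥ ∨ W = ⊤) :
    WeaklyBounded K ρ := by
  have hadj : Algebra.adjoin K (Set.range ρ) = ⊤ :=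
    Subalgebra.eq_top_of_forall_invariant _ fun W hW =>
      hirr W fun m w hw => hW _ (Algebra.subset_adjoin ⟨m, rfl⟩) w hw
  have hspan : Submodule.span K (Set.range ρ) = ⊤ := by
    have h := Algebra.adjoin_eq_span K (Set.range ρ)
    rw [hadj, ← MonoidHom.coe_mrange, Submonoid.closure_eq] at h
    simpa using h.symm
  intro φ
  obtain ⟨y, hy⟩ := exists_dual_end_eq_trace_mul φ
  simp only [hy]
  clear hy
  have hmem : y ∈ Submodule.span K (Set.range ρ) := hspan ▸ Submodule.mem_top
  induction hmem using Submodule.span_induction with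
  | mem y h =>
    obtain ⟨m', rfl⟩ := h
    refine ⟨1, fun m => ?_⟩
    rw [← map_mul]
    exact norm_trace_le_one_of_weaklyBounded_pow (by simpa using hpow (m * m'))
  | zero => exact ⟨0, by simp⟩
  | add y z _ _ hy hz =>
    obtain ⟨C, hC⟩ := hy
    obtain ⟨D, hD⟩ := hz
    refine ⟨C + D, fun m => ?_⟩
    rw [mul_add, map_add]
    exact (norm_add_le _ _).trans (add_le_add (hC m) (hD m))
  | smul c y _ hy =>
    obtain ⟨C, hC⟩ := hy
    refine ⟨‖c‖ * C, fun m => ?_⟩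
    rw [mul_smul_comm, map_smul, norm_smul]
    exact mul_le_mul_of_nonneg_left (hC m) (norm_nonneg _)

/-- Boundedness of a block triangular action follows from boundedness of the diagonal blocks and
of a generating set. -/
theorem weaklyBounded_of_blockTriangular {V : Type*} [AddCommGroup V] [Module K V]
    [FiniteDimensional K V] {M : Type*} [Monoid M] (ρ : M →* End K V)
    {S : Set M} (hS : Submonoid.closure S = ⊤) (hSb : WeaklyBounded K (fun s : S => ρ s))
    {p q : End K V} (hadd : p + q = 1) (hpq : p * q = 0) (hinv : ∀ m, q * ρ m * p = 0)
    (hp : WeaklyBounded K (fun m => p * ρ m * p)) (hq : WeaklyBounded K (fun m => q * ρ m * q)) :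
    WeaklyBounded K ρ := by
  have hpp : p * p = p := by
    have h : p * (p + q) = p * 1 := by rw [hadd]
    simpa [mul_add, hpq] using h
  have hqq : q * q = q := by
    have h : (p + q) * q = 1 * q := by rw [hadd]
    simpa [add_mul, hpq] using h
  have hsplit : ∀ x y : End K V, x * y = x * p * y + x * q * y := fun x y => by
    rw [← add_mul, ← mul_add, hadd, mul_one]
  have hpm : ∀ a m, p * ρ (a * m) * p = p * ρ a * p * ρ m * p := fun a m => by
    have h : p * ρ (a * m) * p = p * ρ a * p * ρ m * p + p * ρ a * (q * ρ m * p) := by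
      rw [map_mul, ← mul_assoc, hsplit (p * ρ a)]
      simp only [add_mul, mul_assoc]
    rw [h, hinv, mul_zero, add_zero]
  have hqm : ∀ m b, q * ρ (m * b) * q = q * ρ m * q * ρ b * q := fun m b => by
    have h : q * ρ (m * b) * q = q * ρ m * p * ρ b * q + q * ρ m * q * ρ b * q := by
      rw [map_mul, ← mul_assoc, hsplit (q * ρ m)]
      simp only [add_mul, mul_assoc]
    rw [h, hinv, zero_mul, zero_mul, zero_add]
  have hX : WeaklyBounded K (fun m => p * ρ m * q) := by
    intro φ
    obtain ⟨C, hC⟩ := ((hp.map₂ hSb (LinearMap.mul K _)).map₂ hq (LinearMap.mul K _)) φ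
    have key : ∀ m a b, ‖φ ((p * ρ a * p) * ρ m * (q * ρ b * q))‖ ≤ max C 0 := by
      intro m
      have hm : m ∈ Submonoid.closure S := hS ▸ Submonoid.mem_top m
      induction hm using Submonoid.closure_induction with
      | mem s hs => exact fun a b => (hC ((a, ⟨s, hs⟩), b)).trans (le_max_left _ _)
      | one =>
        intro a b
        have h : (p * ρ a * p) * ρ 1 * (q * ρ b * q) = p * ρ a * (p * q) * ρ b * q := by
          simp only [map_one, mul_one, mul_assoc]
        rw [h, hpq]
        simp
      | mul m n _ _ hm hn =>
        intro a b
        have h : (p * ρ a * p) * ρ (m * n) * (q * ρ b * q) =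
            (p * ρ (a * m) * p) * ρ n * (q * ρ b * q) +
            (p * ρ a * p) * ρ m * (q * ρ (n * b) * q) := by
          rw [hpm, hqm, map_mul, ← mul_assoc _ (ρ m), hsplit (p * ρ a * p * ρ m)]
          simp only [add_mul, mul_assoc]
        rw [h, map_add]
        exact (IsUltrametricDist.norm_add_le_max _ _).trans (max_le (hn _ _) (hm _ _))
    refine ⟨max C 0, fun m => ?_⟩
    have h := key m 1 1
    rwa [map_one, mul_one, mul_one, hpp, hqq] at h
  intro φ
  obtain ⟨A, hA⟩ := hp φ
  obtain ⟨B, hB⟩ := hX φ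
  obtain ⟨C, hC⟩ := hq φ
  refine ⟨A + B + C, fun m => ?_⟩
  have h : ρ m = p * ρ m * p + p * ρ m * q + q * ρ m * q := by
    have h1 := hsplit 1 (ρ m)
    have h2 := hsplit (p * ρ m) 1
    have h3 := hsplit (q * ρ m) 1
    simp only [one_mul, mul_one, hinv, zero_add] at h1 h2 h3
    rw [← h3, ← h2, ← h1]
  rw [h, map_add, map_add]
  exact (norm_add_le _ _).trans (add_le_add ((norm_add_le _ _).trans
    (add_le_add (hA m) (hB m))) (hC m))

/-- A monoid of power bounded operators with a bounded generating set is bounded. -/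
theorem weaklyBounded_of_closure_eq_top [IsAlgClosed K] {V : Type*} [AddCommGroup V] [Module K V]
    [FiniteDimensional K V] {M : Type*} [Monoid M] (ρ : M →* End K V)
    {S : Set M} (hS : Submonoid.closure S = ⊤) (hSb : WeaklyBounded K (fun s : S => ρ s))
    (hpow : ∀ m, WeaklyBounded K (fun n : ℕ => ρ (m ^ n))) :
    WeaklyBounded K ρ := by
  induction hn : finrank K V using Nat.strong_induction_on generalizing V with
  | h n ih =>
    subst hn
    rcases subsingleton_or_nontrivial V with hV | hV
    · exact fun φ => ⟨0, fun m => by rw [Subsingleton.elim (ρ m) 0]; simp⟩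
    by_cases hirr : ∀ W : Submodule K V, (∀ m, ∀ w ∈ W, ρ m w ∈ W) → W = ⊥ ∨ W = ⊤
    · exact weaklyBounded_of_irreducible ρ hpow hirr
    push Not at hirr
    obtain ⟨W, hW, hbot, htop⟩ := hirr
    let ρW : M →* End K W :=
      { toFun := fun m => (ρ m).restrict (hW m)
        map_one' := by ext; simp
        map_mul' := fun a b => by ext; simp }
    let ρQ : M →* End K (V ⧸ W) :=
      { toFun := fun m => W.mapQ W (ρ m) (hW m)
        map_one' := by ext; simp
        map_mul' := fun a b => by ext; simp }
    obtain ⟨P, hP⟩ := W.subtype.exists_leftInverse_of_injective W.ker_subtype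
    obtain ⟨s, hs⟩ := W.mkQ.exists_rightInverse_of_surjective W.range_mkQ
    have hPw : ∀ w : W, P w = w := fun w => congr($hP w)
    have hρW : ∀ m, ρW m = P ∘ₗ ρ m ∘ₗ W.subtype := fun m => by
      ext w
      exact congr(($(hPw (ρW m w)) : V)).symm
    have hρQ : ∀ m, ρQ m = W.mkQ ∘ₗ ρ m ∘ₗ s := fun m => by
      have h : ρQ m ∘ₗ W.mkQ = W.mkQ ∘ₗ ρ m := W.mapQ_mkQ W (ρ m) (h := hW m)
      rw [← LinearMap.comp_assoc, ← h, LinearMap.comp_assoc, hs, LinearMap.comp_id]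
    have hbW : WeaklyBounded K ρW := by
      refine ih _ (Submodule.finrank_lt htop) ρW ?_ ?_ rfl
      · simpa only [hρW] using hSb.comp_comp W.subtype P
      · simpa only [hρW] using fun m => (hpow m).comp_comp W.subtype P
    have hbQ : WeaklyBounded K ρQ := by
      have hlt : finrank K (V ⧸ W) < finrank K V := by
        have h1 := W.finrank_quotient_add_finrank
        have h2 := Submodule.one_le_finrank_iff.2 hbot
        omega
      refine ih _ hlt ρQ ?_ ?_ rfl
      · simpa only [hρQ] using hSb.comp_comp s W.mkQ
      · simpa only [hρQ] using fun m => (hpow m).comp_comp s W.mkQ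
    let p : End K V := W.subtype ∘ₗ P
    let q : End K V := 1 - p
    have hqW : ∀ w ∈ W, q w = 0 := fun w hw => by
      have := congr(($(hPw ⟨w, hw⟩) : V))
      simpa [q, p, sub_eq_zero] using this.symm
    have hqp : q * p = 0 := by
      ext v
      exact hqW _ (P v).2
    let t : V ⧸ W →ₗ[K] V := W.liftQ q hqW
    refine weaklyBounded_of_blockTriangular ρ hS hSb (p := p) (q := q) (by simp [q]) ?_ ?_ ?_ ?_
    · rw [← hqp]; simp [q, mul_sub, sub_mul]
    · intro m
      ext v
      exact hqW _ (hW m _ (P v).2)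
    · convert hbW.comp_comp P W.subtype using 2 with m
      ext v
      exact congr(($(hPw (ρW m (P v))) : V))
    · convert hbQ.comp_comp (W.mkQ ∘ₗ q) t using 2 with m
      ext v
      rfl

end Ultrametric

/-- Descent of `weaklyBounded_of_closure_eq_top` from an algebraically closed extension. -/
theorem weaklyBounded_of_closure_eq_top_of_normedAlgebra {F : Type*} (L : Type*) [NormedField F]
    [NormedField L] [NormedAlgebra F L] [IsUltrametricDist L] [IsAlgClosed L]
    {V : Type*} [AddCommGroup V] [Module F V]
    [FiniteDimensional F V] {M : Type*} [Monoid M] (ρ : M →* End F V)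
    {S : Set M} (hS : Submonoid.closure S = ⊤) (hSb : WeaklyBounded F (fun s : S => ρ s))
    (hpow : ∀ m, WeaklyBounded F (fun n : ℕ => ρ (m ^ n))) :
    WeaklyBounded F ρ := by
  let T : End F V →ₐ[F] End L (TensorProduct F L V) := End.baseChangeHom F L V
  let ρL : M →* End L (TensorProduct F L V) := (T : End F V →* End L (TensorProduct F L V)).comp ρ
  have hb : WeaklyBounded L ρL :=
    weaklyBounded_of_closure_eq_top ρL hS (hSb.map_of_normedAlgebra T.toLinearMap)
      fun m => (hpow m).map_of_normedAlgebra T.toLinearMap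
  intro φ
  obtain ⟨y, hy⟩ := exists_dual_end_eq_trace_mul φ
  obtain ⟨C, hC⟩ := hb (LinearMap.trace L _ ∘ₗ LinearMap.mulRight L (T y))
  refine ⟨C, fun m => ?_⟩
  have h : LinearMap.trace L _ (T (ρ m) * T y) = algebraMap F L (φ (ρ m)) := by
    rw [hy, ← map_mul]
    exact LinearMap.trace_baseChange (ρ m * y) L
  rw [← norm_algebraMap' L, ← h]
  exact hC m

/-- A monoid of power bounded operators over a complete ultrametric field with a bounded
generating set is bounded. -/
theorem weaklyBounded_of_closure_eq_top_of_complete {F : Type*} [NontriviallyNormedField F]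
    [CompleteSpace F] [IsUltrametricDist F] {V : Type*} [AddCommGroup V] [Module F V]
    [FiniteDimensional F V] {M : Type*} [Monoid M] (ρ : M →* End F V)
    {S : Set M} (hS : Submonoid.closure S = ⊤) (hSb : WeaklyBounded F (fun s : S => ρ s))
    (hpow : ∀ m, WeaklyBounded F (fun n : ℕ => ρ (m ^ n))) :
    WeaklyBounded F ρ := by
  let _ : NormedField (AlgebraicClosure F) := spectralNorm.normedField F (AlgebraicClosure F)
  let _ : NormedAlgebra F (AlgebraicClosure F) := spectralNorm.normedAlgebra F (AlgebraicClosure F)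
  have : IsUltrametricDist (AlgebraicClosure F) :=
    IsUltrametricDist.isUltrametricDist_of_isNonarchimedean_norm isNonarchimedean_spectralNorm
  exact weaklyBounded_of_closure_eq_top_of_normedAlgebra (AlgebraicClosure F) ρ hS hSb hpow

section Normed

variable {F : Type*} [NontriviallyNormedField F] {E : Type*}
  [NormedAddCommGroup E] [NormedSpace F E] [FiniteDimensional F E] {ι : Type*}

theorem WeaklyBounded.exists_norm_le {x : ι → E} (hx : WeaklyBounded F x) :
    ∃ C : ℝ, ∀ i, ‖x i‖ ≤ C := by
  let b := finBasis F E
  choose C hC using fun k => hx (b.coord k)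
  refine ⟨∑ k, C k * ‖b k‖, fun i => ?_⟩
  rw [← b.sum_repr (x i)]
  refine (norm_sum_le _ _).trans (Finset.sum_le_sum fun k _ => ?_)
  rw [norm_smul]
  exact mul_le_mul_of_nonneg_right (hC k i) (norm_nonneg _)

theorem WeaklyBounded.of_norm_le [CompleteSpace F] {x : ι → E} {C : ℝ} (hx : ∀ i, ‖x i‖ ≤ C) :
    WeaklyBounded F x := fun φ =>
  ⟨‖φ.toContinuousLinearMap‖ * C, fun i => (φ.toContinuousLinearMap.le_opNorm (x i)).trans
    (mul_le_mul_of_nonneg_left (hx i) (norm_nonneg _))⟩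

theorem WeaklyBounded.toLinearMap_of_norm_le [CompleteSpace F] {x : ι → E →L[F] E} {C : ℝ}
    (hx : ∀ i, ‖x i‖ ≤ C) : WeaklyBounded F (fun i => (x i : E →ₗ[F] E)) :=
  (WeaklyBounded.of_norm_le hx).map (LinearMap.toContinuousLinearMap (𝕜 := F)).symm.toLinearMap

end Normed

/-- Let `V` be a finite-dimensional vector space over a non-archimedean local field `F`
(a nondiscrete locally compact field with ultrametric norm) and `G` a compactly generated
subgroup of `GL(V)` such that every two-sided orbit `{gⁿ v : n ∈ ℤ}` is relatively compact.
Then the closure of `G` in `GL(V)` is compact. -/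
theorem stmt4 {F : Type*} [NontriviallyNormedField F] [LocallyCompactSpace F]
    [IsUltrametricDist F]
    {V : Type*} [NormedAddCommGroup V] [NormedSpace F V] [FiniteDimensional F V]
    (G : Subgroup (V →L[F] V)ˣ)
    (hcg : ∃ S : Set (V →L[F] V)ˣ, IsCompact S ∧ Subgroup.closure S = G)
    (horb : ∀ g ∈ G, ∀ v : V,
      IsCompact (closure {w : V | ∃ n : ℤ, w = ((g ^ n : (V →L[F] V)ˣ) : V →L[F] V) v})) :
    IsCompact (closure (G : Set (V →L[F] V)ˣ)) := by
  have : ProperSpace F := ProperSpace.of_locallyCompactSpace F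
  have : CompleteSpace V := FiniteDimensional.complete F V
  have : ProperSpace (V →L[F] V) := FiniteDimensional.proper F _
  obtain ⟨S, hScomp, rfl⟩ := hcg
  set G := Subgroup.closure S
  let c : (V →L[F] V) →+* End F V := ContinuousLinearMap.toLinearMapRingHom
  let ρ : G →* End F V := ((c : (V →L[F] V) →* End F V).comp (Units.coeHom _)).comp G.subtype
  let T : Set G := (↑) ⁻¹' S
  have hT : Submonoid.closure (T ∪ T⁻¹) = ⊤ := by
    rw [← Subgroup.closure_toSubmonoid, Subgroup.closure_closure_coe_preimage,
      Subgroup.top_toSubmonoid]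
  have hTb : WeaklyBounded F (fun s : ↥(T ∪ T⁻¹) => ρ s) := by
    obtain ⟨C, hC⟩ := (hScomp.image Units.continuous_val).isBounded.exists_norm_le
    obtain ⟨D, hD⟩ := (hScomp.image Units.continuous_coe_inv).isBounded.exists_norm_le
    refine WeaklyBounded.toLinearMap_of_norm_le
      (x := fun s : ↥(T ∪ T⁻¹) => ((s : G) : (V →L[F] V)ˣ).val) (C := max C D) ?_
    rintro ⟨g, hg | hg⟩
    · exact (hC _ ⟨_, hg, rfl⟩).trans (le_max_left _ _)
    · refine (hD _ ⟨_, hg, ?_⟩).trans (le_max_right _ _)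
      simp
  have hpow : ∀ g : G, WeaklyBounded F (fun n : ℕ => ρ (g ^ n)) := by
    intro g
    obtain ⟨C, hC⟩ := banach_steinhaus
      (g := fun n : ℕ => ((g ^ n : G) : (V →L[F] V)ˣ).val) fun v => by
        obtain ⟨C, hC⟩ := (horb g g.2 v).isBounded.exists_norm_le
        exact ⟨C, fun n => hC _ (subset_closure ⟨n, by simp⟩)⟩
    exact WeaklyBounded.toLinearMap_of_norm_le hC
  obtain ⟨C, hC⟩ := ((weaklyBounded_of_closure_eq_top_of_complete ρ hT hTb hpow).map
    (LinearMap.toContinuousLinearMap (𝕜 := F)).toLinearMap).exists_norm_le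
  have hC' : ∀ g ∈ G, ‖(g : V →L[F] V)‖ ≤ C := fun g hg => hC ⟨g, hg⟩
  have hK : IsCompact (Units.embedProduct (V →L[F] V) ⁻¹'
      (Metric.closedBall 0 C ×ˢ (MulOpposite.unop ⁻¹' Metric.closedBall 0 C))) := by
    refine Units.isClosedEmbedding_embedProduct.isCompact_preimage
      ((isCompact_closedBall _ _).prod ?_)
    exact MulOpposite.opHomeomorph.symm.isClosedEmbedding.isCompact_preimage
      (isCompact_closedBall _ _)
  refine hK.closure_of_subset fun g hg => ?_
  simpa using ⟨hC' g hg, hC' g⁻¹ (inv_mem hg)⟩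
end

section
/- Let F be a non-archimedean local field and G a closed compactly generated subgroup of GL(n, F) such that C_g = {e} for every g ∈ G. Then G has a neighborhood basis of the identity consisting of compact open normal subgroups of G. -/
open Filter Topology Matrix

/-- A family of linear maps all of whose matrix coefficients are bounded. -/
def CoeffBounded {F ι E E' : Type*} [NormedField F] [AddCommGroup E] [Module F E]
    [AddCommGroup E'] [Module F E'] (T : ι → E →ₗ[F] E') : Prop :=
  ∀ (φ : Module.Dual F E') (v : E), ∃ C : ℝ, ∀ i, ‖φ (T i v)‖ ≤ C

namespace CoeffBounded

variable {F ι κ E E' E'' : Type*} [NormedField F] [AddCommGroup E] [Module F E]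
  [AddCommGroup E'] [Module F E'] [AddCommGroup E''] [Module F E'']

theorem add {T T' : ι → E →ₗ[F] E'} (h : CoeffBounded T) (h' : CoeffBounded T') :
    CoeffBounded fun i => T i + T' i := by
  intro φ v
  obtain ⟨C, hC⟩ := h φ v
  obtain ⟨C', hC'⟩ := h' φ v
  refine ⟨C + C', fun i => ?_⟩
  simpa using (norm_add_le _ _).trans (add_le_add (hC i) (hC' i))

theorem sub {T T' : ι → E →ₗ[F] E'} (h : CoeffBounded T) (h' : CoeffBounded T') :
    CoeffBounded fun i => T i - T' i := by
  intro φ v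
  obtain ⟨C, hC⟩ := h φ v
  obtain ⟨C', hC'⟩ := h' φ v
  refine ⟨C + C', fun i => ?_⟩
  simpa using (norm_sub_le _ _).trans (add_le_add (hC i) (hC' i))

theorem reindex {T : ι → E →ₗ[F] E'} (h : CoeffBounded T) (f : κ → ι) :
    CoeffBounded fun k => T (f k) := fun φ v => (h φ v).imp fun _ hC k => hC (f k)

theorem comp_right {T : ι → E' →ₗ[F] E''} (h : CoeffBounded T) (f : E →ₗ[F] E') :
    CoeffBounded fun i => T i ∘ₗ f := fun φ v => h φ (f v)

theorem comp_left {T : ι → E →ₗ[F] E'} (h : CoeffBounded T) (f : E' →ₗ[F] E'') :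
    CoeffBounded fun i => f ∘ₗ T i := fun φ v => h (φ ∘ₗ f) v

theorem comp [FiniteDimensional F E'] {T : ι → E' →ₗ[F] E''} {T' : κ → E →ₗ[F] E'}
    (h : CoeffBounded T) (h' : CoeffBounded T') :
    CoeffBounded fun p : ι × κ => T p.1 ∘ₗ T' p.2 := by
  intro φ v
  let b := Module.finBasis F E'
  choose C hC using fun j => h φ (b j)
  choose C' hC' using fun j => h' (b.coord j) v
  refine ⟨∑ j, C' j * C j, fun p => ?_⟩
  have e : T' p.2 v = ∑ j, b.coord j (T' p.2 v) • b j := (b.sum_repr _).symm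
  rw [LinearMap.comp_apply, e]
  simp only [map_sum, map_smul, smul_eq_mul]
  refine (norm_sum_le _ _).trans (Finset.sum_le_sum fun j _ => ?_)
  rw [norm_mul]
  exact mul_le_mul (hC' j p.2) (hC j p.1) (norm_nonneg _) ((norm_nonneg _).trans (hC' j p.2))

/-- Over an ultrametric field, boundedness passes to the additive subgroup generated. -/
theorem of_mem_closure [IsUltrametricDist F] {T : ι → E →ₗ[F] E'} {T' : κ → E →ₗ[F] E'}
    (h : CoeffBounded T) (hT' : ∀ k, T' k ∈ AddSubgroup.closure (Set.range T)) :
    CoeffBounded T' := by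
  intro φ v
  obtain ⟨C, hC⟩ := h φ v
  refine ⟨max C 0, fun k => ?_⟩
  refine AddSubgroup.closure_induction (p := fun t _ => ‖φ (t v)‖ ≤ max C 0) ?_ ?_ ?_ ?_ (hT' k)
  · rintro _ ⟨i, rfl⟩
    exact (hC i).trans (le_max_left _ _)
  · simp
  · intro s t _ _ hs ht
    rw [LinearMap.add_apply, map_add]
    exact (IsUltrametricDist.norm_add_le_max _ _).trans (max_le hs ht)
  · intro s _ hs
    simpa using hs

end CoeffBounded

/-- A representation generated by a bounded set is bounded as soon as its restriction to an
invariant subspace and the corresponding quotient representation are. -/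
theorem CoeffBounded.of_subrepresentation_of_quotient {F Γ E : Type*} [NormedField F]
    [IsUltrametricDist F] [Group Γ] [AddCommGroup E] [Module F E] [FiniteDimensional F E]
    (ρ : Representation F Γ E) (W : Submodule F E) (hW : ∀ g, W ≤ W.comap (ρ g))
    {S : Set Γ} (hS : Subgroup.closure S = ⊤) (hSb : CoeffBounded fun s : S => ρ s)
    (hsub : CoeffBounded fun g => ρ.subrepresentation W hW g)
    (hquot : CoeffBounded fun g => ρ.quotient W hW g) : CoeffBounded fun g => ρ g := by
  obtain ⟨π, hπ⟩ := W.subtype.exists_leftInverse_of_injective W.ker_subtype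
  obtain ⟨σ, hσ⟩ := W.mkQ.exists_rightInverse_of_surjective W.range_mkQ
  have hσ' : ∀ q, W.mkQ (σ q) = q := fun q => LinearMap.congr_fun hσ q
  have hπ' : ∀ w ∈ W, (π w : E) = w := fun w hw =>
    congrArg Subtype.val (LinearMap.congr_fun hπ ⟨w, hw⟩)
  have hQ : ∀ g v, ρ.quotient W hW g (W.mkQ v) = W.mkQ (ρ g v) := fun g v => rfl
  let b : Γ → (E ⧸ W) →ₗ[F] E := fun g => ρ g ∘ₗ σ - σ ∘ₗ ρ.quotient W hW g
  have hbW : ∀ g q, b g q ∈ W := fun g q => by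
    rw [← Submodule.Quotient.mk_eq_zero, ← Submodule.mkQ_apply]
    simp only [b, LinearMap.sub_apply, LinearMap.comp_apply, map_sub, hσ', ← hQ, sub_self]
  have hbmul : ∀ g h, b (g * h) = ρ g ∘ₗ b h + b g ∘ₗ ρ.quotient W hW h := fun g h => by
    ext q
    simp [b, map_mul]
  have hb1 : b 1 = 0 := by
    ext q
    simp [b]
  have hρW : CoeffBounded fun g => ρ g ∘ₗ W.subtype := hsub.comp_left W.subtype
  have hbS : CoeffBounded fun s : S => b s :=
    (hSb.comp_right σ).sub ((hquot.reindex _).comp_left σ)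
  have key := hρW.comp ((hbS.comp_left π).comp hquot)
  let P : Γ × (S × Γ) → (E ⧸ W) →ₗ[F] E := fun p =>
    (ρ p.1 ∘ₗ W.subtype) ∘ₗ ((π ∘ₗ b p.2.1) ∘ₗ ρ.quotient W hW p.2.2)
  have hP : ∀ p, P p = ρ p.1 ∘ₗ b p.2.1 ∘ₗ ρ.quotient W hW p.2.2 := fun p => by
    refine LinearMap.ext fun q => ?_
    simp only [P, LinearMap.comp_apply, Submodule.subtype_apply]
    rw [hπ' _ (hbW _ _)]
  let N := AddSubgroup.closure (Set.range P)
  have hN : ∀ g h, ∀ t ∈ N, ρ g ∘ₗ t ∘ₗ ρ.quotient W hW h ∈ N := by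
    intro g h t ht
    induction ht using AddSubgroup.closure_induction with
    | mem x hx =>
      obtain ⟨⟨g', s, h'⟩, rfl⟩ := hx
      refine AddSubgroup.subset_closure ⟨⟨g * g', s, h' * h⟩, ?_⟩
      rw [hP, hP]
      simp only [map_mul]
      rfl
    | zero => simp
    | add x y _ _ hx hy =>
      rw [LinearMap.add_comp, LinearMap.comp_add]
      exact N.add_mem hx hy
    | neg x _ hx =>
      rw [LinearMap.neg_comp, LinearMap.comp_neg]
      exact N.neg_mem hx
  have hNl : ∀ g, ∀ t ∈ N, ρ g ∘ₗ t ∈ N := fun g t ht => by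
    have := hN g 1 t ht
    rwa [map_one, Module.End.one_eq_id, LinearMap.comp_id] at this
  have hNr : ∀ g, ∀ t ∈ N, t ∘ₗ ρ.quotient W hW g ∈ N := fun g t ht => by
    have := hN 1 g t ht
    rwa [map_one, Module.End.one_eq_id, LinearMap.id_comp] at this
  have hbN : ∀ g, b g ∈ N := by
    intro g
    have hg : g ∈ Subgroup.closure S := hS ▸ Subgroup.mem_top g
    induction hg using Subgroup.closure_induction with
    | mem s hs =>
      refine AddSubgroup.subset_closure ⟨⟨1, ⟨s, hs⟩, 1⟩, ?_⟩
      rw [hP]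
      simp only [map_one]
      rfl
    | one => rw [hb1]; exact N.zero_mem
    | mul g h _ _ hg hh =>
      rw [hbmul]
      exact N.add_mem (hNl _ _ hh) (hNr _ _ hg)
    | inv g _ hg =>
      have h0 := hbmul g⁻¹ g
      rw [inv_mul_cancel, hb1] at h0
      have h1 : b g⁻¹ = -(ρ g⁻¹ ∘ₗ b g ∘ₗ ρ.quotient W hW g⁻¹) := by
        have h2 := congrArg (fun t => t ∘ₗ ρ.quotient W hW g⁻¹) h0
        have h3 : ρ.quotient W hW g ∘ₗ ρ.quotient W hW g⁻¹ = LinearMap.id := by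
          rw [← Module.End.mul_eq_comp, ← map_mul, mul_inv_cancel, map_one]
          rfl
        simp only [LinearMap.zero_comp, LinearMap.add_comp, LinearMap.comp_assoc, h3,
          LinearMap.comp_id] at h2
        exact eq_neg_of_add_eq_zero_right h2.symm
      rw [h1]
      exact N.neg_mem (hN _ _ _ hg)
  have hb : CoeffBounded b := key.of_mem_closure hbN
  have hfin : (fun g => ρ g) = fun g =>
      (ρ g ∘ₗ W.subtype) ∘ₗ (π ∘ₗ (LinearMap.id - σ ∘ₗ W.mkQ)) +
        (b g ∘ₗ W.mkQ + σ ∘ₗ (ρ.quotient W hW g ∘ₗ W.mkQ)) := by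
    funext g
    refine LinearMap.ext fun v => ?_
    have hv : v - σ (W.mkQ v) ∈ W := by
      rw [← Submodule.Quotient.mk_eq_zero, ← Submodule.mkQ_apply, map_sub, hσ', sub_self]
    simp only [LinearMap.add_apply, LinearMap.comp_apply, Submodule.subtype_apply,
      LinearMap.sub_apply, LinearMap.id_apply, b]
    rw [hπ' _ hv, map_sub]
    abel
  rw [hfin]
  exact (hρW.comp_right _).add ((hb.comp_right _).add ((hquot.comp_right _).comp_left σ))

theorem norm_det_one_sub_le_one {F ι : Type*} [NormedField F] [IsUltrametricDist F]
    [Fintype ι] [DecidableEq ι] {M : Matrix ι ι F}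
    (hM : ∃ C : ℝ, ∀ (k : ℕ) (i j : ι), ‖(M ^ k) i j‖ ≤ C) : ‖(1 - M).det‖ ≤ 1 := by
  obtain ⟨C, hC⟩ := hM
  have hbin : ∀ (k : ℕ) (i j : ι), ‖((1 - M) ^ k) i j‖ ≤ max C 0 := by
    intro k i j
    rw [sub_eq_neg_add, (Commute.one_right (-M)).add_pow, Matrix.sum_apply]
    refine IsUltrametricDist.norm_sum_le_of_forall_le_of_nonneg (le_max_right _ _) fun m _ => ?_
    have e : ((-M) ^ m * 1 ^ (k - m) * ((k.choose m : ℕ) : Matrix ι ι F)) i j =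
        (-1) ^ m * ((k.choose m : ℕ) : F) * (M ^ m) i j := by
      rw [one_pow, mul_one, neg_pow, ← nsmul_eq_mul', Matrix.smul_apply, nsmul_eq_mul]
      rcases neg_one_pow_eq_or F m with h | h <;>
        rcases neg_one_pow_eq_or (Matrix ι ι F) m with h' | h' <;>
        rcases Nat.even_or_odd m with h'' | h'' <;> simp [h'']
    rw [e, norm_mul, norm_mul, norm_pow, norm_neg, norm_one, one_pow, one_mul]
    refine (mul_le_of_le_one_left (norm_nonneg _)
      (IsUltrametricDist.norm_natCast_le_one F _)).trans ((hC m i j).trans (le_max_left _ _))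
  by_contra! hdet
  obtain ⟨k, hk⟩ := (tendsto_pow_atTop_atTop_of_one_lt hdet).eventually_gt_atTop
    ((Fintype.card ι).factorial • max C 0 ^ Fintype.card ι) |>.exists
  rw [← norm_pow, ← Matrix.det_pow] at hk
  exact hk.not_ge (Matrix.det_le (abv := NormedField.toAbsoluteValue F) (hbin k))

/-- A limit of matrices `c i • M i`, where the `M i` are power-bounded and `c i → 0`,
is nilpotent. -/
theorem isNilpotent_of_tendsto_smul {F ι : Type*} [NontriviallyNormedField F]
    [IsUltrametricDist F] [Fintype ι] [DecidableEq ι] {M : ℕ → Matrix ι ι F}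
    (hM : ∀ i, ∃ C : ℝ, ∀ (k : ℕ) (a b : ι), ‖(M i ^ k) a b‖ ≤ C) {c : ℕ → F}
    (hc : Tendsto c atTop (𝓝 0)) {p : Matrix ι ι F}
    (hp : Tendsto (fun i => c i • M i) atTop (𝓝 p)) : IsNilpotent p := by
  have hdet : ∀ t : F, ‖(1 - t • p).det‖ ≤ 1 := by
    intro t
    have hcont : Continuous fun A : Matrix ι ι F => ‖(1 - t • A).det‖ := by fun_prop
    refine le_of_tendsto ((hcont.tendsto p).comp hp) ?_
    have ht : Tendsto (fun i => ‖t * c i‖) atTop (𝓝 0) := by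
      simpa using (hc.const_mul t).norm
    filter_upwards [ht.eventually_le_const one_pos] with i hi
    refine norm_det_one_sub_le_one ((hM i).imp fun C hC k a b => ?_)
    rw [smul_smul, smul_pow, Matrix.smul_apply, smul_eq_mul, norm_mul, norm_pow]
    exact (mul_le_of_le_one_left (norm_nonneg _) (pow_le_one₀ (norm_nonneg _) hi)).trans (hC k a b)
  have heval : ∀ t : F, p.charpolyRev.eval t = (1 - t • p).det := by
    intro t
    rw [Matrix.charpolyRev, ← Polynomial.coe_evalRingHom, RingHom.map_det]
    congr 1
    ext a b
    simp [Matrix.one_apply, apply_ite (Polynomial.eval t), mul_comm t]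
  have hdeg : p.charpolyRev.degree ≤ 0 := by
    by_contra! hpos
    have hz : ∀ n : ℕ, ∃ z : F, (n : ℝ) < ‖z‖ := fun n => NormedField.exists_lt_norm F n
    choose z hz using hz
    have hz' : Tendsto (fun n => ‖z n‖) atTop atTop :=
      tendsto_atTop_mono (fun n => (hz n).le) tendsto_natCast_atTop_atTop
    obtain ⟨n, hn⟩ := ((Polynomial.tendsto_norm_atTop _ hpos hz').eventually_gt_atTop 1).exists
    rw [heval] at hn
    exact hn.not_ge (hdet _)
  have hone : p.charpolyRev = 1 := by
    have h1 := Polynomial.eq_C_of_degree_le_zero hdeg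
    have h2 := Matrix.eval_charpolyRev (M := p)
    rw [h1, Polynomial.eval_C] at h2
    rw [h1, h2, Polynomial.C_1]
  have hchar : p.charpoly = Polynomial.X ^ p.charpoly.natDegree := by
    have h := Matrix.reverse_charpoly p
    rw [hone] at h
    rw [← Polynomial.reflect_one, ← h, Polynomial.reverse, Polynomial.reflect_reflect]
  refine ⟨p.charpoly.natDegree, ?_⟩
  have h := Matrix.aeval_self_charpoly p
  rwa [hchar, map_pow, Polynomial.aeval_X] at h

/-- If `p` has minimal rank among the nonzero elements of a class `P` of endomorphisms such that
`p * h * p` lies in `P` and `p * h` is nilpotent, then `p * h * p = 0`. -/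
theorem mul_mul_eq_zero_of_isNilpotent {F E : Type*} [Field F] [AddCommGroup E] [Module F E]
    [FiniteDimensional F E] {p h : Module.End F E} (hnil : IsNilpotent (p * h))
    (hmin : p * h * p ≠ 0 → Module.finrank F (LinearMap.range p) ≤
      Module.finrank F (LinearMap.range (p * h * p))) : p * h * p = 0 := by
  by_contra hne
  have hle : LinearMap.range (p * h * p) ≤ LinearMap.range p := by
    rw [mul_assoc]
    exact LinearMap.range_comp_le_range _ _
  have heq := Submodule.eq_of_le_of_finrank_le hle (hmin hne)
  have hpow : ∀ k : ℕ, LinearMap.range ((p * h) ^ k * p) = LinearMap.range p := by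
    intro k
    induction k with
    | zero => simp
    | succ k ih =>
      rw [pow_succ', mul_assoc, Module.End.mul_eq_comp, LinearMap.range_comp, ih,
        ← LinearMap.range_comp, ← Module.End.mul_eq_comp, heq]
  obtain ⟨k, hk⟩ := hnil
  have h0 := hpow k
  rw [hk, zero_mul, LinearMap.range_zero] at h0
  have : p = 0 := LinearMap.range_eq_bot.mp h0.symm
  exact hne (by rw [this, mul_zero])

open scoped Matrix.Norms.Elementwise in
theorem Representation.exists_tendsto_smul_of_not_coeffBounded {F Γ E ι : Type*}
    [NontriviallyNormedField F] [LocallyCompactSpace F] [Group Γ] [AddCommGroup E] [Module F E]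
    [Fintype ι] [DecidableEq ι] (b : Module.Basis ι F E) (ρ : Representation F Γ E)
    (h : ¬ CoeffBounded fun g => ρ g) :
    ∃ p : Matrix ι ι F, p ≠ 0 ∧ ∃ (c : ℕ → F) (g : ℕ → Γ), Tendsto c atTop (𝓝 0) ∧
      Tendsto (fun i => c i • LinearMap.toMatrix b b (ρ (g i))) atTop (𝓝 p) := by
  have : ProperSpace F := .of_locallyCompactSpace F
  have : ProperSpace (Matrix ι ι F) := FiniteDimensional.proper F _
  have : FirstCountableTopology (Matrix ι ι F) :=
    inferInstanceAs (FirstCountableTopology (ι → ι → F))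
  have hunb : ∀ n : ℕ, ∃ g, (n : ℝ) < ‖LinearMap.toMatrix b b (ρ g)‖ := by
    by_contra! hb
    obtain ⟨n, hn⟩ := hb
    refine h fun φ v => ⟨∑ j, ∑ i, ‖b.repr v j‖ * (n * ‖φ (b i)‖), fun g => ?_⟩
    have e : φ (ρ g v) = ∑ j, ∑ i,
        b.repr v j * (LinearMap.toMatrix b b (ρ g) i j * φ (b i)) := by
      conv_lhs => rw [← b.sum_repr v]
      simp only [map_sum, map_smul, smul_eq_mul]
      refine Finset.sum_congr rfl fun j _ => ?_
      conv_lhs => rw [← b.sum_repr (ρ g (b j))]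
      simp only [map_sum, map_smul, smul_eq_mul, Finset.mul_sum, LinearMap.toMatrix_apply]
    rw [e]
    refine (norm_sum_le _ _).trans (Finset.sum_le_sum fun j _ =>
      (norm_sum_le _ _).trans (Finset.sum_le_sum fun i _ => ?_))
    rw [norm_mul, norm_mul]
    gcongr
    exact (Matrix.norm_entry_le_entrywise_sup_norm _).trans (hn g)
  choose g hg using hunb
  obtain ⟨a, ha⟩ := NormedField.exists_one_lt_norm F
  have hg0 : ∀ n, LinearMap.toMatrix b b (ρ (g n)) ≠ 0 := fun n h0 => by
    have := hg n
    rw [h0, norm_zero] at this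
    exact absurd this (not_lt.mpr n.cast_nonneg)
  choose c hc0 hc1 hc2 hc3 using fun n => rescale_to_shell ha one_pos (hg0 n)
  have hshell : IsCompact
      (Metric.closedBall (0 : Matrix ι ι F) 1 ∩ {A | 1 / ‖a‖ ≤ ‖A‖}) :=
    (isCompact_closedBall _ _).inter_right (isClosed_le continuous_const continuous_norm)
  obtain ⟨p, hp, φ, hφ, hlim⟩ := hshell.tendsto_subseq
    (x := fun n => c n • LinearMap.toMatrix b b (ρ (g n)))
    fun n => ⟨by simpa using (hc1 n).le, hc2 n⟩
  refine ⟨p, ?_, c ∘ φ, g ∘ φ, ?_, hlim⟩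
  · rintro rfl
    have := hp.2
    rw [Set.mem_ofPred_eq, norm_zero] at this
    exact absurd this (not_le.mpr (by positivity))
  · refine Tendsto.comp ?_ hφ.tendsto_atTop
    rw [tendsto_zero_iff_norm_tendsto_zero]
    refine squeeze_zero' (Eventually.of_forall fun _ => norm_nonneg _)
      ?_ (tendsto_inv_atTop_zero.comp (tendsto_natCast_atTop_atTop (R := ℝ)))
    filter_upwards [eventually_gt_atTop 0] with n hn
    have hn' : (0 : ℝ) < n := Nat.cast_pos.mpr hn
    have h1 := hc1 n
    rw [norm_smul] at h1
    rw [Function.comp_apply, le_inv_comm₀ (norm_pos_iff.mpr (hc0 n)) hn']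
    rw [← lt_div_iff₀' (norm_pos_iff.mpr (hc0 n)), one_div] at h1
    exact (hg n).le.trans h1.le

/-- A representation by power-bounded operators which is not bounded is reducible. -/
theorem Representation.exists_invariant_of_not_coeffBounded {F Γ E : Type*}
    [NontriviallyNormedField F] [LocallyCompactSpace F] [IsUltrametricDist F] [Group Γ]
    [AddCommGroup E] [Module F E] [FiniteDimensional F E] (ρ : Representation F Γ E)
    (hpow : ∀ g, CoeffBounded fun k : ℕ => ρ (g ^ k)) (h : ¬ CoeffBounded fun g => ρ g) :
    ∃ W : Submodule F E, W ≠ ⊥ ∧ W ≠ ⊤ ∧ ∀ g, W ≤ W.comap (ρ g) := by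
  let b := Module.finBasis F E
  let m : Module.End F E ≃ₐ[F] _ := LinearMap.toMatrixAlgEquiv b
  let P : Module.End F E → Prop := fun p => ∃ (c : ℕ → F) (g : ℕ → Γ), Tendsto c atTop (𝓝 0) ∧
    Tendsto (fun i => c i • m (ρ (g i))) atTop (𝓝 (m p))
  have hPnil : ∀ p, P p → IsNilpotent p := by
    rintro p ⟨c, g, hc, hp⟩
    have hn : IsNilpotent (m p) := by
      refine isNilpotent_of_tendsto_smul (fun i => ?_) hc hp
      choose C hC using fun (x y : Fin _) => hpow (g i) (b.coord x) (b y)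
      refine ⟨∑ x, ∑ y, |C x y|, fun k x y => ?_⟩
      have e : (m (ρ (g i)) ^ k) x y = b.coord x (ρ (g i ^ k) (b y)) := by
        rw [← map_pow, ← map_pow]
        exact LinearMap.toMatrixAlgEquiv_apply b _ x y
      rw [e]
      refine (hC x y k).trans ((le_abs_self _).trans ?_)
      refine le_trans ?_ (Finset.single_le_sum (f := fun x => ∑ y, |C x y|)
        (fun _ _ => Finset.sum_nonneg fun _ _ => abs_nonneg _) (Finset.mem_univ x))
      exact Finset.single_le_sum (f := fun y => |C x y|)
        (fun _ _ => abs_nonneg _) (Finset.mem_univ y)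
    exact (IsNilpotent.map_iff m.injective).mp hn
  have hPmul : ∀ p, P p → ∀ h, P (p * ρ h) := by
    rintro p ⟨c, g, hc, hp⟩ h
    refine ⟨c, fun i => g i * h, hc, ?_⟩
    rw [map_mul]
    refine (hp.mul_const (m (ρ h))).congr fun i => ?_
    rw [map_mul, map_mul, smul_mul_assoc]
  have hPmulmul : ∀ p, P p → ∀ h, P (p * ρ h * p) := by
    rintro p ⟨c, g, hc, hp⟩ h
    refine ⟨fun i => c i * c i, fun i => g i * h * g i, by simpa using hc.mul hc, ?_⟩
    rw [map_mul, map_mul]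
    refine ((hp.mul_const (m (ρ h))).mul hp).congr fun i => ?_
    rw [map_mul, map_mul, map_mul, map_mul, smul_mul_assoc, smul_mul_smul_comm]
  have hex : ∃ p, p ≠ 0 ∧ P p := by
    obtain ⟨p, hp0, c, g, hc, hp⟩ := ρ.exists_tendsto_smul_of_not_coeffBounded b h
    refine ⟨m.symm p, by simpa using hp0, c, g, hc, ?_⟩
    rw [AlgEquiv.apply_symm_apply]
    exact hp
  obtain ⟨p, ⟨hp0, hp⟩, hmin⟩ := exists_minimalFor_of_wellFoundedLT
    (fun p : Module.End F E => p ≠ 0 ∧ P p)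
    (fun p => Module.finrank F (LinearMap.range p)) hex
  have hzero : ∀ g, p * ρ g * p = 0 := fun g =>
    mul_mul_eq_zero_of_isNilpotent (hPnil _ (hPmul p hp g)) fun hne =>
      (le_total _ _).elim id (hmin ⟨hne, hPmulmul p hp g⟩)
  refine ⟨⨆ g, LinearMap.range (ρ g * p), ?_, ?_, ?_⟩
  · intro hbot
    refine hp0 (LinearMap.range_eq_bot.mp (le_bot_iff.mp (hbot ▸ ?_)))
    exact le_iSup_of_le (f := fun g => LinearMap.range (ρ g * p)) 1 (by simp)
  · intro htop
    have hker : (⨆ g, LinearMap.range (ρ g * p)) ≤ LinearMap.ker p := by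
      refine iSup_le fun g => ?_
      rintro _ ⟨v, rfl⟩
      have := LinearMap.congr_fun (hzero g) v
      simpa [mul_assoc] using this
    rw [htop, top_le_iff, LinearMap.ker_eq_top] at hker
    exact hp0 hker
  · intro g
    refine iSup_le fun h => ?_
    rintro _ ⟨v, rfl⟩
    refine Submodule.mem_iSup_of_mem (g * h) ⟨v, ?_⟩
    rw [map_mul]
    rfl

theorem CoeffBounded.subrepresentation {F Γ κ E : Type*} [NormedField F] [Monoid Γ]
    [AddCommGroup E] [Module F E] (ρ : Representation F Γ E) (W : Submodule F E)
    (hW : ∀ g, W ≤ W.comap (ρ g)) {f : κ → Γ} (hf : CoeffBounded fun k => ρ (f k)) :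
    CoeffBounded fun k => ρ.subrepresentation W hW (f k) := by
  intro φ v
  obtain ⟨ψ, hψ⟩ := LinearMap.exists_extend φ
  refine (hf ψ v).imp fun C hC k => ?_
  have : φ (ρ.subrepresentation W hW (f k) v) = ψ (ρ (f k) v) := by
    rw [← hψ]
    rfl
  rw [this]
  exact hC k

theorem CoeffBounded.quotient {F Γ κ E : Type*} [NormedField F] [Monoid Γ]
    [AddCommGroup E] [Module F E] (ρ : Representation F Γ E) (W : Submodule F E)
    (hW : ∀ g, W ≤ W.comap (ρ g)) {f : κ → Γ} (hf : CoeffBounded fun k => ρ (f k)) :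
    CoeffBounded fun k => ρ.quotient W hW (f k) := by
  intro φ q
  obtain ⟨v, rfl⟩ := W.mkQ_surjective q
  exact hf (φ ∘ₗ W.mkQ) v

/-- A finite-dimensional representation over a non-archimedean local field which is generated by
a bounded set and in which every element is power-bounded, is bounded. -/
theorem Representation.coeffBounded_of_powers {F : Type*} [NontriviallyNormedField F]
    [LocallyCompactSpace F] [IsUltrametricDist F] {Γ : Type*} [Group Γ] {S : Set Γ}
    (hS : Subgroup.closure S = ⊤) {E : Type*} [AddCommGroup E] [Module F E]
    [FiniteDimensional F E] (ρ : Representation F Γ E) (hSb : CoeffBounded fun s : S => ρ s)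
    (hpow : ∀ g, CoeffBounded fun k : ℕ => ρ (g ^ k)) : CoeffBounded fun g => ρ g := by
  induction hd : Module.finrank F E using Nat.strong_induction_on generalizing E with
  | _ d ih =>
    by_contra hub
    obtain ⟨W, hbot, htop, hW⟩ := ρ.exists_invariant_of_not_coeffBounded hpow hub
    refine hub (CoeffBounded.of_subrepresentation_of_quotient ρ W hW hS hSb ?_ ?_)
    · refine ih _ ?_ (ρ.subrepresentation W hW) (.subrepresentation ρ W hW hSb)
        (fun g => .subrepresentation ρ W hW (hpow g)) rfl
      exact hd ▸ Submodule.finrank_lt (lt_top_iff_ne_top.mpr htop).ne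
    · refine ih _ ?_ (ρ.quotient W hW) (.quotient ρ W hW hSb)
        (fun g => .quotient ρ W hW (hpow g)) rfl
      have h1 := W.finrank_quotient_add_finrank
      have h2 : 0 < Module.finrank F W := Module.finrank_pos_iff.mpr
        ((Submodule.nontrivial_iff_ne_bot).mpr hbot)
      omega

/-- The subspace of vectors with bounded image under a family of endomorphisms. -/
def boundedOrbit {F ι E : Type*} [NormedField F] [NormedAddCommGroup E] [NormedSpace F E]
    (T : ι → Module.End F E) : Submodule F E where
  carrier := {v | ∃ C : ℝ, ∀ i, ‖T i v‖ ≤ C}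
  zero_mem' := ⟨0, fun i => by simp⟩
  add_mem' := by
    rintro v w ⟨C, hC⟩ ⟨D, hD⟩
    exact ⟨C + D, fun i => by
      rw [map_add]
      exact (norm_add_le _ _).trans (add_le_add (hC i) (hD i))⟩
  smul_mem' := by
    rintro a v ⟨C, hC⟩
    exact ⟨‖a‖ * C, fun i => by
      rw [map_smul, norm_smul]
      exact mul_le_mul_of_nonneg_left (hC i) (norm_nonneg a)⟩

theorem exists_bound_of_le_boundedOrbit {F ι E : Type*} [NontriviallyNormedField F]
    [CompleteSpace F] [NormedAddCommGroup E] [NormedSpace F E] [FiniteDimensional F E]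
    {T : ι → Module.End F E} {W : Submodule F E} (hW : W ≤ boundedOrbit T) :
    ∃ C : ℝ, 0 < C ∧ ∀ v ∈ W, ∀ i, ‖T i v‖ ≤ C * ‖v‖ := by
  have : CompleteSpace W := FiniteDimensional.complete F W
  obtain ⟨C, hC⟩ := banach_steinhaus
    (g := fun i => LinearMap.toContinuousLinearMap (T i ∘ₗ W.subtype)) fun w => hW w.2
  refine ⟨max C 1, lt_max_of_lt_right one_pos, fun v hv i => ?_⟩
  exact ((LinearMap.toContinuousLinearMap (T i ∘ₗ W.subtype)).le_of_opNorm_le (hC i) ⟨v, hv⟩).trans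
    (mul_le_mul_of_nonneg_right (le_max_left _ _) (norm_nonneg _))

theorem CoeffBounded.subrepresentation_of_le_boundedOrbit {F Γ κ E : Type*}
    [NontriviallyNormedField F] [CompleteSpace F] [Monoid Γ] [NormedAddCommGroup E]
    [NormedSpace F E] [FiniteDimensional F E] (ρ : Representation F Γ E) {W : Submodule F E}
    (hW : ∀ g, W ≤ W.comap (ρ g)) {f : κ → Γ} (h : W ≤ boundedOrbit fun k => ρ (f k)) :
    CoeffBounded fun k => ρ.subrepresentation W hW (f k) := by
  intro φ v
  obtain ⟨ψ, hψ⟩ := LinearMap.exists_extend φ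
  obtain ⟨C, hC⟩ := h v.2
  refine ⟨‖LinearMap.toContinuousLinearMap ψ‖ * C, fun k => ?_⟩
  have : φ (ρ.subrepresentation W hW (f k) v) = ψ (ρ (f k) v) := by
    rw [← hψ]
    rfl
  rw [this]
  exact (LinearMap.toContinuousLinearMap ψ).le_opNorm_of_le (hC k)

open scoped Matrix.Norms.Elementwise in
theorem le_boundedOrbit_of_coeffBounded_subrepresentation {F ι Γ : Type*}
    [NontriviallyNormedField F] [Fintype ι] [Monoid Γ]
    (ρ : Representation F Γ (Matrix ι ι F)) {W : Submodule F (Matrix ι ι F)}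
    (hW : ∀ g, W ≤ W.comap (ρ g)) (h : CoeffBounded fun g => ρ.subrepresentation W hW g) :
    W ≤ boundedOrbit fun g => ρ g := by
  intro v hv
  choose C hC using fun i j => h (Matrix.entryLinearMap F F i j ∘ₗ W.subtype) ⟨v, hv⟩
  refine ⟨∑ i, ∑ j, |C i j|, fun g => (Matrix.norm_le_iff (by positivity)).mpr fun i j => ?_⟩
  refine (hC i j g).trans ((le_abs_self _).trans ?_)
  refine le_trans ?_ (Finset.single_le_sum (f := fun i => ∑ j, |C i j|)
    (fun _ _ => Finset.sum_nonneg fun _ _ => abs_nonneg _) (Finset.mem_univ i))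
  exact Finset.single_le_sum (f := fun j => |C i j|)
    (fun _ _ => abs_nonneg _) (Finset.mem_univ j)

/-- The conjugation representation of the general linear group on matrices. -/
def conjRepresentation (ι F : Type*) [Fintype ι] [DecidableEq ι] [Field F] :
    Representation F (GL ι F) (Matrix ι ι F) where
  toFun g := LinearMap.mulLeft F (g : Matrix ι ι F) ∘ₗ
    LinearMap.mulRight F ((g⁻¹ : GL ι F) : Matrix ι ι F)
  map_one' := by ext1 v; simp
  map_mul' g h := by
    refine LinearMap.ext fun v => ?_
    simp only [LinearMap.comp_apply, LinearMap.mulLeft_apply, LinearMap.mulRight_apply,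
      Module.End.mul_apply, _root_.mul_inv_rev, Units.val_mul, mul_assoc]

theorem conjRepresentation_apply {ι F : Type*} [Fintype ι] [DecidableEq ι] [Field F]
    (g : GL ι F) (v : Matrix ι ι F) :
    conjRepresentation ι F g v = g * v * (g⁻¹ : GL ι F) := by
  simp [conjRepresentation, mul_assoc]

theorem conjRepresentation_val {ι F : Type*} [Fintype ι] [DecidableEq ι] [Field F]
    (g x : GL ι F) : conjRepresentation ι F g x = (g * x * g⁻¹ : GL ι F) := by
  simp [conjRepresentation_apply]

theorem conjRepresentation_one {ι F : Type*} [Fintype ι] [DecidableEq ι] [Field F]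
    (g : GL ι F) : conjRepresentation ι F g 1 = 1 := by
  simp [conjRepresentation_apply]

/-- If every element whose backward `g`-orbit stays in the compact open set `U` is conjugated by `g`
into `U`, then all elements close to `1` have their forward `g`-orbit in `U`. -/
theorem setOf_forall_conj_pow_mem_mem_nhds_one {G : Type*} [Group G] [TopologicalSpace G]
    [IsTopologicalGroup G] {U : Set G} (hUc : IsCompact U) (hUo : IsClopen U) (h1 : 1 ∈ U)
    (g : G) (hg : ∀ y, (∀ k : ℕ, (g ^ k)⁻¹ * y * g ^ k ∈ U) → g * y * g⁻¹ ∈ U) :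
    {x | ∀ k : ℕ, g ^ k * x * (g ^ k)⁻¹ ∈ U} ∈ 𝓝 (1 : G) := by
  by_contra hW
  let t : ℕ → Set G := fun j =>
    U ∩ {y | g * y * g⁻¹ ∉ U} ∩ {y | ∀ k ≤ j, (g ^ k)⁻¹ * y * g ^ k ∈ U}
  have hcl : ∀ j, IsClosed (t j) := fun j => by
    refine (hUo.1.inter ?_).inter ?_
    · exact hUo.2.isClosed_compl.preimage (f := fun y => g * y * g⁻¹) (by fun_prop)
    · simp only [Set.ofPred_forall]
      exact isClosed_iInter fun k => isClosed_iInter fun _ =>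
        hUo.1.preimage (f := fun y => (g ^ k)⁻¹ * y * g ^ k) (by fun_prop)
  have hne : ∀ j, (t j).Nonempty := by
    intro j
    have hj : {x | ∀ k ∈ Finset.range (j + 1), g ^ k * x * (g ^ k)⁻¹ ∈ U} ∈ 𝓝 (1 : G) := by
      simp only [Set.ofPred_forall]
      refine (Filter.biInter_finset_mem _).mpr fun k _ => ?_
      exact (hUo.2.preimage (f := fun y => g ^ k * y * (g ^ k)⁻¹) (by fun_prop)).mem_nhds
        (by simpa using h1)
    obtain ⟨x, hxj, hxW⟩ : ∃ x, (∀ k ∈ Finset.range (j + 1), g ^ k * x * (g ^ k)⁻¹ ∈ U) ∧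
        ∃ k : ℕ, g ^ k * x * (g ^ k)⁻¹ ∉ U := by
      by_contra! hx
      exact hW (mem_of_superset hj hx)
    classical
    let N := Nat.find hxW
    have hN : g ^ N * x * (g ^ N)⁻¹ ∉ U := Nat.find_spec hxW
    have hNmin : ∀ k < N, g ^ k * x * (g ^ k)⁻¹ ∈ U := fun k hk => not_not.mp (Nat.find_min hxW hk)
    have hjN : j + 1 ≤ N := by
      by_contra! hlt
      exact hN (hxj _ (Finset.mem_range.mpr hlt))
    obtain ⟨M, hM⟩ : ∃ M, N = M + 1 := ⟨N - 1, by omega⟩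
    refine ⟨g ^ M * x * (g ^ M)⁻¹, ⟨hNmin M (by omega), ?_⟩, fun k hk => ?_⟩
    · rw [hM] at hN
      convert hN using 1
      rw [pow_succ']
      group
    · convert hNmin (M - k) (by omega) using 1
      rw [pow_sub g (by omega : k ≤ M)]
      group
  obtain ⟨y, hy⟩ := IsCompact.nonempty_iInter_of_sequence_nonempty_isCompact_isClosed t
    (fun j y hy => ⟨hy.1, fun k hk => hy.2 k (by omega)⟩) hne
    (hUc.of_isClosed_subset (hcl 0) fun y hy => hy.1.1) hcl
  rw [Set.mem_iInter] at hy
  exact (hy 0).1.2 (hg y fun k => (hy k).2 k le_rfl)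

/-- A compact open neighbourhood of the identity contains an open compact subgroup. -/
theorem exists_subgroup_isCompact_isOpen_subset {G : Type*} [Group G] [TopologicalSpace G]
    [IsTopologicalGroup G] {U : Set G} (hUc : IsCompact U) (hUo : IsClopen U) (h1 : 1 ∈ U) :
    ∃ H : Subgroup G, IsCompact (H : Set G) ∧ IsOpen (H : Set G) ∧ (H : Set G) ⊆ U := by
  let H : Subgroup G :=
    { carrier := {x | ∀ u ∈ U, x * u ∈ U ∧ x⁻¹ * u ∈ U}
      one_mem' := by simp
      mul_mem' := fun {x y} hx hy u hu => by
        refine ⟨?_, ?_⟩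
        · rw [mul_assoc]
          exact (hx _ (hy u hu).1).1
        · rw [_root_.mul_inv_rev, mul_assoc]
          exact (hy _ (hx u hu).2).2
      inv_mem' := fun {x} hx u hu => by
        rw [inv_inv]
        exact (hx u hu).symm }
  have hHU : (H : Set G) ⊆ U := fun x hx => by simpa using (hx 1 h1).1
  have hHo : IsOpen (H : Set G) := by
    refine H.isOpen_of_mem_nhds (g := 1) ?_
    refine hUc.eventually_forall_of_forall_eventually fun u hu => ?_
    have ho : IsOpen {z : G × G | z.1 * z.2 ∈ U ∧ z.1⁻¹ * z.2 ∈ U} :=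
      (hUo.2.preimage (f := fun z : G × G => z.1 * z.2) (by fun_prop)).inter
        (hUo.2.preimage (f := fun z : G × G => z.1⁻¹ * z.2) (by fun_prop))
    exact ho.mem_nhds (by simpa using hu)
  exact ⟨H, hUc.of_isClosed_subset (H.isClosed_of_isOpen hHo) hHU, hHo, hHU⟩

section LinearGroup

variable {F ι : Type*} [NontriviallyNormedField F] [Fintype ι] [DecidableEq ι]

theorem isInducing_val_val_inv (G : Subgroup (GL ι F)) :
    IsInducing fun x : G => (((x : GL ι F) : Matrix ι ι F), ((x⁻¹ : GL ι F) : Matrix ι ι F)) :=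
  ((Homeomorph.refl _).prodCongr MulOpposite.opHomeomorph.symm).isInducing.comp
    (Units.isEmbedding_embedProduct.isInducing.comp IsInducing.subtypeVal)

theorem continuous_coe_matrix (G : Subgroup (GL ι F)) :
    Continuous fun x : G => ((x : GL ι F) : Matrix ι ι F) :=
  (isInducing_val_val_inv G).continuous.fst

theorem Subgroup.coe_matrix_injective (G : Subgroup (GL ι F)) :
    Function.Injective fun x : G => ((x : GL ι F) : Matrix ι ι F) :=
  fun _ _ h => Subtype.ext (Units.ext h)

instance firstCountableTopology_linearGroup (G : Subgroup (GL ι F)) :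
    FirstCountableTopology G :=
  have : FirstCountableTopology (Matrix ι ι F) :=
    inferInstanceAs (FirstCountableTopology (ι → ι → F))
  (isInducing_val_val_inv G).firstCountableTopology

theorem tendsto_inv_mul_nhds_one {G : Subgroup (GL ι F)} {U : Set G} (hU : IsCompact U)
    {a b : ℕ → G} (ha : ∀ k, a k ∈ U) (hb : ∀ k, b k ∈ U)
    (h : Tendsto (fun k => (((b k : GL ι F) : Matrix ι ι F) - ((a k : GL ι F) : Matrix ι ι F)))
      atTop (𝓝 0)) : Tendsto (fun k => (a k)⁻¹ * b k) atTop (𝓝 1) := by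
  rw [tendsto_iff_ultrafilter]
  intro f hf
  obtain ⟨p, -, hp⟩ := hU.ultrafilter_le_nhds (f.map a)
    (le_principal_iff.mpr (Filter.mem_map.mpr (Filter.univ_mem' ha)))
  obtain ⟨q, -, hq⟩ := hU.ultrafilter_le_nhds (f.map b)
    (le_principal_iff.mpr (Filter.mem_map.mpr (Filter.univ_mem' hb)))
  have hp' : Tendsto a f (𝓝 p) := hp
  have hq' : Tendsto b f (𝓝 q) := hq
  have hsub := (((continuous_coe_matrix G).tendsto q).comp hq').sub
    (((continuous_coe_matrix G).tendsto p).comp hp')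
  have hpq : q = p := G.coe_matrix_injective
    (sub_eq_zero.mp (tendsto_nhds_unique hsub (h.mono_left hf)))
  have := hp'.inv.mul hq'
  rwa [hpq, inv_mul_cancel] at this

open scoped Matrix.Norms.Elementwise

theorem IsCompact.exists_norm_matrix_le {G : Subgroup (GL ι F)} {U : Set G} (hU : IsCompact U) :
    ∃ C : ℝ, ∀ x ∈ U, ‖((x : GL ι F) : Matrix ι ι F)‖ ≤ C :=
  hU.exists_bound_of_continuousOn (continuous_coe_matrix G).continuousOn

/-- If the contraction group of `g` is trivial, then an element whose forward `g`-orbit stays in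
a compact set also has its backward `g`-orbit in that set. -/
theorem inv_pow_conj_mem_of_pow_conj_mem [CompleteSpace F] {G : Subgroup (GL ι F)} {U : Set G}
    (hU : IsCompact U) {g x : G}
    (hg : ∀ y : G, Tendsto (fun k : ℕ => g ^ k * y * (g ^ k)⁻¹) atTop (𝓝 1) → y = 1)
    (hx : ∀ k : ℕ, g ^ k * x * (g ^ k)⁻¹ ∈ U) (k : ℕ) : (g ^ k)⁻¹ * x * g ^ k ∈ U := by
  let X : ℕ → G := fun k => g ^ k * x * (g ^ k)⁻¹
  let T : ℕ → Module.End F (Matrix ι ι F) := fun k => conjRepresentation ι F (g ^ k : G)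
  let c : G → Matrix ι ι F := fun x => ((x : GL ι F) : Matrix ι ι F)
  have hc : Continuous c := continuous_coe_matrix G
  have hTc : ∀ k y, T k (c y) = c (g ^ k * y * (g ^ k)⁻¹) := fun k y => by
    simp only [T, c, conjRepresentation_val]
    rfl
  have hTT : ∀ k l v, T (k + l) v = T k (T l v) := fun k l v => by
    simp only [T, pow_add, Subgroup.coe_mul, map_mul, Module.End.mul_apply]
  have hXX : ∀ k l, g ^ k * X l * (g ^ k)⁻¹ = X (k + l) := fun k l => by
    simp only [X, pow_add]
    group
  have hUcl : IsClosed U := hU.isClosed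
  obtain ⟨p, -, φ, hφ, hp⟩ := hU.tendsto_subseq hx
  have hd : ∀ i, i ≤ φ (i + i) - φ i := fun i => by
    have := hφ.add_le_nat i i
    omega
  obtain ⟨q, -, ψ, hψ, hq⟩ := hU.tendsto_subseq fun i => hx (φ (i + i) - φ i)
  let d : ℕ → ℕ := fun i => φ (ψ i + ψ i) - φ (ψ i)
  have hq' : Tendsto (fun i => X (d i)) atTop (𝓝 q) := hq
  have hdi : ∀ i, i ≤ d i := fun i => (hψ.id_le i).trans (hd (ψ i))
  have hqf : ∀ m : ℕ, g ^ m * q * (g ^ m)⁻¹ ∈ U := fun m => by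
    refine hUcl.mem_of_tendsto ((hq'.const_mul (g ^ m)).mul_const _)
      (Eventually.of_forall fun i => ?_)
    rw [hXX]
    exact hx _
  have hqb : ∀ m : ℕ, (g ^ m)⁻¹ * q * g ^ m ∈ U := fun m => by
    refine hUcl.mem_of_tendsto ((hq'.const_mul (g ^ m)⁻¹).mul_const _) ?_
    filter_upwards [eventually_ge_atTop m] with i hi
    obtain ⟨r, hr⟩ := Nat.exists_eq_add_of_le (hi.trans (hdi i))
    rw [hr, ← hXX]
    convert hx r using 1
    simp only [X]
    group
  have hbdd : ∀ y : G, (∀ m : ℕ, g ^ m * y * (g ^ m)⁻¹ ∈ U) → c y ∈ boundedOrbit T := by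
    intro y hy
    obtain ⟨C, hC⟩ := hU.exists_norm_matrix_le
    exact ⟨C, fun m => by rw [hTc]; exact hC _ (hy m)⟩
  have hTinv : ∀ m, ∀ v ∈ boundedOrbit T, T m v ∈ boundedOrbit T := by
    rintro m v ⟨C, hC⟩
    exact ⟨C, fun k => by rw [← hTT]; exact hC _⟩
  obtain ⟨C, hC0, hC⟩ := exists_bound_of_le_boundedOrbit (le_refl (boundedOrbit T))
  have hxb := hbdd x hx
  have hqb' := hbdd q hqf
  have hXb : ∀ l, c (X l) ∈ boundedOrbit T := fun l => by
    rw [← hTc]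
    exact hTinv _ _ hxb
  have hlim1 : Tendsto (fun i => T (φ (ψ i)) (c (X (d i)) - c q)) atTop (𝓝 0) := by
    have h0 : Tendsto (fun i => C * ‖c (X (d i)) - c q‖) atTop (𝓝 0) := by
      have := (((hc.tendsto q).comp hq').sub_const (c q)).norm.const_mul C
      simpa using this
    exact squeeze_zero_norm (fun i => hC _ (Submodule.sub_mem _ (hXb _) hqb') _) h0
  have hp1 : Tendsto (fun i => c (X (φ (ψ i)))) atTop (𝓝 (c p)) :=
    ((hc.tendsto p).comp hp).comp hψ.tendsto_atTop
  have hp2 : Tendsto (fun i => c (X (φ (ψ i + ψ i)))) atTop (𝓝 (c p)) :=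
    ((hc.tendsto p).comp hp).comp
      (tendsto_atTop_mono (fun i => Nat.le_add_left _ _) hψ.tendsto_atTop)
  have hlim2 : Tendsto (fun i => T (φ (ψ i)) (c x - c q)) atTop (𝓝 0) := by
    have h0 := (hp1.sub hp2).add hlim1
    rw [sub_self, add_zero] at h0
    refine h0.congr fun i => ?_
    have e : φ (ψ i + ψ i) = φ (ψ i) + d i := by
      have : φ (ψ i) ≤ φ (ψ i + ψ i) := hφ.monotone (by omega)
      simp only [d]
      omega
    have e₁ : c (X (φ (ψ i + ψ i))) = T (φ (ψ i)) (c (X (d i))) := by rw [e, ← hXX, hTc]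
    have e₂ : T (φ (ψ i)) (c x) = c (X (φ (ψ i))) := hTc _ _
    rw [e₁, map_sub, map_sub, e₂]
    abel
  have hlim3 : Tendsto (fun k => T k (c x - c q)) atTop (𝓝 0) := by
    refine Metric.tendsto_atTop.mpr fun ε hε => ?_
    obtain ⟨i, hi⟩ := (Metric.tendsto_atTop.mp hlim2 (ε / C) (div_pos hε hC0)).imp
      fun i h => h i le_rfl
    refine ⟨φ (ψ i), fun k hk => ?_⟩
    obtain ⟨m, rfl⟩ := Nat.exists_eq_add_of_le' hk
    rw [dist_zero_right] at hi ⊢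
    rw [hTT]
    refine (hC _ (hTinv _ _ (Submodule.sub_mem _ hxb hqb')) _).trans_lt ?_
    rwa [lt_div_iff₀' hC0] at hi
  have hz : q⁻¹ * x = 1 := by
    refine hg _ ?_
    have := tendsto_inv_mul_nhds_one hU (a := fun k => g ^ k * q * (g ^ k)⁻¹)
      (b := fun k => g ^ k * x * (g ^ k)⁻¹) hqf hx ?_
    · refine this.congr fun k => ?_
      group
    · refine hlim3.congr fun k => ?_
      rw [map_sub, hTc, hTc]
  rw [inv_mul_eq_one.mp hz] at hqb
  exact hqb k

/-- The span of the differences `u - 1` for `u` in `U`. -/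
def spanSubOne {G : Subgroup (GL ι F)} (U : Set G) : Submodule F (Matrix ι ι F) :=
  Submodule.span F ((fun u : G => ((u : GL ι F) : Matrix ι ι F) - 1) '' U)

theorem spanSubOne_mono {G : Subgroup (GL ι F)} {U V : Set G} (h : U ⊆ V) :
    spanSubOne U ≤ spanSubOne V :=
  Submodule.span_mono (Set.image_mono h)

theorem sub_one_mem_spanSubOne {G : Subgroup (GL ι F)} {U : Set G} {u : G} (hu : u ∈ U) :
    ((u : GL ι F) : Matrix ι ι F) - 1 ∈ spanSubOne U :=
  Submodule.subset_span ⟨u, hu, rfl⟩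

theorem exists_spanSubOne_minimal (G : Subgroup (GL ι F)) :
    ∃ U ∈ 𝓝 (1 : G), ∀ V ∈ 𝓝 (1 : G), V ⊆ U → spanSubOne V = spanSubOne U := by
  obtain ⟨U, hU, hmin⟩ := exists_minimalFor_of_wellFoundedLT
    (fun U : Set G => U ∈ 𝓝 (1 : G)) (fun U => Module.finrank F (spanSubOne U))
    ⟨Set.univ, univ_mem⟩
  exact ⟨U, hU, fun V hV hVU => Submodule.eq_of_le_of_finrank_le (spanSubOne_mono hVU)
    ((le_total _ _).elim id (hmin hV))⟩

theorem spanSubOne_le_comap_conjRepresentation {G : Subgroup (GL ι F)} {U : Set G}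
    (hU : U ∈ 𝓝 (1 : G)) (hmin : ∀ V ∈ 𝓝 (1 : G), V ⊆ U → spanSubOne V = spanSubOne U) (g : G) :
    spanSubOne U ≤ (spanSubOne U).comap (conjRepresentation ι F (g : GL ι F)) := by
  have hV : U ∩ {x | g * x * g⁻¹ ∈ U} ∈ 𝓝 (1 : G) := by
    refine inter_mem hU ?_
    have hcont : Continuous fun x : G => g * x * g⁻¹ := by fun_prop
    have := hcont.tendsto 1
    rw [mul_one, mul_inv_cancel] at this
    exact this hU
  rw [← hmin _ hV Set.inter_subset_left]
  refine Submodule.span_le.mpr ?_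
  rintro _ ⟨x, ⟨-, hx⟩, rfl⟩
  rw [SetLike.mem_coe, Submodule.mem_comap, map_sub, conjRepresentation_one,
    conjRepresentation_val, hmin _ hV Set.inter_subset_left]
  exact sub_one_mem_spanSubOne (u := g * x * g⁻¹) hx

theorem spanSubOne_le_boundedOrbit [CompleteSpace F] {G : Subgroup (GL ι F)}
    (hcontr : ∀ g x : G, Tendsto (fun k : ℕ => g ^ k * x * (g ^ k)⁻¹) atTop (𝓝 1) → x = 1)
    {K : Set G} (hKc : IsCompact K) (hKo : IsClopen K) (h1 : 1 ∈ K) {U : Set G}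
    (hU : U ∈ 𝓝 (1 : G)) (hmin : ∀ V ∈ 𝓝 (1 : G), V ⊆ U → spanSubOne V = spanSubOne U) (g : G) :
    spanSubOne U ≤ boundedOrbit fun k : ℕ => conjRepresentation ι F ((g ^ k : G) : GL ι F) := by
  have hW : U ∩ {x | ∀ k : ℕ, g ^ k * x * (g ^ k)⁻¹ ∈ K} ∈ 𝓝 (1 : G) := by
    refine inter_mem hU (setOf_forall_conj_pow_mem_mem_nhds_one hKc hKo h1 g fun y hy => ?_)
    have := inv_pow_conj_mem_of_pow_conj_mem hKc (hcontr g⁻¹) (x := y)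
      (fun k => by simpa using hy k) 1
    simpa using this
  rw [← hmin _ hW Set.inter_subset_left]
  refine Submodule.span_le.mpr ?_
  rintro _ ⟨x, ⟨-, hx⟩, rfl⟩
  obtain ⟨C, hC⟩ := hKc.exists_norm_matrix_le
  refine ⟨C + ‖(1 : Matrix ι ι F)‖, fun k => ?_⟩
  rw [map_sub, conjRepresentation_one, conjRepresentation_val]
  exact (norm_sub_le _ _).trans (add_le_add_left (hC _ (hx k)) _)

/-- If conjugation by `G` is bounded on `spanSubOne U` for some neighbourhood `U` of the identity,
then the identity has arbitrarily small conjugation-invariant neighbourhoods. -/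
theorem setOf_forall_conj_mem_mem_nhds_one [CompleteSpace F] {G : Subgroup (GL ι F)} {U : Set G}
    (hU : U ∈ 𝓝 (1 : G))
    (hb : spanSubOne U ≤ boundedOrbit fun g : G => conjRepresentation ι F (g : GL ι F))
    {V : Set G} (hV : V ∈ 𝓝 (1 : G)) : {x | ∀ g, g * x * g⁻¹ ∈ V} ∈ 𝓝 (1 : G) := by
  obtain ⟨C, hC0, hC⟩ := exists_bound_of_le_boundedOrbit hb
  rw [(isInducing_val_val_inv G).nhds_eq_comap, mem_comap] at hV
  obtain ⟨t, ht, htV⟩ := hV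
  obtain ⟨ε, hε, hεt⟩ := Metric.mem_nhds_iff.mp ht
  let c : G → Matrix ι ι F := fun x => ((x : GL ι F) : Matrix ι ι F)
  have hconj : ∀ x ∈ U, ∀ g : G, ‖c (g * x * g⁻¹) - 1‖ ≤ C * ‖c x - 1‖ := by
    intro x hx g
    refine le_trans (le_of_eq ?_) (hC _ (sub_one_mem_spanSubOne hx) g)
    rw [map_sub, conjRepresentation_one, conjRepresentation_val]
    rfl
  have hsmall : ∀ᶠ x in 𝓝 (1 : G), ‖c x - 1‖ < ε / C := by
    have hcont : Continuous fun x : G => ‖c x - 1‖ :=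
      ((continuous_coe_matrix G).sub continuous_const).norm
    refine (hcont.tendsto 1).eventually_lt_const ?_
    simpa [c] using div_pos hε hC0
  have hboth : ∀ᶠ x in 𝓝 (1 : G), x ∈ U ∧ ‖c x - 1‖ < ε / C := Filter.Eventually.and hU hsmall
  have hinv : Tendsto (fun x : G => x⁻¹) (𝓝 1) (𝓝 1) := by
    simpa using (continuous_inv (G := G)).tendsto 1
  filter_upwards [hboth, hinv.eventually hboth] with x hx hx' g
  refine htV (hεt ?_)
  rw [Metric.mem_ball, Prod.dist_eq, max_lt_iff, dist_eq_norm, dist_eq_norm]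
  constructor
  · have := (hconj x hx.1 g).trans_lt ((lt_div_iff₀' hC0).mp hx.2)
    simpa [c] using this
  · have := (hconj _ hx'.1 g).trans_lt ((lt_div_iff₀' hC0).mp hx'.2)
    simpa [c, mul_assoc] using this

end LinearGroup

/-- Let `F` be a non-archimedean local field and `G` a closed compactly generated subgroup
of `GL(n, F)` whose contraction subgroups are all trivial. Then `G` has a neighborhood basis
of the identity consisting of compact open normal subgroups. -/
theorem stmt5 {F : Type*} [NontriviallyNormedField F] [LocallyCompactSpace F]
    [IsUltrametricDist F] (n : ℕ)
    (G : Subgroup (GL (Fin n) F))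
    (hGclosed : IsClosed (G : Set (GL (Fin n) F)))
    (hcg : ∃ S : Set (GL (Fin n) F), IsCompact S ∧ Subgroup.closure S = G)
    (hcontr : ∀ g x : ↥G,
      Tendsto (fun k : ℕ => g ^ k * x * (g ^ k)⁻¹) atTop (nhds 1) → x = 1) :
    ∀ U ∈ nhds (1 : ↥G), ∃ K : Subgroup ↥G,
      K.Normal ∧ IsCompact (K : Set ↥G) ∧ IsOpen (K : Set ↥G) ∧ (K : Set ↥G) ⊆ U := by
  open scoped Matrix.Norms.Elementwise in
  intro U hU
  have : ProperSpace F := .of_locallyCompactSpace F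
  have : LocallyCompactSpace (Matrix (Fin n) (Fin n) F) :=
    inferInstanceAs (LocallyCompactSpace (Fin n → Fin n → F))
  have : LocallyCompactSpace (GL (Fin n) F) :=
    Units.isClosedEmbedding_embedProduct.locallyCompactSpace
  have : LocallyCompactSpace G := hGclosed.locallyCompactSpace
  have : TotallyDisconnectedSpace (Matrix (Fin n) (Fin n) F) :=
    inferInstanceAs (TotallyDisconnectedSpace (Fin n → Fin n → F))
  have : TotallyDisconnectedSpace G := ⟨isTotallyDisconnected_of_image
    (continuous_coe_matrix G).continuousOn G.coe_matrix_injective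
    (isTotallyDisconnected_of_totallyDisconnectedSpace _)⟩
  obtain ⟨K₀, hK₀c, hK₀, hK₀U⟩ := exists_compact_subset isOpen_interior
    (mem_interior_iff_mem_nhds.mpr hU)
  obtain ⟨K, hK, hK1, hKK₀⟩ := loc_compact_Haus_tot_disc_of_zero_dim.exists_subset_of_mem_open
    hK₀ isOpen_interior
  have hKc : IsCompact K := hK₀c.of_isClosed_subset hK.1 (hKK₀.trans interior_subset)
  have hKU : K ⊆ U := hKK₀.trans (interior_subset.trans (hK₀U.trans interior_subset))
  obtain ⟨H, hHc, hHo, hHK⟩ := exists_subgroup_isCompact_isOpen_subset hKc hK hK1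
  obtain ⟨V, hV, hmin⟩ := exists_spanSubOne_minimal G
  obtain ⟨S, hS, hSG⟩ := hcg
  let ρ : Representation F G (Matrix (Fin n) (Fin n) F) :=
    (conjRepresentation (Fin n) F).comp G.subtype
  have hA : ∀ g, spanSubOne V ≤ (spanSubOne V).comap (ρ g) :=
    spanSubOne_le_comap_conjRepresentation hV hmin
  have hgen : Subgroup.closure ((↑) ⁻¹' S : Set G) = ⊤ := by
    subst hSG
    exact Subgroup.closure_closure_coe_preimage
  have hSb : spanSubOne V ≤ boundedOrbit fun s : ((↑) ⁻¹' S : Set G) => ρ s := by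
    intro v _
    have hcont : Continuous fun s : GL (Fin n) F => conjRepresentation (Fin n) F s v := by
      simp only [conjRepresentation_apply]
      exact (Units.continuous_val.mul continuous_const).mul Units.continuous_coe_inv
    obtain ⟨C, hC⟩ := hS.exists_bound_of_continuousOn hcont.continuousOn
    exact ⟨C, fun s => hC _ s.2⟩
  have hbdd := Representation.coeffBounded_of_powers hgen (ρ.subrepresentation _ hA)
    (CoeffBounded.subrepresentation_of_le_boundedOrbit ρ hA hSb) fun g =>
      CoeffBounded.subrepresentation_of_le_boundedOrbit ρ hA
        (spanSubOne_le_boundedOrbit hcontr hKc hK hK1 hV hmin g)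
  have hHn := setOf_forall_conj_mem_mem_nhds_one hV
    (le_boundedOrbit_of_coeffBounded_subrepresentation ρ hA hbdd) (hHo.mem_nhds H.one_mem)
  have hopen : IsOpen (H.normalCore : Set G) :=
    H.normalCore.isOpen_of_mem_nhds (g := 1) (mem_of_superset hHn fun x hx g => hx g)
  exact ⟨H.normalCore, H.normalCore_normal,
    hHc.of_isClosed_subset (H.normalCore.isClosed_of_isOpen hopen) H.normalCore_le, hopen,
    fun x hx => hKU (hHK (H.normalCore_le hx))⟩
end

section
/- Let G be a compactly generated, totally disconnected, locally compact group of polynomial growth which is a closed subgroup of GL(n, F) for a non-archimedean local field F, and in which every closed subgroup is unimodular. Then G has a basis (Kₙ) of compact open normal subgroups such that each quotient G/Kₙ has a finitely generated nilpotent subgroup of finite index. -/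
open Filter Topology MeasureTheory Matrix Pointwise

universe u

universe v

lemma exists_mul_pow_lt_two_pow (C d : ℕ) : ∃ m : ℕ, C * (2 * m + 1) ^ d < 2 ^ m := by
  have h : Tendsto (fun m : ℕ => (C * 3 ^ d : ℝ) * ((m : ℝ) ^ d / 2 ^ m)) atTop (𝓝 0) := by
    simpa using (tendsto_pow_const_div_const_pow_of_one_lt d (r := (2 : ℝ))
      (by norm_num)).const_mul (C * 3 ^ d : ℝ)
  obtain ⟨m, hm1, hm⟩ := ((eventually_ge_atTop 1).and
    (h.eventually (gt_mem_nhds zero_lt_one))).exists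
  refine ⟨m, ?_⟩
  rw [mul_div_assoc', div_lt_one (by positivity)] at hm
  have h3 : C * (2 * m + 1) ^ d ≤ C * 3 ^ d * m ^ d := by
    rw [mul_assoc, ← mul_pow]
    gcongr
    omega
  refine h3.trans_lt ?_
  exact_mod_cast hm

/-- Milnor's trick: in a group of polynomial growth modulo `V`, some `tʳ a t⁻ʳ` lies in the
subgroup generated by `V` and the previous conjugates. -/
lemma exists_conj_pow_mem_closure {G : Type*} [Group G] (V : Subgroup G)
    (hV : ∀ B : Set G, B.Finite → ∃ C d : ℕ, ∀ m : ℕ,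
      ((QuotientGroup.mk : G → G ⧸ V) '' (B ^ m)).ncard ≤ C * (m + 1) ^ d) (t a : G) :
    ∃ r : ℕ, t ^ r * a * (t ^ r)⁻¹ ∈
      Subgroup.closure ((V : Set G) ∪ {x | ∃ i < r, x = t ^ i * a * (t ^ i)⁻¹}) := by
  by_contra! hcon
  set x : ℕ → G := fun r => t ^ r * a * (t ^ r)⁻¹ with hx
  set M : ℕ → Subgroup G := fun r =>
    Subgroup.closure ((V : Set G) ∪ {y | ∃ i < r, y = t ^ i * a * (t ^ i)⁻¹}) with hM
  let Ω : ℕ → Set G := fun m => Nat.rec {1} (fun k s => s ∪ x k • s) m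
  have hΩs : ∀ m, Ω (m + 1) = Ω m ∪ x m • Ω m := fun m => rfl
  have hMmono : ∀ m, M m ≤ M (m + 1) := fun m => Subgroup.closure_mono
    (Set.union_subset_union_right _ fun y ⟨i, hi, h⟩ => ⟨i, hi.trans (Nat.lt_succ_self m), h⟩)
  have hxM : ∀ m, x m ∈ M (m + 1) := fun m =>
    Subgroup.subset_closure (Or.inr ⟨m, Nat.lt_succ_self m, rfl⟩)
  have hVM : ∀ m, V ≤ M m := fun m v hv => Subgroup.subset_closure (Or.inl hv)
  have hΩM : ∀ m, Ω m ⊆ M m := by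
    intro m
    induction m with
    | zero => rintro _ rfl; exact one_mem _
    | succ m ih =>
      rw [hΩs]
      rintro y (hy | ⟨z, hz, rfl⟩)
      · exact hMmono m (ih hy)
      · exact mul_mem (hxM m) (hMmono m (ih hz))
  have hΩfin : ∀ m, (Ω m).Finite := by
    intro m
    induction m with
    | zero => exact Set.finite_singleton _
    | succ m ih => rw [hΩs]; exact ih.union ih.smul_set
  let π : G → G ⧸ V := QuotientGroup.mk
  have hπ : ∀ (g : G) (s : Set G), π '' (g • s) = g • (π '' s) := fun g s => Set.image_smul_comm π g s fun _ => rfl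
  have hcard : ∀ m, (π '' Ω m).ncard = 2 ^ m := by
    intro m
    induction m with
    | zero => simp [Ω]
    | succ m ih =>
      rw [hΩs, Set.image_union, Set.ncard_union_eq ?_ ((hΩfin m).image _)
        ((hΩfin m).smul_set.image _), hπ, Set.ncard_smul_set, ih]
      · ring
      · rw [Set.disjoint_left]
        rintro _ ⟨y, hy, rfl⟩ ⟨_, ⟨z, hz, rfl⟩, hzy⟩
        have h1 : (x m * z)⁻¹ * y ∈ V := QuotientGroup.eq.1 hzy
        apply hcon m
        have h2 : x m = y * ((x m * z)⁻¹ * y)⁻¹ * z⁻¹ := by group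
        change x m ∈ M m
        rw [h2]
        exact mul_mem (mul_mem (hΩM m hy) (inv_mem (hVM m h1))) (inv_mem (hΩM m hz))
  let B : Set G := {1, a, t⁻¹}
  have h1B : (1 : G) ∈ B := by simp [B]
  have hΩB : ∀ m, Ω m ⊆ t ^ m • B ^ (2 * m) := by
    intro m
    induction m with
    | zero => simp [Ω]
    | succ m ih =>
      rw [hΩs]
      have key : ∀ b ∈ B ^ (2 * m), ∀ c ∈ B, t ^ m * c * b ∈ t ^ (m + 1) • B ^ (2 * (m + 1)) := by
        intro b hb c hc
        refine ⟨t⁻¹ * (c * b), ?_, ?_⟩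
        · rw [show 2 * (m + 1) = (2 * m + 1) + 1 by ring, pow_succ', pow_succ' _ (2 * m)]
          exact Set.mul_mem_mul (by simp [B]) (Set.mul_mem_mul hc hb)
        · simp only [smul_eq_mul]; rw [pow_succ]; group
      rintro y (hy | ⟨z, hz, rfl⟩)
      · obtain ⟨b, hb, rfl⟩ := ih hy
        simpa using key b hb 1 h1B
      · obtain ⟨b, hb, rfl⟩ := ih hz
        have := key b hb a (by simp [B])
        convert this using 1
        simp only [smul_eq_mul, hx]; group
  obtain ⟨C, d, hCd⟩ := hV B (by simp [B])
  obtain ⟨m, hm⟩ := exists_mul_pow_lt_two_pow C d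
  refine absurd (hCd (2 * m)) (not_le.2 (hm.trans_le ?_))
  rw [← hcard m, ← Set.ncard_smul_set (t ^ m) (QuotientGroup.mk '' (B ^ (2 * m)))]
  have hBfin : ∀ k, (B ^ k).Finite := fun k => by
    induction k with
    | zero => simp
    | succ k ih => rw [pow_succ]; exact ih.mul (by simp [B])
  refine Set.ncard_le_ncard ?_ ((hBfin _).image _).smul_set
  rw [← hπ]
  exact Set.image_mono (hΩB m)

lemma exists_mul_zpow_of_mem_closure {G : Type*} [Group G] (M : Subgroup G) {t : G}
    (ht : t ∈ Subgroup.normalizer (M : Set G)) {g : G}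
    (hg : g ∈ Subgroup.closure ((M : Set G) ∪ {t})) : ∃ m ∈ M, ∃ k : ℤ, g = m * t ^ k := by
  have htz : ∀ (k : ℤ), ∀ g ∈ M, t ^ k * g * (t ^ k)⁻¹ ∈ M := fun k g hg =>
    (Subgroup.mem_normalizer_iff.1 (zpow_mem ht k) g).1 hg
  induction hg using Subgroup.closure_induction with
  | mem g hg =>
    rcases hg with hg | rfl
    · exact ⟨g, hg, 0, by simp⟩
    · exact ⟨1, one_mem _, 1, by simp⟩
  | one => exact ⟨1, one_mem _, 0, by simp⟩
  | mul x y _ _ hx hy =>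
    obtain ⟨m, hm, k, rfl⟩ := hx
    obtain ⟨m', hm', l, rfl⟩ := hy
    exact ⟨_, mul_mem hm (htz k m' hm'), k + l, by rw [_root_.zpow_add]; group⟩
  | inv x _ hx =>
    obtain ⟨m, hm, k, rfl⟩ := hx
    exact ⟨_, htz (-k) _ (inv_mem hm), -k, by group⟩

/-- Conjugates by powers of `t`, together with `V`, stabilise after finitely many steps. -/
lemma exists_finite_closure_conj_le {G : Type*} [Group G] (V : Subgroup G)
    (hV : ∀ B : Set G, B.Finite → ∃ C d : ℕ, ∀ m : ℕ,
      ((QuotientGroup.mk : G → G ⧸ V) '' (B ^ m)).ncard ≤ C * (m + 1) ^ d)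
    (t : G) (A : Set G) (hA : A.Finite)
    (htV : ∀ v ∈ V, t * v * t⁻¹ ∈ Subgroup.closure ((V : Set G) ∪ A)) :
    ∃ A' : Set G, A'.Finite ∧ A ⊆ A' ∧
      (∀ g ∈ A', ∃ a ∈ A, ∃ i : ℕ, g = t ^ i * a * (t ^ i)⁻¹) ∧
      ∀ g ∈ Subgroup.closure ((V : Set G) ∪ A'),
        t * g * t⁻¹ ∈ Subgroup.closure ((V : Set G) ∪ A') := by
  let X : ℕ → Set G := fun n => {x | ∃ a ∈ A, ∃ i < n, x = t ^ i * a * (t ^ i)⁻¹}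
  let U : ℕ → Subgroup G := fun n => Subgroup.closure ((V : Set G) ∪ X n)
  have hUmono : Monotone U := fun m n hmn => Subgroup.closure_mono
    (Set.union_subset_union_right _ fun y ⟨a, ha, i, hi, h⟩ => ⟨a, ha, i, hi.trans_le hmn, h⟩)
  have hU1 : Subgroup.closure ((V : Set G) ∪ A) ≤ U 1 := Subgroup.closure_mono
    (Set.union_subset_union_right _ fun a ha => ⟨a, ha, 0, by simp, by simp⟩)
  have hconj : ∀ n, ∀ g ∈ U n, t * g * t⁻¹ ∈ U (n + 1) := by
    intro n
    suffices U n ≤ (U (n + 1)).comap (MulAut.conj t).toMonoidHom from fun g hg => this hg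
    refine (Subgroup.closure_le _).2 ?_
    rintro g (hg | ⟨a, ha, i, hi, rfl⟩)
    · exact hUmono (by omega) (hU1 (htV g hg))
    · refine Subgroup.subset_closure (Or.inr ⟨a, ha, i + 1, by omega, ?_⟩)
      simp only [MulEquiv.toMonoidHom_eq_coe, MonoidHom.coe_coe, MulAut.conj_apply, pow_succ']
      group
  have hex : ∀ a ∈ A, ∃ r : ℕ, ∀ n ≥ r, t ^ n * a * (t ^ n)⁻¹ ∈ U n := by
    intro a ha
    obtain ⟨r, hr⟩ := exists_conj_pow_mem_closure V hV t a
    refine ⟨r, fun n hn => ?_⟩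
    induction n, hn using Nat.le_induction with
    | base =>
      refine Subgroup.closure_mono (Set.union_subset_union_right _ ?_) hr
      rintro y ⟨i, hi, rfl⟩
      exact ⟨a, ha, i, hi, rfl⟩
    | succ n hn ih =>
      have := hconj n _ ih
      rwa [show t * (t ^ n * a * (t ^ n)⁻¹) * t⁻¹ = t ^ (n + 1) * a * (t ^ (n + 1))⁻¹ by
        rw [pow_succ']; group] at this
  choose! r hr using hex
  obtain ⟨R, hR⟩ := (hA.image r).bddAbove
  have hRr : ∀ a ∈ A, r a ≤ R + 1 := fun a ha => (hR ⟨a, ha, rfl⟩).trans (Nat.le_succ R)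
  have hXfin : ∀ n, (X n).Finite := fun n => by
    refine ((hA.prod (Set.finite_Iio n)).image
      (fun p : G × ℕ => t ^ p.2 * p.1 * (t ^ p.2)⁻¹)).subset ?_
    rintro _ ⟨a, ha, i, hi, rfl⟩
    exact ⟨(a, i), ⟨ha, hi⟩, rfl⟩
  refine ⟨X (R + 1), hXfin _, fun a ha => ⟨a, ha, 0, by omega, by simp⟩,
    fun g ⟨a, ha, i, _, h⟩ => ⟨a, ha, i, h⟩, fun g hg => ?_⟩
  have hle : U (R + 1 + 1) ≤ U (R + 1) := by
    refine (Subgroup.closure_le _).2 ?_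
    rintro g (hg | ⟨a, ha, i, hi, rfl⟩)
    · exact Subgroup.subset_closure (Or.inl hg)
    · rcases Nat.lt_succ_iff_lt_or_eq.1 hi with h | rfl
      · exact Subgroup.subset_closure (Or.inr ⟨a, ha, i, h, rfl⟩)
      · exact hr a ha _ (hRr a ha)
  exact hle (hconj _ g hg)

/-- If `N⟨t⟩` is generated by `V` and finitely many elements of `N⟨t⟩`, then `N` is generated
by `V` and finitely many elements. -/
lemma exists_finite_closure_of_cyclic_quotient {G : Type*} [Group G] (V N : Subgroup G)
    (hV : ∀ B : Set G, B.Finite → ∃ C d : ℕ, ∀ m : ℕ,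
      ((QuotientGroup.mk : G → G ⧸ V) '' (B ^ m)).ncard ≤ C * (m + 1) ^ d)
    (hVN : V ≤ N) (t : G) (hN : ∀ g ∈ N, t * g * t⁻¹ ∈ N) (hN' : ∀ g ∈ N, t⁻¹ * g * t ∈ N)
    (A : Set G) (hA : A.Finite) (hAN : A ⊆ N)
    (hgen : N ≤ Subgroup.closure ((V : Set G) ∪ A ∪ {t}))
    (htV : ∀ v ∈ V, t * v * t⁻¹ ∈ Subgroup.closure ((V : Set G) ∪ A))
    (htV' : ∀ v ∈ V, t⁻¹ * v * t ∈ Subgroup.closure ((V : Set G) ∪ A)) :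
    ∃ A' : Set G, A'.Finite ∧ Subgroup.closure ((V : Set G) ∪ A') = N := by
  obtain ⟨A₁, hA₁, hAA₁, hA₁N, h₁⟩ := exists_finite_closure_conj_le V hV t A hA htV
  have hle₁ : Subgroup.closure ((V : Set G) ∪ A) ≤ Subgroup.closure ((V : Set G) ∪ A₁) :=
    Subgroup.closure_mono (Set.union_subset_union_right _ hAA₁)
  obtain ⟨A₂, hA₂, hAA₂, hA₂N, h₂⟩ := exists_finite_closure_conj_le V hV t⁻¹ A₁ hA₁
    (fun v hv => by simpa using hle₁ (htV' v hv))
  set M := Subgroup.closure ((V : Set G) ∪ A₂) with hM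
  have hle₂ : Subgroup.closure ((V : Set G) ∪ A₁) ≤ M :=
    Subgroup.closure_mono (Set.union_subset_union_right _ hAA₂)
  have hpow : ∀ g ∈ N, ∀ i : ℕ, t ^ i * g * (t ^ i)⁻¹ ∈ N := by
    intro g hg i
    induction i with
    | zero => simpa
    | succ i ih => convert hN _ ih using 1; rw [pow_succ']; group
  have hpow' : ∀ g ∈ N, ∀ i : ℕ, t⁻¹ ^ i * g * (t⁻¹ ^ i)⁻¹ ∈ N := by
    intro g hg i
    induction i with
    | zero => simpa
    | succ i ih => convert hN' _ ih using 1; rw [pow_succ']; group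
  have hA₁N' : A₁ ⊆ N := fun g hg => by
    obtain ⟨a, ha, i, rfl⟩ := hA₁N g hg
    exact hpow a (hAN ha) i
  have hA₂N' : A₂ ⊆ N := fun g hg => by
    obtain ⟨a, ha, i, rfl⟩ := hA₂N g hg
    exact hpow' a (hA₁N' ha) i
  have hMN : M ≤ N := (Subgroup.closure_le _).2 (Set.union_subset hVN hA₂N')
  have ht' : ∀ g ∈ M, t⁻¹ * g * t ∈ M := fun g hg => by simpa using h₂ g hg
  have ht : ∀ g ∈ M, t * g * t⁻¹ ∈ M := by
    suffices M ≤ M.comap (MulAut.conj t).toMonoidHom from fun g hg => this hg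
    refine (Subgroup.closure_le _).2 ?_
    rintro g (hg | hg)
    · exact hle₂ (hle₁ (htV g hg))
    · obtain ⟨a, ha, i, rfl⟩ := hA₂N g hg
      have haM : a ∈ M := hle₂ (Subgroup.subset_closure (Or.inr ha))
      rcases i with _ | i
      · simpa using hle₂ (h₁ a (Subgroup.subset_closure (Or.inr ha)))
      · have hi : ∀ i : ℕ, t⁻¹ ^ i * a * (t⁻¹ ^ i)⁻¹ ∈ M := by
          intro i
          induction i with
          | zero => simpa
          | succ i ih => convert ht' _ ih using 1; rw [pow_succ']; group
        have := hi i
        change t * _ * t⁻¹ ∈ M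
        convert this using 1
        rw [pow_succ']; group
  have htn : t ∈ Subgroup.normalizer (M : Set G) := by
    rw [Subgroup.mem_normalizer_iff]
    refine fun g => ⟨ht g, fun hg => ?_⟩
    have := ht' _ hg
    convert this using 1; group
  have hsub : ∀ g ∈ Subgroup.closure ((V : Set G) ∪ A ∪ {t}), ∃ m ∈ M, ∃ k : ℤ, g = m * t ^ k :=
    fun g hg => exists_mul_zpow_of_mem_closure M htn (Subgroup.closure_mono
      (Set.union_subset_union_left _ (Subgroup.subset_closure.trans (hle₁.trans hle₂))) hg)
  obtain ⟨⟨s, hs⟩, hgs⟩ := (inferInstance : IsCyclic (N.comap (zpowersHom G t))).exists_generator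
  refine ⟨insert (zpowersHom G t s) A₂, hA₂.insert _, le_antisymm ?_ fun g hg => ?_⟩
  · exact (Subgroup.closure_le _).2 (Set.union_subset hVN (Set.insert_subset hs hA₂N'))
  · obtain ⟨m, hm, k, rfl⟩ := hsub g (hgen hg)
    have hk : t ^ k ∈ N := by
      simpa using mul_mem (inv_mem (hMN hm)) hg
    obtain ⟨l, hl⟩ := hgs ⟨Multiplicative.ofAdd k, by simpa [Subgroup.mem_comap] using hk⟩
    have hl' : (zpowersHom G t s) ^ l = t ^ k := by
      rw [← map_zpow]
      simpa using congrArg (fun x : N.comap (zpowersHom G t) => zpowersHom G t x.1) hl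
    rw [← hl']
    have hle : M ≤ Subgroup.closure ((V : Set G) ∪ insert (zpowersHom G t s) A₂) :=
      Subgroup.closure_mono (Set.union_subset_union_right _ (Set.subset_insert _ _))
    have hs' : zpowersHom G t s ∈ Subgroup.closure ((V : Set G) ∪ insert (zpowersHom G t s) A₂) :=
      Subgroup.subset_closure (Or.inr (Or.inl rfl))
    exact mul_mem (hle hm) (Subgroup.zpow_mem _ hs' l)

/-- A subgroup generated by a compact set. -/
def Subgroup.CompactlyGenerated {G : Type*} [Group G] [TopologicalSpace G]
    (P : Subgroup G) : Prop :=
  ∃ S : Set G, IsCompact S ∧ Subgroup.closure S = P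

/-- Compactly generated groups with a compact open subgroup and polynomial growth, the growth
being measured by numbers of cosets of compact open subgroups. -/
structure IsPolyGrowthGroup (G : Type*) [Group G] [TopologicalSpace G] : Prop where
  exists_compact_open : ∃ V : Subgroup G, IsCompact (V : Set G) ∧ IsOpen (V : Set G)
  growth : ∀ V : Subgroup G, IsCompact (V : Set G) → IsOpen (V : Set G) → ∀ S : Set G,
    IsCompact S → ∃ C d : ℕ, ∀ m : ℕ,
      ((QuotientGroup.mk : G → G ⧸ V) '' (S ^ m)).ncard ≤ C * (m + 1) ^ d
  compactlyGenerated : (⊤ : Subgroup G).CompactlyGenerated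

lemma compactlyGenerated_closure_union {G : Type*} [Group G] [TopologicalSpace G]
    {V : Subgroup G} (hV : IsCompact (V : Set G)) {A : Set G}
    (hA : A.Finite) : (Subgroup.closure ((V : Set G) ∪ A)).CompactlyGenerated :=
  ⟨_, hV.union hA.isCompact, rfl⟩

lemma Subgroup.CompactlyGenerated.top_of_isClosed {G : Type*} [Group G]
    [TopologicalSpace G] {H : Subgroup G} (hH : IsClosed (H : Set G))
    (h : H.CompactlyGenerated) : (⊤ : Subgroup H).CompactlyGenerated := by
  obtain ⟨S, hS, hcl⟩ := h
  have hSH : S ⊆ H := by rw [← hcl]; exact Subgroup.subset_closure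
  refine ⟨(↑) ⁻¹' S, hH.isClosedEmbedding_subtypeVal.isCompact_preimage hS, ?_⟩
  apply Subgroup.map_injective H.subtype_injective
  rw [MonoidHom.map_closure, ← MonoidHom.range_eq_map, H.range_subtype]
  rw [Subgroup.coe_subtype, Set.image_preimage_eq_of_subset (by simpa using hSH), hcl]

section CompactlyGenerated

variable {G : Type*} [Group G] [TopologicalSpace G] [IsTopologicalGroup G]

lemma IsCompact.finite_image_mk {V : Subgroup G} (hV : IsOpen (V : Set G)) {S : Set G}
    (hS : IsCompact S) : ((QuotientGroup.mk : G → G ⧸ V) '' S).Finite := by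
  have := QuotientGroup.discreteTopology hV
  exact (hS.image QuotientGroup.continuous_mk).finite_of_discrete

lemma IsCompact.exists_finite_subset_mul {V : Subgroup G} (hV : IsOpen (V : Set G)) {S : Set G}
    (hS : IsCompact S) : ∃ A ⊆ S, A.Finite ∧ S ⊆ A * (V : Set G) := by
  obtain ⟨A, hAS, hA, h⟩ := (Set.exists_subset_image_finite_and
    (p := fun t => (QuotientGroup.mk : G → G ⧸ V) '' S ⊆ t)).1
    ⟨_, subset_rfl, hS.finite_image_mk hV, subset_rfl⟩
  refine ⟨A, hAS, hA, fun s hs => ?_⟩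
  obtain ⟨a, ha, has⟩ := h ⟨s, hs, rfl⟩
  exact ⟨a, ha, a⁻¹ * s, QuotientGroup.eq.1 has, by simp⟩

lemma Subgroup.CompactlyGenerated.exists_finite {V P : Subgroup G} (hV : IsOpen (V : Set G))
    (hVP : V ≤ P) (hP : P.CompactlyGenerated) :
    ∃ A : Set G, A.Finite ∧ A ⊆ P ∧ Subgroup.closure ((V : Set G) ∪ A) = P := by
  obtain ⟨S, hS, rfl⟩ := hP
  obtain ⟨A, hAS, hA, h⟩ := hS.exists_finite_subset_mul hV
  have hAP : A ⊆ Subgroup.closure S := hAS.trans Subgroup.subset_closure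
  refine ⟨A, hA, hAP, le_antisymm ((Subgroup.closure_le _).2 (Set.union_subset hVP hAP))
    ((Subgroup.closure_le _).2 fun s hs => ?_)⟩
  obtain ⟨a, ha, v, hv, rfl⟩ := h hs
  exact mul_mem (Subgroup.subset_closure (Or.inr ha)) (Subgroup.subset_closure (Or.inl hv))

lemma IsPolyGrowthGroup.compactlyGenerated_of_cyclic_quotient (hG : IsPolyGrowthGroup G)
    {N P : Subgroup G} (hP : P.CompactlyGenerated) (hN : IsOpen (N : Set G)) (hNP : N ≤ P) {t : G}
    (ht : t ∈ Subgroup.normalizer (N : Set G)) (hPt : ∀ p ∈ P, ∃ m ∈ N, ∃ k : ℤ, p = m * t ^ k) :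
    N.CompactlyGenerated := by
  obtain ⟨V₀, hV₀, hV₀'⟩ := hG.exists_compact_open
  set V := V₀ ⊓ N with hVdef
  have hVc : IsCompact (V : Set G) := hV₀.inter_right (N.isClosed_of_isOpen hN)
  have hVo : IsOpen (V : Set G) := hV₀'.inter hN
  have hVN : V ≤ N := inf_le_right
  obtain ⟨A, hA, hAP, hcl⟩ := hP.exists_finite hVo (hVN.trans hNP)
  choose! n hn k hk using fun a (ha : a ∈ A) => hPt a (hAP ha)
  have htN : ∀ g ∈ N, t * g * t⁻¹ ∈ N := fun g hg => (Subgroup.mem_normalizer_iff.1 ht g).1 hg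
  have htN' : ∀ g ∈ N, t⁻¹ * g * t ∈ N := fun g hg => by
    simpa using (Subgroup.mem_normalizer_iff.1 (inv_mem ht) g).1 hg
  obtain ⟨B, hB, hBf, hB'⟩ := (hVc.image (f := fun g => t * g * t⁻¹)
    (by fun_prop)).exists_finite_subset_mul hVo
  obtain ⟨D, hD, hDf, hD'⟩ := (hVc.image (f := fun g => t⁻¹ * g * t)
    (by fun_prop)).exists_finite_subset_mul hVo
  have hBN : B ⊆ N := fun b hb => by
    obtain ⟨v, hv, rfl⟩ := hB hb
    exact htN v (hVN hv)
  have hDN : D ⊆ N := fun b hb => by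
    obtain ⟨v, hv, rfl⟩ := hD hb
    exact htN' v (hVN hv)
  set E := n '' A ∪ B ∪ D
  have hsub : ∀ F ⊆ E, ∀ x ∈ F * (V : Set G), x ∈ Subgroup.closure ((V : Set G) ∪ E) := by
    rintro F hF _ ⟨f, hf, v, hv, rfl⟩
    exact mul_mem (Subgroup.subset_closure (Or.inr (hF hf))) (Subgroup.subset_closure (Or.inl hv))
  obtain ⟨A', hA', hA'N⟩ := exists_finite_closure_of_cyclic_quotient V N
    (fun B hB => hG.growth V hVc hVo B hB.isCompact) hVN t htN htN' E
    (((hA.image n).union hBf).union hDf)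
    (Set.union_subset (Set.union_subset (by rintro _ ⟨a, ha, rfl⟩; exact hn a ha) hBN) hDN)
    (by
      rw [← hcl] at hNP
      refine hNP.trans ((Subgroup.closure_le _).2 (Set.union_subset (fun v hv =>
        Subgroup.subset_closure (Or.inl (Or.inl hv))) fun a ha => ?_))
      have h₁ : n a ∈ Subgroup.closure ((V : Set G) ∪ E ∪ {t}) :=
        Subgroup.subset_closure (Or.inl (Or.inr (Or.inl (Or.inl ⟨a, ha, rfl⟩))))
      have h₂ : t ∈ Subgroup.closure ((V : Set G) ∪ E ∪ {t}) :=
        Subgroup.subset_closure (Or.inr rfl)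
      rw [hk a ha]
      exact mul_mem h₁ (Subgroup.zpow_mem _ h₂ _))
    (fun v hv => hsub B (fun b hb => Or.inl (Or.inr hb)) _ (hB' ⟨v, hv, rfl⟩))
    (fun v hv => hsub D (fun b hb => Or.inr hb) _ (hD' ⟨v, hv, rfl⟩))
  rw [← hA'N]
  exact compactlyGenerated_closure_union hVc hA'

/-- In a group of polynomial growth, an open subgroup of a compactly generated subgroup is
compactly generated as soon as it contains all commutators. -/
lemma IsPolyGrowthGroup.compactlyGenerated_of_commutators_mem (hG : IsPolyGrowthGroup G)
    {K P : Subgroup G} (hP : P.CompactlyGenerated) (hK : IsOpen (K : Set G)) (hKP : K ≤ P)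
    (hcomm : ∀ x ∈ P, ∀ y ∈ P, x * y * x⁻¹ * y⁻¹ ∈ K) : K.CompactlyGenerated := by
  obtain ⟨A, hA, hAP, hcl⟩ := hP.exists_finite hK hKP
  suffices ∀ T : Set G, T.Finite → T ⊆ P →
      (Subgroup.closure ((K : Set G) ∪ T)).CompactlyGenerated → K.CompactlyGenerated from
    this A hA hAP (hcl ▸ hP)
  intro T hT
  induction T, hT using Set.Finite.induction_on with
  | empty => intro _ h; simpa using h
  | @insert t T _ _ ih =>
    intro hTP h
    have htP : t ∈ P := hTP (Set.mem_insert _ _)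
    have hTP' : T ⊆ P := (Set.subset_insert _ _).trans hTP
    set N := Subgroup.closure ((K : Set G) ∪ T) with hN
    have hKN : K ≤ N := fun g hg => Subgroup.subset_closure (Or.inl hg)
    have hNP : N ≤ P := (Subgroup.closure_le _).2 (Set.union_subset hKP hTP')
    have hconj : ∀ x ∈ P, ∀ g ∈ N, x * g * x⁻¹ ∈ N := fun x hx g hg => by
      simpa using mul_mem (hKN (hcomm x hx g (hNP hg))) hg
    have htn : t ∈ Subgroup.normalizer (N : Set G) := by
      rw [Subgroup.mem_normalizer_iff]
      refine fun g => ⟨hconj t htP g, fun hg => ?_⟩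
      have := hconj _ (inv_mem htP) _ hg
      convert this using 1; group
    refine ih hTP' (hG.compactlyGenerated_of_cyclic_quotient h
      (Subgroup.isOpen_mono hKN hK) ?_ htn fun p hp => ?_)
    · exact Subgroup.closure_mono (Set.union_subset_union_right _ (Set.subset_insert _ _))
    · refine exists_mul_zpow_of_mem_closure N htn ((Subgroup.closure_le _).2 ?_ hp)
      rintro x (hx | rfl | hx)
      · exact Subgroup.subset_closure (Or.inl (hKN hx))
      · exact Subgroup.subset_closure (Or.inr rfl)
      · exact Subgroup.subset_closure (Or.inl (Subgroup.subset_closure (Or.inr hx)))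

/-- Schreier's lemma for closed subgroups of finite index. -/
lemma Subgroup.compactlyGenerated_of_finiteIndex (hG : (⊤ : Subgroup G).CompactlyGenerated)
    {H : Subgroup G} [H.FiniteIndex] (hH : IsClosed (H : Set G)) : H.CompactlyGenerated := by
  obtain ⟨S, hS, hcl⟩ := hG
  obtain ⟨R, hR, hR1⟩ := H.exists_isComplement_right 1
  have hRf : R.Finite := hR.finite_right
  have hc : IsCompact ((R * S * R⁻¹ : Set G) ∩ H) :=
    ((hRf.isCompact.mul hS).mul hRf.inv.isCompact).inter_right hH
  refine ⟨_, hc, le_antisymm ((Subgroup.closure_le _).2 Set.inter_subset_right)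
    ((Subgroup.closure_mul_image_eq hR hR1 hcl).ge.trans (Subgroup.closure_mono ?_))⟩
  rintro _ ⟨g, hg, rfl⟩
  refine ⟨Set.mul_mem_mul hg (Set.inv_mem_inv.2 (Subtype.prop _)), ?_⟩
  exact (Subgroup.closure_mul_image_eq hR hR1 hcl).le (Subgroup.subset_closure ⟨g, hg, rfl⟩)

lemma IsPolyGrowthGroup.of_finiteIndex (hG : IsPolyGrowthGroup G)
    {H : Subgroup G} [H.FiniteIndex] (hH : IsOpen (H : Set G)) : IsPolyGrowthGroup H where
  exists_compact_open := by
    obtain ⟨V, hV, hV'⟩ := hG.exists_compact_open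
    exact ⟨V.comap H.subtype, (H.isClosed_of_isOpen hH).isClosedEmbedding_subtypeVal.isCompact_preimage hV,
      hV'.preimage continuous_subtype_val⟩
  growth V hV hV' S hS := by
    obtain ⟨C, d, h⟩ := hG.growth (V.map H.subtype) (hV.image continuous_subtype_val)
      (hH.isOpenMap_subtype_val _ hV') ((↑) '' S) (hS.image continuous_subtype_val)
    refine ⟨C, d, fun m => (le_of_eq_of_le ?_ (h m))⟩
    let f : H ⧸ V → G ⧸ (V.map H.subtype) := Quotient.map' (↑) fun a b hab => by
      rw [QuotientGroup.leftRel_apply] at hab ⊢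
      exact ⟨_, hab, rfl⟩
    have hf : Function.Injective f := by
      rintro ⟨a⟩ ⟨b⟩ hab
      obtain ⟨x, hx, hxe⟩ := QuotientGroup.eq.1 hab
      refine QuotientGroup.eq.2 ?_
      rwa [show a⁻¹ * b = x from Subtype.ext hxe.symm]
    rw [← Set.ncard_image_of_injective _ hf, Set.image_image]
    have : ((↑) '' S : Set G) ^ m = H.subtype '' (S ^ m) := by
      rw [Set.image_pow]; rfl
    rw [this, Set.image_image]
    rfl
  compactlyGenerated := (Subgroup.compactlyGenerated_of_finiteIndex hG.compactlyGenerated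
    (H.isClosed_of_isOpen hH)).top_of_isClosed (H.isClosed_of_isOpen hH)

end CompactlyGenerated

lemma exists_succ_le_of_le_pow {b : ℕ → ℝ} (h0 : 0 < b 0) (C : ℝ) (d : ℕ)
    (hb : ∀ m, b m ≤ C * ((m : ℝ) + 2) ^ d) {ε : ℝ} (hε : 0 < ε) :
    ∃ m, b (m + 1) ≤ (1 + ε) * b m := by
  by_contra! h
  have hlow : ∀ m, (1 + ε) ^ m * b 0 ≤ b m := by
    intro m
    induction m with
    | zero => simp
    | succ m ih =>
      calc (1 + ε) ^ (m + 1) * b 0 = (1 + ε) * ((1 + ε) ^ m * b 0) := by ring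
        _ ≤ (1 + ε) * b m := by gcongr
        _ ≤ b (m + 1) := (h m).le
  have hC : 0 < C := by
    have := h0.trans_le (hb 0)
    exact pos_of_mul_pos_left this (by positivity)
  have hlim : Tendsto (fun m : ℕ => (C * 3 ^ d) * ((m : ℝ) ^ d / (1 + ε) ^ m)) atTop (𝓝 0) := by
    simpa using (tendsto_pow_const_div_const_pow_of_one_lt d (r := 1 + ε)
      (by linarith)).const_mul (C * 3 ^ d)
  obtain ⟨m, hm1, hm⟩ := ((eventually_ge_atTop 1).and
    (hlim.eventually (gt_mem_nhds h0))).exists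
  rw [mul_div_assoc', div_lt_iff₀ (by positivity)] at hm
  have h1 : (1 : ℝ) ≤ m := by exact_mod_cast hm1
  have h3 : C * ((m : ℝ) + 2) ^ d ≤ C * 3 ^ d * m ^ d := by
    rw [mul_assoc, ← mul_pow]
    gcongr
    linarith
  have := hlow m
  have := hb m
  linarith

lemma measure_le_ncard_mul {G : Type*} [Group G] [TopologicalSpace G] [IsTopologicalGroup G]
    [MeasurableSpace G] [BorelSpace G] (μ : Measure G) [μ.IsMulLeftInvariant] {V : Subgroup G}
    {S : Set G} (hfin : ((QuotientGroup.mk : G → G ⧸ V) '' S).Finite) :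
    μ S ≤ ((QuotientGroup.mk : G → G ⧸ V) '' S).ncard * μ V := by
  have hsub : S ⊆ ⋃ q ∈ hfin.toFinset, (q.out : G) • (V : Set G) := by
    intro s hs
    have hmem : (s : G ⧸ V) ∈ hfin.toFinset := by
      rw [Set.Finite.mem_toFinset]; exact ⟨s, hs, rfl⟩
    refine Set.mem_biUnion hmem ⟨(Quotient.out (s : G ⧸ V))⁻¹ * s, ?_, by simp⟩
    exact QuotientGroup.eq.1 (Quotient.out_eq _)
  calc μ S ≤ μ (⋃ q ∈ hfin.toFinset, (q.out : G) • (V : Set G)) := measure_mono hsub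
    _ ≤ ∑ q ∈ hfin.toFinset, μ ((q.out : G) • (V : Set G)) := measure_biUnion_finset_le _ _
    _ = _ := by
      simp only [measure_smul, Finset.sum_const, nsmul_eq_mul]
      rw [Set.ncard_eq_toFinset_card _ hfin]

/-- Følner sequences in groups of polynomial growth. -/
lemma IsPolyGrowthGroup.exists_folner {G : Type*} [Group G] [TopologicalSpace G]
    [IsTopologicalGroup G] [MeasurableSpace G] [BorelSpace G]
    (hG : IsPolyGrowthGroup G) (μ : Measure G) [μ.IsHaarMeasure] :
    ∃ W : Set G, IsCompact W ∧ (1 : G) ∈ W ∧ W⁻¹ = W ∧ Subgroup.closure W = ⊤ ∧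
      (∀ m, μ (W ^ (m + 1)) ≠ 0) ∧ (∀ m, μ (W ^ m) ≠ ⊤) ∧
      ∀ ε : ℝ, 0 < ε → ∃ m : ℕ, μ (W ^ (m + 2)) ≤ (1 + ENNReal.ofReal ε) * μ (W ^ (m + 1)) := by
  obtain ⟨V, hVc, hVo⟩ := hG.exists_compact_open
  obtain ⟨S, hS, hcl⟩ := hG.compactlyGenerated
  set W : Set G := S ∪ S⁻¹ ∪ V with hW
  have hWc : IsCompact W := (hS.union hS.inv).union hVc
  have h1W : (1 : G) ∈ W := Or.inr (one_mem V)
  have hpc : ∀ m, IsCompact (W ^ m) := fun m => by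
    induction m with
    | zero => simp
    | succ m ih => rw [pow_succ]; exact ih.mul hWc
  have hfinite : ∀ m, μ (W ^ m) ≠ ⊤ := fun m => (hpc m).measure_lt_top.ne
  have hpos : ∀ m, μ (W ^ (m + 1)) ≠ 0 := fun m => by
    have h1 : W ⊆ W ^ (m + 1) := by
      simpa only [pow_one] using Set.pow_subset_pow_right h1W (Nat.le_add_left 1 m)
    have hsub : (V : Set G) ⊆ W ^ (m + 1) := Set.subset_union_right.trans h1
    exact ((hVo.measure_pos μ ⟨1, one_mem V⟩).trans_le (measure_mono hsub)).ne'
  refine ⟨W, hWc, h1W, ?_, ?_, hpos, hfinite, fun ε hε => ?_⟩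
  · simp [hW, Set.union_comm]
  · refine top_le_iff.1 (hcl ▸ Subgroup.closure_mono ?_)
    exact Set.subset_union_left.trans Set.subset_union_left
  · obtain ⟨C, d, h⟩ := hG.growth V hVc hVo W hWc
    obtain ⟨m, hm⟩ := exists_succ_le_of_le_pow (b := fun m => (μ (W ^ (m + 1))).toReal)
      (ENNReal.toReal_pos (hpos 0) (hfinite 1)) (C * (μ (V : Set G)).toReal) d (fun m => by
        have h1 := measure_le_ncard_mul μ ((hpc (m + 1)).finite_image_mk hVo)
        have h2 := ENNReal.toReal_mono (ENNReal.mul_ne_top (by simp) hVc.measure_lt_top.ne) h1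
        rw [ENNReal.toReal_mul, ENNReal.toReal_natCast] at h2
        refine h2.trans ?_
        have h3 : (((QuotientGroup.mk : G → G ⧸ V) '' (W ^ (m + 1))).ncard : ℝ) ≤
            C * ((m : ℝ) + 2) ^ d := by
          have := h (m + 1)
          have h4 : (m : ℝ) + 2 = ((m + 1 + 1 : ℕ) : ℝ) := by push_cast; ring
          rw [h4]
          exact_mod_cast this
        calc _ ≤ (C * ((m : ℝ) + 2) ^ d) * (μ (V : Set G)).toReal := by gcongr
          _ = _ := by ring) hε
    refine ⟨m, ?_⟩
    rw [← ENNReal.toReal_le_toReal (hfinite _) (ENNReal.mul_ne_top (by simp) (hfinite _)),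
      ENNReal.toReal_mul, ENNReal.toReal_add (by simp) (by simp), ENNReal.toReal_ofReal hε.le]
    simpa using hm

/-- Groups of polynomial growth are amenable: they preserve a probability measure on every compact
metric space on which they act continuously. -/
lemma IsPolyGrowthGroup.exists_invariant_measure {G : Type*} [Group G] [TopologicalSpace G]
    [IsTopologicalGroup G] [T2Space G] (hG : IsPolyGrowthGroup G)
    {X : Type*} [MetricSpace X] [CompactSpace X] [MeasurableSpace X] [BorelSpace X]
    [MulAction G X] [ContinuousConstSMul G X] (x₀ : X) (hx₀ : Continuous fun g : G => g • x₀) :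
    ∃ ν : Measure X, IsProbabilityMeasure ν ∧ ∀ g : G, ν.map (g • ·) = ν := by
  borelize G
  obtain ⟨V, hVc, hVo⟩ := hG.exists_compact_open
  have : LocallyCompactSpace G := hVc.locallyCompactSpace_of_mem_nhds_of_group
    (hVo.mem_nhds (one_mem V))
  let μ : Measure G := Measure.haar
  obtain ⟨W, hWc, h1W, hWinv, hcl, hpos, hfin, hfol⟩ := hG.exists_folner μ
  have hpc : ∀ m, IsCompact (W ^ m) := fun m => by
    induction m with
    | zero => simp
    | succ m ih => rw [pow_succ]; exact ih.mul hWc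
  have hmeas : ∀ m, MeasurableSet (W ^ m) := fun m => (hpc m).measurableSet
  have hε : ∀ k : ℕ, (0 : ℝ) < 1 / ((k : ℝ) + 1) := fun k => by positivity
  choose m hm using fun k : ℕ => hfol _ (hε k)
  let p : G → X := fun g => g • x₀
  have hp : Measurable p := hx₀.measurable
  let ν' : ℕ → Measure X := fun k =>
    ((μ (W ^ (m k + 1)))⁻¹ • μ.restrict (W ^ (m k + 1))).map p
  have hν' : ∀ k, IsProbabilityMeasure (ν' k) := fun k => by
    refine ⟨?_⟩
    simp only [ν']
    rw [Measure.map_apply hp MeasurableSet.univ]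
    simp [ENNReal.inv_mul_cancel (hpos _) (hfin _)]
  have hlint : ∀ k (f : X → ENNReal), Measurable f → ∫⁻ x, f x ∂(ν' k) =
      (μ (W ^ (m k + 1)))⁻¹ * ∫⁻ h in W ^ (m k + 1), f (p h) ∂μ := fun k f hf => by
    simp only [ν']
    rw [lintegral_map hf hp, lintegral_smul_measure, smul_eq_mul]
  have hest : ∀ k, ∀ g ∈ W, ∀ (f : BoundedContinuousFunction X NNReal) (M : NNReal), (∀ x, f x ≤ M) →
      ∫⁻ x, f (g • x) ∂(ν' k) ≤ ∫⁻ x, f x ∂(ν' k) + M * ENNReal.ofReal (1 / ((k : ℝ) + 1)) := by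
    intro k g hg f M hM
    have hf : Measurable fun x => (f x : ENNReal) := f.continuous.measurable.coe_nnreal_ennreal
    have hfg : Measurable fun x => (f (g • x) : ENNReal) := hf.comp (measurable_const_smul g)
    rw [hlint k _ hfg, hlint k _ hf]
    set F := W ^ (m k + 1)
    set F' := W ^ (m k + 2)
    have hFF' : F ⊆ F' := Set.pow_subset_pow_right h1W (by omega)
    have h1 : ∫⁻ h in F, f (g • p h) ∂μ ≤ ∫⁻ h in F', f (p h) ∂μ := by
      rw [← lintegral_indicator (hmeas _), ← lintegral_indicator (hmeas _),
        ← lintegral_mul_left_eq_self (fun h => F'.indicator (fun h => (f (p h) : ENNReal)) h) g]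
      refine lintegral_mono fun h => ?_
      by_cases hh : h ∈ F
      · have hgh : g * h ∈ F' := by
          change g * h ∈ W ^ (m k + 1 + 1)
          rw [pow_succ']; exact Set.mul_mem_mul hg hh
        rw [Set.indicator_of_mem hh, Set.indicator_of_mem hgh]
        simp [p, mul_smul]
      · rw [Set.indicator_of_notMem hh]; exact zero_le
    have h2 : ∫⁻ h in F', f (p h) ∂μ ≤ ∫⁻ h in F, f (p h) ∂μ + M * μ (F' \ F) := by
      rw [← lintegral_inter_add_sdiff (fun h => (f (p h) : ENNReal)) F' (hmeas (m k + 1)),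
        Set.inter_eq_right.2 hFF']
      gcongr
      calc _ ≤ ∫⁻ h in F' \ F, (M : ENNReal) ∂μ := lintegral_mono fun h => by
            exact ENNReal.coe_le_coe.2 (hM (p h))
        _ = _ := by simp
    have h3 : μ (F' \ F) ≤ ENNReal.ofReal (1 / ((k : ℝ) + 1)) * μ F := by
      rw [measure_sdiff hFF' (hmeas _).nullMeasurableSet (hfin _), tsub_le_iff_left]
      have := hm k
      rwa [add_mul, one_mul] at this
    calc (μ F)⁻¹ * ∫⁻ h in F, f (g • p h) ∂μ
        ≤ (μ F)⁻¹ * (∫⁻ h in F, f (p h) ∂μ +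
            M * (ENNReal.ofReal (1 / ((k : ℝ) + 1)) * μ F)) := by
          gcongr
          exact h1.trans (h2.trans (by gcongr))
      _ = (μ F)⁻¹ * ∫⁻ h in F, f (p h) ∂μ +
            M * ENNReal.ofReal (1 / ((k : ℝ) + 1)) * ((μ F)⁻¹ * μ F) := by ring
      _ = _ := by rw [ENNReal.inv_mul_cancel (hpos _) (hfin _), mul_one]
  let P : ℕ → ProbabilityMeasure X := fun k => ⟨ν' k, hν' k⟩
  obtain ⟨ν, -, φ, hφ, hlim⟩ := isCompact_univ.tendsto_subseq (fun k => Set.mem_univ (P k))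
  rw [ProbabilityMeasure.tendsto_iff_forall_lintegral_tendsto] at hlim
  have hle : ∀ g ∈ W, ∀ f : BoundedContinuousFunction X NNReal,
      ∫⁻ x, f (g • x) ∂(ν : Measure X) ≤ ∫⁻ x, f x ∂(ν : Measure X) := by
    intro g hg f
    obtain ⟨M, hM⟩ := (isCompact_range f.continuous).bddAbove
    replace hM : ∀ x, f x ≤ M := fun x => hM ⟨x, rfl⟩
    let fg : BoundedContinuousFunction X NNReal := f.compContinuous ⟨(g • ·), continuous_const_smul g⟩
    have h0 : Tendsto (fun k : ℕ => M * ENNReal.ofReal (1 / ((φ k : ℝ) + 1))) atTop (𝓝 0) := by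
      have h1 : Tendsto (fun k : ℕ => ENNReal.ofReal (1 / ((φ k : ℝ) + 1))) atTop (𝓝 0) := by
        rw [← ENNReal.ofReal_zero]
        exact ENNReal.tendsto_ofReal
          ((tendsto_one_div_add_atTop_nhds_zero_nat (𝕜 := ℝ)).comp hφ.tendsto_atTop)
      simpa using ENNReal.Tendsto.const_mul (a := (M : ENNReal)) h1 (Or.inr (by simp))
    have h2 := (hlim f).add h0
    rw [add_zero] at h2
    exact le_of_tendsto_of_tendsto' (hlim fg) h2 fun k => hest (φ k) g hg f M hM
  refine ⟨ν, inferInstance, fun g => ?_⟩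
  have hg : g ∈ Subgroup.closure W := hcl ▸ Subgroup.mem_top g
  induction hg using Subgroup.closure_induction with
  | mem g hg =>
    have : IsProbabilityMeasure ((ν : Measure X).map (g • ·)) :=
      Measure.isProbabilityMeasure_map (measurable_const_smul g).aemeasurable
    refine ext_of_forall_lintegral_eq_of_IsFiniteMeasure fun f => ?_
    rw [lintegral_map f.continuous.measurable.coe_nnreal_ennreal (measurable_const_smul g)]
    refine le_antisymm (hle g hg f) ?_
    have hg' : g⁻¹ ∈ W := by rw [← hWinv]; simpa
    simpa using hle g⁻¹ hg' (f.compContinuous ⟨(g • ·), continuous_const_smul g⟩)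
  | one => simp
  | mul g h _ _ hg hh =>
    rw [show (fun x : X => (g * h) • x) = (g • ·) ∘ (h • ·) by ext; simp [mul_smul],
      ← Measure.map_map (measurable_const_smul g) (measurable_const_smul h), hh, hg]
  | inv g _ hg =>
    conv_lhs => rw [← hg]
    rw [Measure.map_map (measurable_const_smul _) (measurable_const_smul _)]
    simp [Function.comp_def]

/-- The multiple of `w` by a power of `p` whose norm lies in `[1, ‖p‖)`. -/
noncomputable def zpowNormalize {F Y : Type*} [NontriviallyNormedField F] [NormedAddCommGroup Y]
    [NormedSpace F Y] (p : F) (w : Y) : Y :=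
  p ^ (-⌊Real.logb ‖p‖ ‖w‖⌋) • w

section Normalize

variable {F Y : Type*} [NontriviallyNormedField F] [NormedAddCommGroup Y] [NormedSpace F Y] {p : F}

lemma zpowNormalize_of_norm_mem (hp : 1 < ‖p‖) {w : Y} (h1 : 1 ≤ ‖w‖) (h2 : ‖w‖ < ‖p‖) :
    zpowNormalize p w = w := by
  have : ⌊Real.logb ‖p‖ ‖w‖⌋ = 0 := by
    rw [Int.floor_eq_zero_iff]
    refine ⟨Real.logb_nonneg hp h1, ?_⟩
    rw [Real.logb_lt_iff_lt_rpow hp (by linarith), Real.rpow_one]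
    exact h2
  simp [zpowNormalize, this]

lemma zpowNormalize_zpow_smul (hp : 1 < ‖p‖) (j : ℤ) (w : Y) :
    zpowNormalize p (p ^ j • w) = zpowNormalize p w := by
  have hp0 : p ≠ 0 := norm_pos_iff.1 (by linarith)
  rcases eq_or_ne w 0 with rfl | hw
  · simp [zpowNormalize]
  have hlog : Real.logb ‖p‖ ‖p ^ j • w‖ = Real.logb ‖p‖ ‖w‖ + j := by
    rw [norm_smul, norm_zpow, Real.logb_mul (zpow_ne_zero _ (by linarith)) (norm_ne_zero_iff.2 hw),
      ← Real.rpow_intCast, Real.logb_rpow (by linarith) hp.ne']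
    ring
  rw [zpowNormalize, hlog, Int.floor_add_intCast, smul_smul, ← zpow_add₀ hp0, zpowNormalize]
  congr 2
  ring

lemma norm_zpowNormalize_mem (hp : 1 < ‖p‖) {w : Y} (hw : w ≠ 0) :
    1 ≤ ‖zpowNormalize p w‖ ∧ ‖zpowNormalize p w‖ < ‖p‖ := by
  have hp0 : 0 < ‖p‖ := by linarith
  have hw0 : 0 < ‖w‖ := norm_pos_iff.2 hw
  set k := ⌊Real.logb ‖p‖ ‖w‖⌋ with hk
  have h1 : ‖p‖ ^ k ≤ ‖w‖ := by
    rw [← Real.rpow_intCast, ← Real.le_logb_iff_rpow_le hp hw0]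
    exact Int.floor_le _
  have h2 : ‖w‖ < ‖p‖ ^ (k + 1) := by
    rw [← Real.rpow_intCast, ← Real.logb_lt_iff_lt_rpow hp hw0]
    push_cast
    exact Int.lt_floor_add_one _
  have h3 : 0 < ‖p‖ ^ k := by positivity
  rw [zpowNormalize, ← hk, norm_smul, norm_zpow, _root_.zpow_neg, inv_mul_eq_div, le_div_iff₀ h3,
    div_lt_iff₀ h3, one_mul]
  refine ⟨h1, h2.trans_eq ?_⟩
  rw [zpow_add_one₀ hp0.ne', mul_comm]

lemma zpowNormalize_map (hp : 1 < ‖p‖) {Z : Type*} [NormedAddCommGroup Z] [NormedSpace F Z]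
    (A : Y →ₗ[F] Z) (w : Y) : zpowNormalize p (A (zpowNormalize p w)) = zpowNormalize p (A w) := by
  rw [show zpowNormalize p w = p ^ (-⌊Real.logb ‖p‖ ‖w‖⌋) • w from rfl, map_smul,
    zpowNormalize_zpow_smul hp]

lemma continuousAt_zpowNormalize [IsUltrametricDist Y] {w : Y} (hw : w ≠ 0) :
    ContinuousAt (zpowNormalize p) w := by
  have h1 : ∀ᶠ x in 𝓝 w, ‖x‖ = ‖w‖ := by
    have := (IsUltrametricDist.isOpen_sphere (0 : Y) (norm_ne_zero_iff.2 hw)).mem_nhds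
      (x := w) (by simp)
    filter_upwards [this] with x hx
    simpa using hx
  have h2 : (fun x => p ^ (-⌊Real.logb ‖p‖ ‖w‖⌋) • x) =ᶠ[𝓝 w] zpowNormalize p := by
    filter_upwards [h1] with x hx
    rw [zpowNormalize, hx]
  exact (continuous_const_smul _).continuousAt.congr h2

lemma isCompact_one_le_norm_lt [IsUltrametricDist Y] [ProperSpace Y] (r : ℝ) :
    IsCompact {w : Y | 1 ≤ ‖w‖ ∧ ‖w‖ < r} := by
  refine (isCompact_closedBall (0 : Y) r).of_isClosed_subset ?_ fun w hw => by simpa using hw.2.le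
  have h : IsClosed {w : Y | ‖w‖ < r} := by
    simpa [Metric.ball] using IsUltrametricDist.isClosed_ball (0 : Y) r
  exact (isClosed_le continuous_const continuous_norm).inter h

end Normalize

section Irreducible

variable {F : Type*} [NontriviallyNormedField F] {G : Type*} [Group G] [TopologicalSpace G]
  [IsTopologicalGroup G] {Y : Type*} [NormedAddCommGroup Y] [NormedSpace F Y]

/-- A finite measure which is preserved by a group of linear maps and charges a proper subspace
produces a proper subspace with a stabilizer of finite index. -/
lemma exists_finiteIndex_invariant_submodule [CompleteSpace F] [FiniteDimensional F Y]
    (ρ : G →* (Y →ₗ[F] Y))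
    (hρ : ∀ v, Continuous fun g => ρ g v) {X : Type*} [MeasurableSpace X] (ν : Measure X)
    [IsFiniteMeasure ν] (f : X → Y) (hf : ∀ S : Submodule F Y, MeasurableSet (f ⁻¹' S))
    (h0 : ∀ x, f x ≠ 0)
    (hν : ∀ (S : Submodule F Y) g, ν (f ⁻¹' (S.comap (ρ g) : Submodule F Y)) = ν (f ⁻¹' S))
    (S : Submodule F Y) (hS : S ≠ ⊤) (hνS : ν (f ⁻¹' S) ≠ 0) :
    ∃ G₁ : Subgroup G, IsOpen (G₁ : Set G) ∧ G₁.FiniteIndex ∧ ∃ S : Submodule F Y,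
      S ≠ ⊥ ∧ S ≠ ⊤ ∧ ∀ g ∈ G₁, S ≤ S.comap (ρ g) := by
  classical
  have hex : ∃ d, ∃ S : Submodule F Y, S ≠ ⊤ ∧ ν (f ⁻¹' S) ≠ 0 ∧ Module.finrank F S = d :=
    ⟨_, S, hS, hνS, rfl⟩
  obtain ⟨S, hS, hνS, hd⟩ := Nat.find_spec hex
  have hmin : ∀ S' : Submodule F Y, S' < S → ν (f ⁻¹' S') = 0 := fun S' h => by
    by_contra hne
    refine Nat.find_min hex (m := Module.finrank F S') ?_ ⟨S', (h.trans hS.lt_top).ne, hne, rfl⟩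
    rw [← hd]
    exact Submodule.finrank_lt_finrank_of_lt h
  have hSbot : S ≠ ⊥ := by
    rintro rfl
    refine hνS ?_
    have : f ⁻¹' ((⊥ : Submodule F Y) : Set Y) = ∅ := by
      ext x; simpa using h0 x
    rw [this, measure_empty]
  have hmul : ∀ g h x, ρ (g * h) x = ρ g (ρ h x) := fun g h x => by simp
  have hinv : ∀ g x, ρ g⁻¹ (ρ g x) = x := fun g x => by rw [← hmul]; simp
  have hinv' : ∀ g x, ρ g (ρ g⁻¹ x) = x := fun g x => by rw [← hmul]; simp
  have hcm : ∀ g h, (S.comap (ρ g)).comap (ρ h) = S.comap (ρ (g * h)) := fun g h => by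
    ext x; simp
  let St : Subgroup G :=
    { carrier := {g | S.comap (ρ g) = S}
      one_mem' := by ext x; simp
      mul_mem' := fun {a b} ha hb => by
        change _ = _ at ha hb ⊢
        rw [← hcm, ha, hb]
      inv_mem' := fun {a} ha => by
        change _ = _ at ha ⊢
        conv_lhs => rw [← ha]
        rw [hcm]
        ext x; simp }
  have hSc : IsClosed (S : Set Y) := S.closed_of_finiteDimensional
  have hStc : IsClosed (St : Set G) := by
    have : (St : Set G) = (⋂ x : S, {g | ρ g x ∈ S}) ∩ ⋂ x : S, {g | ρ g⁻¹ x ∈ S} := by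
      ext g
      simp only [Set.mem_inter_iff, Set.mem_iInter, Set.mem_ofPred_eq]
      constructor
      · intro hg
        have hg' : S.comap (ρ g) = S := hg
        have hg'' : S.comap (ρ g⁻¹) = S := St.inv_mem hg
        refine ⟨fun x => ?_, fun x => ?_⟩
        · exact hg'.ge x.2
        · exact hg''.ge x.2
      · rintro ⟨h1, h2⟩
        refine le_antisymm (fun x hx => ?_) fun x hx => h1 ⟨x, hx⟩
        have := h2 ⟨_, hx⟩
        rwa [hinv] at this
    rw [this]
    refine IsClosed.inter (isClosed_iInter fun x => hSc.preimage (hρ x)) (isClosed_iInter fun x => ?_)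
    exact hSc.preimage ((hρ x).comp continuous_inv)
  let O : Set (Submodule F Y) := Set.range fun g => S.comap (ρ g)
  have hOfin : O.Finite := by
    have hdisj : Pairwise (Function.onFun (AEDisjoint ν)
        fun s : O => f ⁻¹' (s : Submodule F Y)) := by
      rintro ⟨_, g, rfl⟩ ⟨_, h, rfl⟩ hne
      have hne' : S.comap (ρ g) ≠ S.comap (ρ h) := fun e => hne (Subtype.ext e)
      have h1 : ν (f ⁻¹' ((S.comap (ρ g) ⊓ S.comap (ρ h) : Submodule F Y))) = 0 := by
        have h2 : (S.comap (ρ g) ⊓ S.comap (ρ h) : Submodule F Y) =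
            (S ⊓ S.comap (ρ (h * g⁻¹))).comap (ρ g) := by
          ext x; simp
        rw [h2, hν]
        apply hmin
        refine lt_of_le_of_ne inf_le_left fun e => hne' ?_
        have hle : S ≤ S.comap (ρ (h * g⁻¹)) := inf_eq_left.1 e
        have hle' : S.comap (ρ g) ≤ S.comap (ρ h) := fun x hx => by
          have := hle (show ρ g x ∈ S from hx)
          simpa using this
        refine Submodule.eq_of_le_of_finrank_eq hle' ?_
        have hfr : ∀ g, Module.finrank F (S.comap (ρ g)) = Module.finrank F S := fun g => by
          let e : Y ≃ₗ[F] Y := LinearEquiv.ofLinearMap (ρ g) (ρ g⁻¹)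
            (by ext x; simp) (by ext x; simp)
          have : S.comap (ρ g) = S.map (e.symm : Y →ₗ[F] Y) := by
            rw [← Submodule.comap_equiv_eq_map_symm]; rfl
          rw [this]
          exact LinearEquiv.finrank_map_eq e.symm S
        rw [hfr, hfr]
      exact h1
    have := Measure.finite_const_le_meas_of_disjoint_iUnion₀ ν (pos_iff_ne_zero.2 hνS)
      (As := fun s : O => f ⁻¹' (s : Submodule F Y)) (fun s => (hf _).nullMeasurableSet) hdisj
      (measure_ne_top _ _)
    have huniv : {i : O | ν (f ⁻¹' S) ≤ ν (f ⁻¹' (i : Submodule F Y))} = Set.univ := by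
      ext ⟨_, g, rfl⟩
      simp only [Set.mem_ofPred_eq, Set.mem_univ, iff_true]
      exact (hν S g).ge
    rw [huniv] at this
    exact Set.finite_univ_iff.1 this
  have hStf : St.FiniteIndex := by
    have : Finite O := hOfin
    have hfq : Finite (G ⧸ St) := by
      refine Finite.of_injective (β := O)
        (Quotient.lift (fun g => ⟨S.comap (ρ g⁻¹), g⁻¹, rfl⟩) ?_) ?_
      · intro a b hab
        have hab' : a⁻¹ * b ∈ St := QuotientGroup.leftRel_apply.1 hab
        have : S.comap (ρ (a⁻¹ * b)) = S := hab'
        refine Subtype.ext ?_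
        change S.comap (ρ a⁻¹) = S.comap (ρ b⁻¹)
        conv_rhs => rw [← this]
        rw [hcm]; simp
      · intro a b
        induction a using Quotient.inductionOn with | _ a
        induction b using Quotient.inductionOn with | _ b
        intro hab
        have hab' : S.comap (ρ a⁻¹) = S.comap (ρ b⁻¹) := congrArg Subtype.val hab
        refine Quotient.sound (QuotientGroup.leftRel_apply.2 ?_)
        change S.comap (ρ (a⁻¹ * b)) = S
        rw [← hcm, hab', hcm]
        ext x; simp
    exact Subgroup.finiteIndex_of_finite_quotient
  refine ⟨St, Subgroup.isOpen_of_isClosed_of_finiteIndex _ hStc, hStf, S, hSbot, hS, fun g hg => ?_⟩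
  have : S.comap (ρ g) = S := hg
  exact this.ge

end Irreducible

section Irreducible

variable {F : Type*} [NontriviallyNormedField F]

lemma norm_det_zpowNormalize_le {m : ℕ} {p : F} (hp : 1 < ‖p‖) (M : Fin m → Fin m → F) (hM : M ≠ 0)
    (hdet : ‖(Matrix.of M).det‖ = 1) :
    ‖(Matrix.of (zpowNormalize p M)).det‖ ≤ (‖p‖ / ‖M‖) ^ m := by
  set j := ⌊Real.logb ‖p‖ ‖M‖⌋ with hj
  have hMpos : 0 < ‖M‖ := norm_pos_iff.2 hM
  have h : zpowNormalize p M = p ^ (-j) • M := rfl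
  have h1 : Matrix.of (zpowNormalize p M) = p ^ (-j) • Matrix.of M := by rw [h]; rfl
  rw [h1, Matrix.det_smul, norm_mul, hdet, mul_one, norm_pow, Fintype.card_fin]
  have h2 := (norm_zpowNormalize_mem hp hM).2.le
  rw [h, norm_smul] at h2
  gcongr
  rwa [le_div_iff₀ hMpos]

/-- In a strongly irreducible representation of a group of polynomial growth, the elements whose
determinant is a unit are uniformly bounded. -/
lemma IsPolyGrowthGroup.exists_bound_of_stronglyIrreducible [LocallyCompactSpace F]
    [IsUltrametricDist F] {G : Type*} [Group G] [TopologicalSpace G] [IsTopologicalGroup G]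
    [T2Space G] (hG : IsPolyGrowthGroup G) {m : ℕ} (ρ : G →* ((Fin m → F) →ₗ[F] (Fin m → F)))
    (hρ : ∀ v, Continuous fun g => ρ g v)
    (hirr : ∀ G₁ : Subgroup G, IsOpen (G₁ : Set G) → G₁.FiniteIndex →
      ∀ S : Submodule F (Fin m → F), (∀ g ∈ G₁, S ≤ S.comap (ρ g)) → S = ⊥ ∨ S = ⊤) :
    ∃ C : ℝ, ∀ g, ‖LinearMap.det (ρ g)‖ = 1 → ∀ i j, ‖ρ g (Pi.single i 1) j‖ ≤ C := by
  rcases Nat.eq_zero_or_pos m with rfl | hm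
  · exact ⟨0, fun g _ i => i.elim0⟩
  have : NeZero m := ⟨hm.ne'⟩
  have : ProperSpace F := ProperSpace.of_locallyCompactSpace F
  obtain ⟨p, hp⟩ := NormedField.exists_one_lt_norm F
  have hp0 : p ≠ 0 := norm_pos_iff.1 (by linarith)
  let Y := Fin m → F
  have hmul : ∀ g h x, ρ (g * h) x = ρ g (ρ h x) := fun g h x => by simp
  have hinv : ∀ g x, ρ g⁻¹ (ρ g x) = x := fun g x => by rw [← hmul]; simp
  have hne : ∀ g {x : Y}, x ≠ 0 → ρ g x ≠ 0 := fun g x hx h => hx (by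
    rw [← hinv g x, h, map_zero])
  let X := {w : Y | 1 ≤ ‖w‖ ∧ ‖w‖ < ‖p‖}
  have hX0 : ∀ x : X, (x : Y) ≠ 0 := fun x h => by
    have := x.2.1
    rw [h, norm_zero] at this
    linarith
  have hXc : CompactSpace X := isCompact_iff_compactSpace.1 (isCompact_one_le_norm_lt _)
  let act : MulAction G X :=
    { smul := fun g x => ⟨zpowNormalize p (ρ g x), norm_zpowNormalize_mem hp (hne g (hX0 x))⟩
      one_smul := fun x => Subtype.ext (by
        change zpowNormalize p (ρ 1 (x : Y)) = x
        rw [map_one]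
        exact zpowNormalize_of_norm_mem hp x.2.1 x.2.2)
      mul_smul := fun g h x => Subtype.ext (by
        change zpowNormalize p (ρ (g * h) (x : Y)) =
          zpowNormalize p (ρ g (zpowNormalize p (ρ h (x : Y))))
        rw [zpowNormalize_map hp, hmul]) }
  have hsmul : ∀ g (x : X), ((g • x : X) : Y) = zpowNormalize p (ρ g x) := fun g x => rfl
  have hact : ContinuousConstSMul G X := ⟨fun g => by
    refine Continuous.subtype_mk (continuous_iff_continuousAt.2 fun x => ?_) _
    exact (continuousAt_zpowNormalize (hne g (hX0 x))).comp_of_eq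
      ((LinearMap.continuous_of_finiteDimensional (ρ g)).comp continuous_subtype_val).continuousAt
      rfl⟩
  let x₀ : X := ⟨fun _ => 1, by
    have h1 : ‖(fun _ => 1 : Y)‖ = 1 := by simp
    exact ⟨h1.ge, h1.trans_lt hp⟩⟩
  have hx₀ : Continuous fun g : G => g • x₀ := by
    refine Continuous.subtype_mk (continuous_iff_continuousAt.2 fun g => ?_) _
    exact (continuousAt_zpowNormalize (hne g (hX0 x₀))).comp_of_eq (hρ x₀).continuousAt rfl
  borelize ↥X
  obtain ⟨ν, hνp, hν⟩ := hG.exists_invariant_measure x₀ hx₀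
  have hcl : ∀ S : Submodule F Y, IsClosed (S : Set Y) := fun S => S.closed_of_finiteDimensional
  have hms : ∀ S : Submodule F Y, MeasurableSet ((Subtype.val : X → Y) ⁻¹' S) := fun S =>
    ((hcl S).preimage continuous_subtype_val).measurableSet
  have hnull : ∀ S : Submodule F Y, S ≠ ⊤ → ν ((Subtype.val : X → Y) ⁻¹' S) = 0 := by
    intro S hS
    by_contra hνS
    obtain ⟨G₁, h1, h2, S', hb, ht, hinvS⟩ := exists_finiteIndex_invariant_submodule ρ hρ ν
      (Subtype.val : X → Y) hms hX0 (fun S g => by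
        conv_rhs => rw [← hν g]
        rw [Measure.map_apply (measurable_const_smul g) (hms S)]
        congr 1
        ext x
        have h3 : p ^ (-⌊Real.logb ‖p‖ ‖ρ g x‖⌋) ≠ 0 := zpow_ne_zero _ hp0
        simp only [Set.mem_preimage, SetLike.mem_coe, Submodule.mem_comap, hsmul, zpowNormalize]
        exact (S.smul_mem_iff h3).symm) S hS hνS
    exact (hirr G₁ h1 h2 S' hinvS).elim hb ht
  let M : G → Fin m → Fin m → F := fun g i => ρ g (Pi.single i 1)
  have hMρ : ∀ g, Fintype.linearCombination F (M g) = ρ g := fun g => by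
    ext i : 2
    simp [M, Fintype.linearCombination_apply, Pi.single_apply]
  have hMdet : ∀ g, (Matrix.of (M g)).det = LinearMap.det (ρ g) := fun g => by
    rw [← LinearMap.det_toMatrix', ← Matrix.det_transpose]
    rfl
  by_contra! hunb
  have hseq : ∀ k : ℕ, ∃ g, ‖LinearMap.det (ρ g)‖ = 1 ∧ (k : ℝ) < ‖M g‖ := fun k => by
    obtain ⟨g, hg, i, j, hij⟩ := hunb k
    exact ⟨g, hg, hij.trans_le ((norm_le_pi_norm (M g i) j).trans (norm_le_pi_norm (M g) i))⟩
  choose g hg hgk using hseq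
  have hM0 : ∀ k, M (g k) ≠ 0 := fun k h => by
    have := hgk k
    rw [h, norm_zero] at this
    exact absurd this (not_lt.2 k.cast_nonneg)
  obtain ⟨T, hT, φ, hφ, hlim⟩ := (isCompact_one_le_norm_lt (Y := Fin m → Fin m → F)
    ‖p‖).tendsto_subseq (fun k => norm_zpowNormalize_mem hp (hM0 k))
  let h := Fintype.linearCombination F T
  have hhT : ∀ i, h (Pi.single i 1) = T i := fun i => by
    simp [h, Fintype.linearCombination_apply_single]
  have hTdet : (Matrix.of T).det = 0 := by
    have h1 : Tendsto (fun k => (Matrix.of (zpowNormalize p (M (g (φ k))))).det) atTop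
        (𝓝 (Matrix.of T).det) := by
      have : Continuous fun T : Fin m → Fin m → F => (Matrix.of T).det :=
        Continuous.matrix_det continuous_id
      exact (this.tendsto T).comp hlim
    have hMlim : Tendsto (fun k => ‖M (g (φ k))‖) atTop atTop :=
      tendsto_atTop_mono (fun k => (hgk (φ k)).le)
        (tendsto_natCast_atTop_atTop.comp hφ.tendsto_atTop)
    have h2 : Tendsto (fun k => (‖p‖ / ‖M (g (φ k))‖) ^ m) atTop (𝓝 0) := by
      simpa [hm.ne'] using (hMlim.const_div_atTop ‖p‖).pow m
    refine tendsto_nhds_unique h1 (squeeze_zero_norm (fun k => ?_) h2)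
    exact norm_det_zpowNormalize_le hp _ (hM0 _) (by rw [hMdet, hg])
  have hdet : LinearMap.det h = 0 := by
    rw [← hTdet, ← LinearMap.det_toMatrix', ← Matrix.det_transpose]
    congr 1
    ext i j
    simp [LinearMap.toMatrix'_apply, hhT]
  have hker : LinearMap.ker h ≠ ⊤ := fun e => by
    have h0 : h = 0 := LinearMap.ker_eq_top.1 e
    have hT0 : T = 0 := by
      ext i j
      have := congrFun (LinearMap.congr_fun h0 (Pi.single i 1)) j
      rwa [hhT] at this
    have := hT.1
    rw [hT0, norm_zero] at this
    linarith
  have hrange : LinearMap.range h ≠ ⊤ := (LinearMap.range_lt_top_of_det_eq_zero hdet).ne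
  let f : Y → ENNReal := fun y => ENNReal.ofReal (min 1 (Metric.infDist y (LinearMap.range h)))
  have hfc : Continuous f := ENNReal.continuous_ofReal.comp
    (continuous_const.min (Metric.continuous_infDist_pt _))
  have hf1 : ∀ y, f y ≤ 1 := fun y => by
    simp only [f]
    rw [ENNReal.ofReal_le_one]
    exact min_le_left _ _
  have hfX : Measurable fun x : X => f x := (hfc.comp continuous_subtype_val).measurable
  have hconst : ∀ k, ∫⁻ x : X, f (zpowNormalize p (ρ (g (φ k)) x)) ∂ν = ∫⁻ x : X, f x ∂ν := by
    intro k
    conv_rhs => rw [← hν (g (φ k)), lintegral_map hfX (measurable_const_smul _)]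
    rfl
  have hptw : ∀ᵐ x : X ∂ν, Tendsto (fun k => f (zpowNormalize p (ρ (g (φ k)) x))) atTop (𝓝 0) := by
    have hae : ∀ᵐ x : X ∂ν, (x : Y) ∉ LinearMap.ker h :=
      measure_eq_zero_iff_ae_notMem.1 (hnull _ hker)
    filter_upwards [hae] with x hx
    have hfx : f (zpowNormalize p (h x)) = 0 := by
      have : zpowNormalize p (h x) ∈ LinearMap.range h :=
        Submodule.smul_mem _ _ (LinearMap.mem_range_self h x)
      simp [f, Metric.infDist_zero_of_mem (s := (LinearMap.range h : Set Y)) this]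
    rw [← hfx]
    have hlin : Tendsto (fun k => Fintype.linearCombination F (zpowNormalize p (M (g (φ k)))) (x : Y))
        atTop (𝓝 (h x)) := by
      have : Continuous fun T : Fin m → Fin m → F => Fintype.linearCombination F T (x : Y) := by
        simp only [Fintype.linearCombination_apply]
        fun_prop
      exact (this.tendsto T).comp hlim
    have hcomp := (hfc.tendsto _).comp ((continuousAt_zpowNormalize (p := p) hx).tendsto.comp hlin)
    refine hcomp.congr fun k => ?_
    simp only [Function.comp_apply]
    congr 1
    rw [← hMρ]
    conv_lhs => rw [show zpowNormalize p (M (g (φ k))) =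
      p ^ (-⌊Real.logb ‖p‖ ‖M (g (φ k))‖⌋) • M (g (φ k)) from rfl]
    refine Eq.trans (congrArg _ ?_) (zpowNormalize_zpow_smul hp (-⌊Real.logb ‖p‖ ‖M (g (φ k))‖⌋) _)
    simp only [Fintype.linearCombination_apply, Finset.smul_sum, Pi.smul_apply]
    exact Finset.sum_congr rfl fun i _ => smul_comm _ _ _
  have hlim0 := tendsto_lintegral_of_dominated_convergence (μ := ν) (fun _ => 1)
    (fun k => hfX.comp (measurable_const_smul (g (φ k)))) (fun k => ae_of_all _ fun x => hf1 _)
    (by simp) hptw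
  have hzero : ∫⁻ x : X, f x ∂ν = 0 := by
    have h1 : Tendsto (fun _ : ℕ => ∫⁻ x : X, f x ∂ν) atTop (𝓝 0) := by
      simpa using hlim0.congr hconst
    exact tendsto_nhds_unique tendsto_const_nhds h1
  rw [lintegral_eq_zero_iff hfX] at hzero
  have hfalse : ∀ᵐ x : X ∂ν, False := by
    have hae : ∀ᵐ x : X ∂ν, (x : Y) ∉ LinearMap.range h :=
      measure_eq_zero_iff_ae_notMem.1 (hnull _ hrange)
    filter_upwards [hzero, hae] with x hx hx'
    apply hx'
    rw [← SetLike.mem_coe, (hcl _).mem_iff_infDist_zero ⟨0, Submodule.zero_mem _⟩]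
    simp only [f, Pi.zero_apply, ENNReal.ofReal_eq_zero] at hx
    refine le_antisymm ?_ Metric.infDist_nonneg
    rcases min_le_iff.1 hx with h1 | h1
    · linarith
    · exact h1
  rw [eventually_false_iff_eq_bot, ae_eq_bot] at hfalse
  exact IsProbabilityMeasure.ne_zero ν hfalse

end Irreducible

section Bounded

variable {F : Type*} [NontriviallyNormedField F] {G : Type*} [Group G]
  {E : Type*} [AddCommGroup E] [Module F E]

/-- The matrix coefficients of `ρ` are bounded on `D`. -/
def Representation.BoundedOn (ρ : Representation F G E) (D : Set G) : Prop :=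
  ∀ (v : E) (f : E →ₗ[F] F), ∃ C : ℝ, ∀ g ∈ D, ‖f (ρ g v)‖ ≤ C

/-- The matrix coefficients of `ρ` are continuous. -/
def Representation.ContinuousCoeffs [TopologicalSpace G] (ρ : Representation F G E) : Prop :=
  ∀ (v : E) (f : E →ₗ[F] F), Continuous fun g => f (ρ g v)

namespace Representation

lemma ContinuousCoeffs.subrepresentation [TopologicalSpace G] {ρ : Representation F G E}
    (hρ : ρ.ContinuousCoeffs) (S : Submodule F E) (hS : ∀ g, S ≤ S.comap (ρ g)) :
    (ρ.subrepresentation S hS).ContinuousCoeffs := fun v f => by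
  obtain ⟨f', rfl⟩ := f.exists_extend
  exact hρ v f'

lemma ContinuousCoeffs.quotient [TopologicalSpace G] {ρ : Representation F G E}
    (hρ : ρ.ContinuousCoeffs) (S : Submodule F E) (hS : ∀ g, S ≤ S.comap (ρ g)) :
    (ρ.quotient S hS).ContinuousCoeffs := fun v f => by
  obtain ⟨v, rfl⟩ := S.mkQ_surjective v
  exact hρ v (f ∘ₗ S.mkQ)

/-- A compactly generated group of block triangular matrices with bounded diagonal blocks is
bounded. -/
lemma BoundedOn.of_subrepresentation_of_quotient [IsUltrametricDist F] [FiniteDimensional F E]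
    [TopologicalSpace G] {ρ : Representation F G E} (hρ : ρ.ContinuousCoeffs) (S : Submodule F E)
    (hS : ∀ g, S ≤ S.comap (ρ g)) {K : Subgroup G} (hK : K.CompactlyGenerated)
    (h1 : (ρ.subrepresentation S hS).BoundedOn K) (h2 : (ρ.quotient S hS).BoundedOn K) :
    ρ.BoundedOn K := by
  obtain ⟨T, hT, rfl⟩ := hK
  set K := Subgroup.closure T with hKT
  obtain ⟨q, hq⟩ := S.subtype.exists_leftInverse_of_injective S.ker_subtype
  let π : E →ₗ[F] E := S.subtype ∘ₗ q
  have hπS : ∀ w, π w ∈ S := fun w => (q w).2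
  have hπ : ∀ w ∈ S, π w = w := fun w hw =>
    congrArg Subtype.val (LinearMap.congr_fun hq ⟨w, hw⟩)
  let σ : E →ₗ[F] E := LinearMap.id - π
  have hσ : ∀ w, σ w = w - π w := fun w => rfl
  have hσS : ∀ w ∈ S, σ w = 0 := fun w hw => by rw [hσ, hπ w hw, sub_self]
  have hmul : ∀ g h x, ρ (g * h) x = ρ g (ρ h x) := fun g h x => by simp
  have hA : ∀ w (f : E →ₗ[F] F), ∃ C : ℝ, ∀ g ∈ K, ‖f (ρ g (π w))‖ ≤ C := fun w f =>
    h1 (q w) (f ∘ₗ S.subtype)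
  have hD : ∀ w (f : E →ₗ[F] F), ∃ C : ℝ, ∀ g ∈ K, ‖f (σ (ρ g w))‖ ≤ C := fun w f => by
    have hker : S ≤ LinearMap.ker (f ∘ₗ σ) := fun x hx => by simp [hσS x hx]
    exact h2 (S.mkQ w) (S.liftQ (f ∘ₗ σ) hker)
  intro v f
  let b := Module.finBasis F E
  choose CA hCA using fun i => hA (b i) f
  choose CD hCD using fun i => hD v (b.coord i)
  have hB : ∀ i j, ∃ C : ℝ, ∀ g ∈ T, ‖b.coord i (π (ρ g (b j)))‖ ≤ C := fun i j =>
    hT.exists_bound_of_continuousOn (hρ (b j) (b.coord i ∘ₗ π)).continuousOn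
  choose CB hCB using hB
  let C : ℝ := ∑ i, ∑ j, |CD j| * |CB i j| * |CA i|
  have hC : 0 ≤ C := Finset.sum_nonneg fun i _ => Finset.sum_nonneg fun j _ => by positivity
  let Φ : G → G → G → F := fun x g y => f (ρ x (π (ρ g (σ (ρ y v)))))
  have hΦT : ∀ g ∈ T, ∀ x ∈ K, ∀ y ∈ K, ‖Φ x g y‖ ≤ C := by
    intro g hg x hx y hy
    have hexp : Φ x g y = ∑ i, ∑ j, b.coord j (σ (ρ y v)) * b.coord i (π (ρ g (b j))) *
        f (ρ x (π (b i))) := by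
      have e1 : π (ρ g (σ (ρ y v))) = ∑ i, b.coord i (π (ρ g (σ (ρ y v)))) • π (b i) := by
        conv_lhs => rw [← hπ _ (hπS (ρ g (σ (ρ y v)))), ← b.sum_repr (π (ρ g (σ (ρ y v)))), map_sum]
        simp only [map_smul, Module.Basis.coord_apply]
      have e2 : ∀ i, b.coord i (π (ρ g (σ (ρ y v)))) =
          ∑ j, b.coord j (σ (ρ y v)) * b.coord i (π (ρ g (b j))) := fun i => by
        conv_lhs => rw [← b.sum_repr (σ (ρ y v)), map_sum, map_sum, map_sum]
        simp only [map_smul, Module.Basis.coord_apply, smul_eq_mul]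
      simp only [Φ]
      rw [e1]
      simp only [map_sum, map_smul, smul_eq_mul, e2, Finset.sum_mul]
    rw [hexp]
    refine (norm_sum_le _ _).trans (Finset.sum_le_sum fun i _ => ?_)
    refine (norm_sum_le _ _).trans (Finset.sum_le_sum fun j _ => ?_)
    rw [norm_mul, norm_mul]
    gcongr
    · exact (hCD j y hy).trans (le_abs_self _)
    · exact (hCB i j g hg).trans (le_abs_self _)
    · exact (hCA i x hx).trans (le_abs_self _)
  have hcocycle : ∀ x g h y, Φ x (g * h) y = Φ (x * g) h y + Φ x g (h * y) := by
    intro x g h y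
    have e1 : ρ h (σ (ρ y v)) = π (ρ h (σ (ρ y v))) + σ (ρ h (ρ y v)) := by
      have : σ (ρ h (π (ρ y v))) = 0 := hσS _ (hS h (hπS _))
      have h3 : σ (ρ h (ρ y v)) = σ (ρ h (σ (ρ y v))) := by
        rw [hσ (ρ y v), map_sub, map_sub, this, sub_zero]
      rw [h3, hσ (ρ h _), add_sub_cancel]
    simp only [Φ, hmul]
    conv_lhs => rw [e1]
    rw [map_add, map_add, hπ _ (hS g (hπS _)), map_add, map_add]
  have hone : ∀ x y, Φ x 1 y = 0 := fun x y => by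
    have : π (σ (ρ y v)) = 0 := by rw [hσ, map_sub, hπ _ (hπS _), sub_self]
    simp [Φ, this]
  have hall : ∀ g ∈ K, ∀ x ∈ K, ∀ y ∈ K, ‖Φ x g y‖ ≤ C := by
    intro g hg
    induction hg using Subgroup.closure_induction with
    | mem g hg => exact hΦT g hg
    | one => intro x _ y _; simpa [hone] using hC
    | mul g h hg hh ihg ihh =>
      intro x hx y hy
      rw [hcocycle]
      exact (IsUltrametricDist.norm_add_le_max _ _).trans
        (max_le (ihh _ (K.mul_mem hx hg) _ hy) (ihg _ hx _ (K.mul_mem hh hy)))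
    | inv g hg ih =>
      intro x hx y hy
      have h := hcocycle (x * g⁻¹) g g⁻¹ y
      rw [mul_inv_cancel, hone, inv_mul_cancel_right] at h
      rw [← neg_eq_of_add_eq_zero_left h.symm, norm_neg]
      exact ih _ (K.mul_mem hx (K.inv_mem hg)) _ (K.mul_mem (K.inv_mem hg) hy)
  obtain ⟨C₁, hC₁⟩ := hA v f
  obtain ⟨C₂, hC₂⟩ := hD (σ v) f
  refine ⟨max C₁ (max C C₂), fun g hg => ?_⟩
  have hsplit : f (ρ g v) = f (ρ g (π v)) + (Φ 1 g 1 + f (σ (ρ g (σ v)))) := by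
    simp only [Φ, map_one, Module.End.one_apply]
    rw [← map_add f (π _), hσ (ρ g (σ v)), add_sub_cancel, ← map_add, ← map_add, hσ,
      add_sub_cancel]
  rw [hsplit]
  refine (IsUltrametricDist.norm_add_le_max _ _).trans (max_le_max (hC₁ g hg) ?_)
  exact (IsUltrametricDist.norm_add_le_max _ _).trans
    (max_le_max (hall g hg 1 K.one_mem 1 K.one_mem) (hC₂ g hg))

end Representation

end Bounded

section Main

variable {F : Type*} [NontriviallyNormedField F]

lemma Subgroup.CompactlyGenerated.map {G G' : Type*} [Group G] [TopologicalSpace G] [Group G']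
    [TopologicalSpace G'] {K : Subgroup G} (hK : K.CompactlyGenerated) (f : G →* G')
    (hf : Continuous f) : (K.map f).CompactlyGenerated := by
  obtain ⟨S, hS, rfl⟩ := hK
  exact ⟨f '' S, hS.image hf, (MonoidHom.map_closure f S).symm⟩

/-- The conclusion of the induction for a linear representation: up to finite index, the commutators
lie in an open compactly generated subgroup with bounded image. -/
def Representation.HasBoundedCommutators {G : Type*} [Group G] [TopologicalSpace G]
    {E : Type*} [AddCommGroup E] [Module F E] (ρ : Representation F G E) : Prop :=
  ∃ G₁ K : Subgroup G, IsOpen (G₁ : Set G) ∧ G₁.FiniteIndex ∧ IsOpen (K : Set G) ∧ K ≤ G₁ ∧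
    (∀ x ∈ G₁, ∀ y ∈ G₁, x * y * x⁻¹ * y⁻¹ ∈ K) ∧ K.CompactlyGenerated ∧ ρ.BoundedOn K

lemma Representation.HasBoundedCommutators.of_subgroup {G : Type*} [Group G] [TopologicalSpace G]
    {E : Type*} [AddCommGroup E] [Module F E] {ρ : Representation F G E} {H : Subgroup G}
    (hH : IsOpen (H : Set G)) [H.FiniteIndex]
    (h : Representation.HasBoundedCommutators (ρ.comp H.subtype)) : ρ.HasBoundedCommutators := by
  obtain ⟨G₁, K, h1, h2, h3, h4, h5, h6, h7⟩ := h
  refine ⟨G₁.map H.subtype, K.map H.subtype, hH.isOpenMap_subtype_val _ h1, ⟨?_⟩,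
    hH.isOpenMap_subtype_val _ h3, Subgroup.map_mono h4, ?_, h6.map _ continuous_subtype_val, ?_⟩
  · rw [Subgroup.index_map_subtype]
    exact mul_ne_zero h2.index_ne_zero Subgroup.FiniteIndex.index_ne_zero
  · rintro _ ⟨x, hx, rfl⟩ _ ⟨y, hy, rfl⟩
    exact ⟨_, h5 x hx y hy, by simp⟩
  · intro v f
    obtain ⟨C, hC⟩ := h7 v f
    refine ⟨C, ?_⟩
    rintro _ ⟨x, hx, rfl⟩
    exact hC x hx

lemma Representation.HasBoundedCommutators.of_subrepresentation_of_quotient [IsUltrametricDist F]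
    {G : Type*} [Group G] [TopologicalSpace G] [IsTopologicalGroup G] (hG : IsPolyGrowthGroup G)
    {E : Type*} [AddCommGroup E] [Module F E] [FiniteDimensional F E] {ρ : Representation F G E}
    (hρ : ρ.ContinuousCoeffs) (S : Submodule F E) (hS : ∀ g, S ≤ S.comap (ρ g))
    (h1 : (ρ.subrepresentation S hS).HasBoundedCommutators)
    (h2 : (ρ.quotient S hS).HasBoundedCommutators) : ρ.HasBoundedCommutators := by
  obtain ⟨G₁, K₁, hG₁, hG₁f, hK₁, hK₁G, hc₁, -, hb₁⟩ := h1
  obtain ⟨G₂, K₂, hG₂, hG₂f, hK₂, hK₂G, hc₂, -, hb₂⟩ := h2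
  have ho : IsOpen ((G₁ ⊓ G₂ : Subgroup G) : Set G) := hG₁.inter hG₂
  have hKo : IsOpen ((K₁ ⊓ K₂ : Subgroup G) : Set G) := hK₁.inter hK₂
  have hcomm : ∀ x ∈ G₁ ⊓ G₂, ∀ y ∈ G₁ ⊓ G₂, x * y * x⁻¹ * y⁻¹ ∈ K₁ ⊓ K₂ := fun x hx y hy =>
    ⟨hc₁ x hx.1 y hy.1, hc₂ x hx.2 y hy.2⟩
  have hle : K₁ ⊓ K₂ ≤ G₁ ⊓ G₂ := inf_le_inf hK₁G hK₂G
  have hcg : (K₁ ⊓ K₂).CompactlyGenerated := hG.compactlyGenerated_of_commutators_mem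
    (Subgroup.compactlyGenerated_of_finiteIndex hG.compactlyGenerated
      (Subgroup.isClosed_of_isOpen _ ho)) hKo hle hcomm
  refine ⟨G₁ ⊓ G₂, K₁ ⊓ K₂, ho, inferInstance, hKo, hle, hcomm, hcg, ?_⟩
  refine Representation.BoundedOn.of_subrepresentation_of_quotient hρ S hS hcg ?_ ?_
  · exact fun v f => (hb₁ v f).imp fun C hC g hg => hC g hg.1
  · exact fun v f => (hb₂ v f).imp fun C hC g hg => hC g hg.2

lemma IsPolyGrowthGroup.hasBoundedCommutators_of_stronglyIrreducible [LocallyCompactSpace F]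
    [IsUltrametricDist F] {G : Type*} [Group G] [TopologicalSpace G] [IsTopologicalGroup G]
    [T2Space G] (hG : IsPolyGrowthGroup G) {E : Type*} [AddCommGroup E] [Module F E]
    [FiniteDimensional F E] {ρ : Representation F G E} (hρ : ρ.ContinuousCoeffs)
    (hirr : ∀ G₁ : Subgroup G, IsOpen (G₁ : Set G) → G₁.FiniteIndex →
      ∀ S : Submodule F E, (∀ g ∈ G₁, S ≤ S.comap (ρ g)) → S = ⊥ ∨ S = ⊤) :
    ρ.HasBoundedCommutators := by
  have : ProperSpace F := ProperSpace.of_locallyCompactSpace F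
  let e : E ≃ₗ[F] (Fin (Module.finrank F E) → F) := (Module.finBasis F E).equivFun
  let τ : G →* ((Fin (Module.finrank F E) → F) →ₗ[F] (Fin (Module.finrank F E) → F)) :=
    { toFun := fun g => e.toLinearMap ∘ₗ ρ g ∘ₗ e.symm.toLinearMap
      map_one' := by ext; simp
      map_mul' := fun g h => by ext; simp }
  have hτe : ∀ g x, τ g (e x) = e (ρ g x) := fun g x => by simp [τ]
  have hτc : ∀ v, Continuous fun g => τ g v := fun v =>
    continuous_pi fun i => hρ (e.symm v) (LinearMap.proj i ∘ₗ e.toLinearMap)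
  have hτirr : ∀ G₁ : Subgroup G, IsOpen (G₁ : Set G) → G₁.FiniteIndex →
      ∀ S : Submodule F (Fin (Module.finrank F E) → F), (∀ g ∈ G₁, S ≤ S.comap (τ g)) →
        S = ⊥ ∨ S = ⊤ := by
    intro G₁ h1 h2 S hS
    have hinj : ∀ S' : Submodule F (Fin (Module.finrank F E) → F),
        S.comap e.toLinearMap = S'.comap e.toLinearMap → S = S' := fun S' h =>
      Submodule.comap_injective_of_surjective e.surjective h
    refine (hirr G₁ h1 h2 (S.comap e.toLinearMap) fun g hg x hx => ?_).imp
      (fun h => hinj _ ?_) (fun h => hinj _ ?_)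
    · have := hS g hg hx
      change τ g (e x) ∈ S at this
      rwa [hτe] at this
    · rw [h]; ext x; simp
    · rw [h]; rfl
  obtain ⟨C, hC⟩ := hG.exists_bound_of_stronglyIrreducible τ hτc hτirr
  have hdetc : Continuous fun g => LinearMap.det (τ g) := by
    have h : Continuous fun g => (LinearMap.toMatrix' (τ g)).det :=
      Continuous.matrix_det (continuous_matrix fun i j => by
        simp only [LinearMap.toMatrix'_apply]
        exact (continuous_apply i).comp (hτc _))
    simpa only [LinearMap.det_toMatrix'] using h
  let K : Subgroup G :=
    { carrier := {g | ‖LinearMap.det (τ g)‖ = 1}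
      one_mem' := by simp
      mul_mem' := fun {a b} ha hb => by
        change _ = _ at ha hb ⊢
        rw [map_mul, map_mul, norm_mul, ha, hb, one_mul]
      inv_mem' := fun {a} ha => by
        change _ = _ at ha ⊢
        have h : LinearMap.det (τ a) * LinearMap.det (τ a⁻¹) = 1 := by
          rw [← map_mul, ← map_mul, mul_inv_cancel, map_one, map_one]
        have := congrArg norm h
        rwa [norm_mul, ha, one_mul, norm_one] at this }
  have hK : ∀ g, g ∈ K ↔ ‖LinearMap.det (τ g)‖ = 1 := fun g => Iff.rfl
  have hKo : IsOpen (K : Set G) := by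
    have h := (IsUltrametricDist.isOpen_sphere (0 : F) one_ne_zero).preimage hdetc
    convert h using 1
    ext g
    simp [hK]
  have hcomm : ∀ x ∈ (⊤ : Subgroup G), ∀ y ∈ (⊤ : Subgroup G), x * y * x⁻¹ * y⁻¹ ∈ K := by
    intro x _ y _
    rw [hK, ← norm_one (α := F)]
    congr 1
    have h : ∀ a, LinearMap.det (τ a) * LinearMap.det (τ a⁻¹) = 1 := fun a => by
      rw [← map_mul, ← map_mul, mul_inv_cancel, map_one, map_one]
    simp only [map_mul]
    linear_combination LinearMap.det (τ y) * LinearMap.det (τ y⁻¹) * h x + h y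
  refine ⟨⊤, K, isOpen_univ, inferInstance, hKo, le_top, hcomm,
    hG.compactlyGenerated_of_commutators_mem hG.compactlyGenerated hKo le_top hcomm, ?_⟩
  intro v f
  let f' := (f ∘ₗ e.symm.toLinearMap)
  refine ⟨∑ i, ∑ j, |C| * ‖e v j * f' (Pi.single i 1)‖, fun g hg => ?_⟩
  have h1 : f (ρ g v) = f' (τ g (e v)) := by simp [f', hτe]
  have h2 : ∀ (L : (Fin (Module.finrank F E) → F) →ₗ[F] F) w,
      L w = ∑ i, w i * L (Pi.single i 1) := fun L w => by
    conv_lhs => rw [← (Pi.basisFun F _).sum_repr w, map_sum]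
    simp only [map_smul, smul_eq_mul, Pi.basisFun_repr, Pi.basisFun_apply]
  have h3 : f (ρ g v) = ∑ i, ∑ j, τ g (Pi.single j 1) i * (e v j * f' (Pi.single i 1)) := by
    rw [h1, h2 f']
    refine Finset.sum_congr rfl fun i _ => ?_
    rw [show τ g (e v) i = (LinearMap.proj i ∘ₗ τ g) (e v) from rfl,
      h2 (LinearMap.proj i ∘ₗ τ g), Finset.sum_mul]
    refine Finset.sum_congr rfl fun j _ => ?_
    simp only [LinearMap.comp_apply, LinearMap.proj_apply]
    ring
  rw [h3]
  refine (norm_sum_le _ _).trans (Finset.sum_le_sum fun i _ => ?_)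
  refine (norm_sum_le _ _).trans (Finset.sum_le_sum fun j _ => ?_)
  rw [norm_mul]
  gcongr
  exact (hC g hg j i).trans (le_abs_self C)

theorem IsPolyGrowthGroup.hasBoundedCommutators [LocallyCompactSpace F] [IsUltrametricDist F] :
    ∀ (n : ℕ) {G : Type u} [Group G] [TopologicalSpace G] [IsTopologicalGroup G] [T2Space G]
      (_ : IsPolyGrowthGroup G) {E : Type v} [AddCommGroup E] [Module F E] [FiniteDimensional F E]
      (ρ : Representation F G E) (_ : ρ.ContinuousCoeffs) (_ : Module.finrank F E = n),
      ρ.HasBoundedCommutators := by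
  intro n
  induction n using Nat.strong_induction_on with | _ n ih
  intro G _ _ _ _ hG E _ _ _ ρ hρ hn
  by_cases hirr : ∀ G₁ : Subgroup G, IsOpen (G₁ : Set G) → G₁.FiniteIndex →
      ∀ S : Submodule F E, (∀ g ∈ G₁, S ≤ S.comap (ρ g)) → S = ⊥ ∨ S = ⊤
  · exact hG.hasBoundedCommutators_of_stronglyIrreducible hρ hirr
  push Not at hirr
  obtain ⟨G₁, h1, h2, S, hS, hbot, htop⟩ := hirr
  let ρ' : Representation F G₁ E := ρ.comp G₁.subtype
  have hρ' : ρ'.ContinuousCoeffs := fun v f => (hρ v f).comp continuous_subtype_val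
  have hS' : ∀ g, S ≤ S.comap (ρ' g) := fun g => hS g g.2
  have hG₁ := hG.of_finiteIndex h1
  refine Representation.HasBoundedCommutators.of_subgroup h1 ?_
  have hpos : 0 < Module.finrank F S :=
    Nat.pos_of_ne_zero fun h => hbot (Submodule.finrank_eq_zero.1 h)
  have hadd := S.finrank_quotient_add_finrank
  refine Representation.HasBoundedCommutators.of_subrepresentation_of_quotient hG₁ hρ' S hS'
    (ih _ ?_ hG₁ _ (hρ'.subrepresentation S hS') rfl)
    (ih _ ?_ hG₁ _ (hρ'.quotient S hS') rfl)
  · exact hn ▸ Submodule.finrank_lt htop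
  · omega

end Main

/-- Cosets of a compact open subgroup are disjoint and have equal measure, so growth of Haar
measure bounds growth of the number of cosets. -/
lemma IsPolyGrowthGroup.of_measure {G : Type*} [Group G] [TopologicalSpace G]
    [IsTopologicalGroup G] [MeasurableSpace G] [BorelSpace G] (μ : Measure G) [μ.IsHaarMeasure]
    (hpoly : ∀ W : Set G, IsCompact W → W ∈ 𝓝 (1 : G) →
      ∃ (c : ENNReal) (d : ℕ), c ≠ ⊤ ∧ ∀ m : ℕ, μ (W ^ m) ≤ c * (m : ENNReal) ^ d)
    (hV : ∃ V : Subgroup G, IsCompact (V : Set G) ∧ IsOpen (V : Set G))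
    (hcg : (⊤ : Subgroup G).CompactlyGenerated) : IsPolyGrowthGroup G := by
  refine ⟨hV, fun V hVc hVo S hS => ?_, hcg⟩
  set W : Set G := (insert 1 S) * (V : Set G) with hW
  have hWc : IsCompact W := (hS.insert 1).mul hVc
  have hVW : (V : Set G) ⊆ W := fun v hv => ⟨1, Set.mem_insert _ _, v, hv, one_mul v⟩
  have hSW : S ⊆ W := fun s hs => ⟨s, Set.mem_insert_of_mem _ hs, 1, V.one_mem, mul_one s⟩
  obtain ⟨c, d, hc, hcd⟩ := hpoly W hWc (mem_of_superset (hVo.mem_nhds V.one_mem) hVW)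
  have hV0 : μ (V : Set G) ≠ 0 := (hVo.measure_pos μ ⟨1, V.one_mem⟩).ne'
  have hVt : μ (V : Set G) ≠ ⊤ := hVc.measure_ne_top
  refine ⟨⌈(c / μ (V : Set G)).toReal⌉₊, d, fun m => ?_⟩
  have hfin : ((QuotientGroup.mk : G → G ⧸ V) '' (S ^ m)).Finite :=
    IsCompact.finite_image_mk hVo (by
      induction m with
      | zero => simp
      | succ m ih => rw [pow_succ]; exact ih.mul hS)
  have key : (((QuotientGroup.mk : G → G ⧸ V) '' (S ^ m)).ncard : ENNReal) * μ (V : Set G) ≤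
      μ (W ^ (m + 1)) := by
    rw [Set.ncard_eq_toFinset_card _ hfin]
    have h1 : μ (⋃ q ∈ hfin.toFinset, (QuotientGroup.mk : G → G ⧸ V) ⁻¹' {q}) =
        ∑ q ∈ hfin.toFinset, μ ((QuotientGroup.mk : G → G ⧸ V) ⁻¹' {q}) := by
      have := QuotientGroup.discreteTopology hVo
      refine MeasureTheory.measure_biUnion_finset ?_ fun q _ =>
        ((isOpen_discrete {q}).preimage QuotientGroup.continuous_mk).measurableSet
      intro a _ b _ hab
      exact Disjoint.preimage _ (Set.disjoint_singleton.2 hab)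
    have h2 : ∀ q : G ⧸ V, μ ((QuotientGroup.mk : G → G ⧸ V) ⁻¹' {q}) = μ (V : Set G) := by
      intro q
      induction q using QuotientGroup.induction_on with | _ g
      have : (QuotientGroup.mk : G → G ⧸ V) ⁻¹' {(g : G ⧸ V)} = g • (V : Set G) := by
        ext x
        rw [Set.mem_preimage, Set.mem_singleton_iff, eq_comm, QuotientGroup.eq,
          Set.mem_smul_set_iff_inv_smul_mem]
        rfl
      rw [this, measure_smul]
    simp only [h2, Finset.sum_const, nsmul_eq_mul] at h1
    rw [← h1]
    refine measure_mono ?_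
    intro x hx
    simp only [Set.mem_iUnion, Set.Finite.mem_toFinset] at hx
    obtain ⟨q, ⟨s, hs, rfl⟩, hx⟩ := hx
    rw [pow_succ]
    refine ⟨s, Set.pow_subset_pow_left hSW hs, s⁻¹ * x, hVW ?_, by simp⟩
    exact QuotientGroup.eq.1 (Set.mem_singleton_iff.1 hx).symm
  have hdiv : (((QuotientGroup.mk : G → G ⧸ V) '' (S ^ m)).ncard : ENNReal) ≤
      c / μ (V : Set G) * ((m + 1 : ℕ) : ENNReal) ^ d := by
    rw [div_eq_mul_inv, mul_right_comm, ← div_eq_mul_inv]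
    exact (ENNReal.le_div_iff_mul_le (Or.inl hV0) (Or.inl hVt)).2 (key.trans (hcd _))
  have hct : c / μ (V : Set G) ≠ ⊤ := ENNReal.div_ne_top hc hV0
  have hle : c / μ (V : Set G) ≤ (⌈(c / μ (V : Set G)).toReal⌉₊ : ENNReal) := by
    rw [← ENNReal.ofReal_toReal hct, ← ENNReal.ofReal_natCast]
    refine ENNReal.ofReal_le_ofReal ?_
    rw [ENNReal.ofReal_toReal hct]
    exact Nat.le_ceil _
  have := hdiv.trans (mul_le_mul_left hle _)
  exact_mod_cast this

/-- A group is virtually nilpotent as soon as it is finitely generated and some finite index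
subgroup has its commutators in a finite subgroup. -/
lemma exists_finiteIndex_nilpotent {Q : Type*} [Group Q] [hQ : Group.FG Q] (P M : Subgroup Q)
    [P.FiniteIndex] [Finite M] (hMP : M ≤ P)
    (hcomm : ∀ x ∈ P, ∀ y ∈ P, x * y * x⁻¹ * y⁻¹ ∈ M) :
    ∃ N : Subgroup Q, N.FiniteIndex ∧ Group.FG N ∧ Group.IsNilpotent N := by
  have hnorm : P ≤ Subgroup.normalizer (M : Set Q) := by
    intro x hx
    have h : ∀ x ∈ P, ∀ y ∈ M, x * y * x⁻¹ ∈ M := fun x hx y hy => by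
      simpa using M.mul_mem (hcomm x hx y (hMP hy)) hy
    rw [Subgroup.mem_normalizer_iff]
    refine fun y => ⟨h x hx y, fun hy => ?_⟩
    have := h x⁻¹ (P.inv_mem hx) _ hy
    simpa [mul_assoc] using this
  have : (Subgroup.normalizer (M : Set Q)).FiniteIndex := Subgroup.finiteIndex_of_le hnorm
  have hC : (Subgroup.centralizer (M : Set Q)).FiniteIndex := by
    have h1 := Subgroup.finiteIndex_ker M.normalizerMonoidHom
    rw [Subgroup.normalizerMonoidHom_ker] at h1
    have hle : Subgroup.centralizer (M : Set Q) ≤ Subgroup.normalizer (M : Set Q) :=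
      Subgroup.centralizer_le_normalizer _
    refine ⟨?_⟩
    rw [← Subgroup.relIndex_mul_index hle]
    exact mul_ne_zero h1.index_ne_zero this.index_ne_zero
  refine ⟨P ⊓ Subgroup.centralizer (M : Set Q), inferInstance, ?_, ?_⟩
  · infer_instance
  · refine ⟨2, ?_⟩
    rw [eq_top_iff]
    intro x _
    rw [Subgroup.mem_upperCentralSeries_succ_iff]
    intro y
    rw [Subgroup.upperCentralSeries_one, Subgroup.mem_center_iff]
    intro z
    apply Subtype.ext
    have h := hcomm x x.2.1 y y.2.1
    exact ((Subgroup.mem_centralizer_iff.1 z.2.2) _ h).symm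

section LinearGroup

variable {F : Type*} [NontriviallyNormedField F] {n : ℕ} {H : Subgroup (GL (Fin n) F)}

lemma isClosedEmbedding_prodInv (hH : IsClosed (H : Set (GL (Fin n) F))) :
    IsClosedEmbedding (fun h : H =>
      (fun i j => ((h : GL (Fin n) F) : Matrix (Fin n) (Fin n) F) i j,
        fun i j => (((h⁻¹ : H) : GL (Fin n) F) : Matrix (Fin n) (Fin n) F) i j) :
      H → (Fin n → Fin n → F) × (Fin n → Fin n → F)) :=
  (((Homeomorph.refl (Matrix (Fin n) (Fin n) F)).prodCongr
    MulOpposite.opHomeomorph.symm).isClosedEmbedding.comp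
    Units.isClosedEmbedding_embedProduct).comp hH.isClosedEmbedding_subtypeVal

lemma continuous_entry (i j : Fin n) :
    Continuous fun h : H => ((h : GL (Fin n) F) : Matrix (Fin n) (Fin n) F) i j :=
  (Units.continuous_val.comp continuous_subtype_val).matrix_elem i j

lemma isCompact_of_entries_bounded [LocallyCompactSpace F]
    (hH : IsClosed (H : Set (GL (Fin n) F))) {A : Set H} (hA : IsClosed A) (C : ℝ)
    (hC : ∀ h ∈ A, ∀ i j, ‖((h : GL (Fin n) F) : Matrix (Fin n) (Fin n) F) i j‖ ≤ C ∧
      ‖(((h⁻¹ : H) : GL (Fin n) F) : Matrix (Fin n) (Fin n) F) i j‖ ≤ C) : IsCompact A := by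
  have : ProperSpace F := ProperSpace.of_locallyCompactSpace F
  have hB : IsCompact (Set.pi Set.univ fun _ : Fin n => Set.pi Set.univ fun _ : Fin n =>
      Metric.closedBall (0 : F) C) :=
    isCompact_univ_pi fun _ => isCompact_univ_pi fun _ => isCompact_closedBall _ _
  refine ((isClosedEmbedding_prodInv hH).isCompact_preimage (hB.prod hB)).of_isClosed_subset hA ?_
  intro h hh
  refine ⟨fun i _ j _ => ?_, fun i _ j _ => ?_⟩
  · exact mem_closedBall_zero_iff.2 (hC h hh i j).1
  · exact mem_closedBall_zero_iff.2 (hC h hh i j).2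

lemma exists_entries_subset_of_mem_nhds (hH : IsClosed (H : Set (GL (Fin n) F))) {U : Set H}
    (hU : U ∈ 𝓝 (1 : H)) : ∃ δ > 0, ∀ h : H,
      (∀ i j, ‖(((h : GL (Fin n) F) : Matrix (Fin n) (Fin n) F) - 1) i j‖ ≤ δ ∧
        ‖((((h⁻¹ : H) : GL (Fin n) F) : Matrix (Fin n) (Fin n) F) - 1) i j‖ ≤ δ) → h ∈ U := by
  rw [(isClosedEmbedding_prodInv hH).isInducing.nhds_eq_comap, mem_comap] at hU
  obtain ⟨T, hT, hTU⟩ := hU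
  obtain ⟨δ, hδ, h⟩ := Metric.nhds_basis_closedBall.mem_iff.1 hT
  refine ⟨δ, hδ, fun x hx => hTU (h ?_)⟩
  rw [Metric.mem_closedBall, dist_eq_norm]
  refine max_le ?_ ?_
  · refine (pi_norm_le_iff_of_nonneg hδ.le).2 fun i => (pi_norm_le_iff_of_nonneg hδ.le).2 fun j => ?_
    simpa using (hx i j).1
  · refine (pi_norm_le_iff_of_nonneg hδ.le).2 fun i => (pi_norm_le_iff_of_nonneg hδ.le).2 fun j => ?_
    simpa using (hx i j).2

/-- The compact open subgroup of integral matrices with integral inverse. -/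
lemma exists_compact_open_subgroup [LocallyCompactSpace F] [IsUltrametricDist F]
    (hH : IsClosed (H : Set (GL (Fin n) F))) :
    ∃ V : Subgroup H, IsCompact (V : Set H) ∧ IsOpen (V : Set H) := by
  have hmul : ∀ A B : Matrix (Fin n) (Fin n) F, (∀ i j, ‖A i j‖ ≤ 1) → (∀ i j, ‖B i j‖ ≤ 1) →
      ∀ i j, ‖(A * B) i j‖ ≤ 1 := fun A B hA hB i j => by
    rw [Matrix.mul_apply]
    refine IsUltrametricDist.norm_sum_le_of_forall_le_of_nonneg zero_le_one fun k _ => ?_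
    rw [norm_mul]
    exact mul_le_one₀ (hA i k) (norm_nonneg _) (hB k j)
  let V : Subgroup H :=
    { carrier := {h | (∀ i j, ‖((h : GL (Fin n) F) : Matrix (Fin n) (Fin n) F) i j‖ ≤ 1) ∧
        ∀ i j, ‖(((h⁻¹ : H) : GL (Fin n) F) : Matrix (Fin n) (Fin n) F) i j‖ ≤ 1}
      one_mem' := by
        have : ∀ i j, ‖(1 : Matrix (Fin n) (Fin n) F) i j‖ ≤ 1 := fun i j => by
          rw [Matrix.one_apply]; split_ifs <;> simp
        exact ⟨by simpa using this, by simpa using this⟩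
      mul_mem' := fun {a b} ha hb => by
        refine ⟨hmul _ _ ha.1 hb.1, ?_⟩
        rw [_root_.mul_inv_rev]
        exact hmul _ _ hb.2 ha.2
      inv_mem' := fun {a} ha => ⟨ha.2, by rw [inv_inv]; exact ha.1⟩ }
  have hVo : IsOpen (V : Set H) := by
    have hV : (V : Set H) = (⋂ i, ⋂ j, (fun h : H =>
        ((h : GL (Fin n) F) : Matrix (Fin n) (Fin n) F) i j) ⁻¹' Metric.closedBall 0 1) ∩
        ⋂ i, ⋂ j, (fun h : H =>
          (((h⁻¹ : H) : GL (Fin n) F) : Matrix (Fin n) (Fin n) F) i j) ⁻¹'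
            Metric.closedBall 0 1 := by
      ext h
      simp only [Set.mem_inter_iff, Set.mem_iInter, Set.mem_preimage, mem_closedBall_zero_iff]
      rfl
    rw [hV]
    have ho := IsUltrametricDist.isOpen_closedBall (0 : F) one_ne_zero
    exact (isOpen_iInter_of_finite fun i => isOpen_iInter_of_finite fun j =>
      ho.preimage (continuous_entry i j)).inter
      (isOpen_iInter_of_finite fun i => isOpen_iInter_of_finite fun j =>
        ho.preimage ((continuous_entry i j).comp continuous_inv))
  exact ⟨V, isCompact_of_entries_bounded hH (V.isClosed_of_isOpen hVo) 1
    fun h hh i j => ⟨hh.1 i j, hh.2 i j⟩, hVo⟩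

end LinearGroup

lemma Subgroup.isOpen_normalCore {G : Type*} [Group G] [TopologicalSpace G] [IsTopologicalGroup G]
    {G₁ K : Subgroup G} [G₁.FiniteIndex] (hK : IsOpen (K : Set G))
    (h : ∀ x ∈ G₁, ∀ y ∈ K, x * y * x⁻¹ ∈ K) : IsOpen (K.normalCore : Set G) := by
  have heq : (K.normalCore : Set G) =
      ⋂ q : G ⧸ G₁, (fun a => q.out⁻¹ * a * q.out) ⁻¹' (K : Set G) := by
    ext a
    simp only [Set.mem_iInter, Set.mem_preimage, SetLike.mem_coe]
    refine ⟨fun ha q => by simpa using ha q.out⁻¹, fun ha b => ?_⟩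
    have hb : (((b⁻¹ : G) : G ⧸ G₁).out)⁻¹ * b⁻¹ ∈ G₁ := by
      rw [← QuotientGroup.eq]; simp
    have := h _ (G₁.inv_mem hb) _ (ha ((b⁻¹ : G) : G ⧸ G₁))
    simpa [mul_assoc] using this
  rw [heq]
  exact isOpen_iInter_of_finite fun q =>
    hK.preimage ((continuous_const.mul continuous_id).mul continuous_const)

section LinearGroup

variable {F : Type*} [NontriviallyNormedField F] {n : ℕ} {H : Subgroup (GL (Fin n) F)}

/-- A finite spanning family of a set of vectors gives linear coordinate functions. -/
lemma exists_linear_coordinates {E : Type*} [AddCommGroup E] [Module F E]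
    [FiniteDimensional F E] (S : Set E) :
    ∃ (s : Finset E) (c : E → E →ₗ[F] F), (s : Set E) ⊆ S ∧
      ∀ x ∈ Submodule.span F S, x = ∑ b ∈ s, c b x • b := by
  obtain ⟨s, hs, hspan⟩ := (Submodule.fg_span_iff_fg_span_finset_subset S).1
    (IsNoetherian.noetherian (Submodule.span F S))
  let L : (s → F) →ₗ[F] Submodule.span F S := (Fintype.linearCombination F
    (fun b : s => (b : E))).codRestrict _ fun w => by
      rw [Fintype.linearCombination_apply]
      exact Submodule.sum_mem _ fun b _ =>
        Submodule.smul_mem _ _ (Submodule.subset_span (hs b.2))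
  have hL : LinearMap.range L = ⊤ := by
    rw [eq_top_iff]
    rintro ⟨x, hx⟩ _
    have : x ∈ LinearMap.range (Fintype.linearCombination F (fun b : s => (b : E))) := by
      rw [Fintype.range_linearCombination]
      simpa [← hspan] using hx
    obtain ⟨w, hw⟩ := this
    exact ⟨w, Subtype.ext hw⟩
  obtain ⟨R, hR⟩ := L.exists_rightInverse_of_surjective hL
  obtain ⟨R', hR'⟩ := R.exists_extend
  classical
  refine ⟨s, fun b => if hb : b ∈ s then LinearMap.proj ⟨b, hb⟩ ∘ₗ R' else 0, hs,
    fun x hx => ?_⟩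
  have h1 := congrArg Subtype.val (LinearMap.congr_fun hR ⟨x, hx⟩)
  have h2 : R ⟨x, hx⟩ = R' x := (LinearMap.congr_fun hR' ⟨x, hx⟩).symm
  rw [LinearMap.comp_apply, h2] at h1
  change (Fintype.linearCombination F (fun b : s => (b : E))) (R' x) = x at h1
  rw [Fintype.linearCombination_apply] at h1
  conv_lhs => rw [← h1]
  rw [← Finset.sum_coe_sort s]
  exact Finset.sum_congr rfl fun b _ => by simp

lemma exists_normal_subgroup_entries_le [CompleteSpace F] [IsUltrametricDist F]
    {K : Subgroup H} [hKn : K.Normal] (hKo : IsOpen (K : Set H)) {C : ℝ}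
    (hC : ∀ h ∈ K, ∀ i j, ‖((h : GL (Fin n) F) : Matrix (Fin n) (Fin n) F) i j‖ ≤ C)
    {ε : ℝ} (hε : 0 < ε) :
    ∃ N : Subgroup H, N.Normal ∧ N ≤ K ∧ IsOpen (N : Set H) ∧ ∀ h ∈ N, ∀ i j,
      ‖(((h : GL (Fin n) F) : Matrix (Fin n) (Fin n) F) - 1) i j‖ ≤ ε * C := by
  let m : H →* Matrix (Fin n) (Fin n) F := (Units.coeHom _).comp H.subtype
  let J : AddSubgroup (Matrix (Fin n) (Fin n) F) :=
    AddSubgroup.closure {x | ∃ c : F, ‖c‖ ≤ ε ∧ ∃ k ∈ K, x = c • m k}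
  have hJ : ∀ c : F, ‖c‖ ≤ ε → ∀ k ∈ K, c • m k ∈ J := fun c hc k hk =>
    AddSubgroup.subset_closure ⟨c, hc, k, hk, rfl⟩
  have hJmul : ∀ A B : Matrix (Fin n) (Fin n) F,
      (∀ c : F, ‖c‖ ≤ ε → ∀ k ∈ K, A * (c • m k) * B ∈ J) → ∀ x ∈ J, A * x * B ∈ J := by
    intro A B hAB x hx
    induction hx using AddSubgroup.closure_induction with
    | mem x hx => obtain ⟨c, hc, k, hk, rfl⟩ := hx; exact hAB c hc k hk
    | zero => simp
    | add x y _ _ hx hy => rw [mul_add, add_mul]; exact J.add_mem hx hy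
    | neg x _ hx => rw [mul_neg, neg_mul]; exact J.neg_mem hx
  have hJconj : ∀ h : H, ∀ x ∈ J, m h * x * m h⁻¹ ∈ J := fun h => hJmul _ _ fun c hc k hk => by
    rw [mul_smul_comm, smul_mul_assoc, ← map_mul, ← map_mul]
    exact hJ c hc _ (hKn.conj_mem k hk h)
  have hJleft : ∀ h ∈ K, ∀ x ∈ J, m h * x ∈ J := fun h hh x hx => by
    rw [← mul_one (m h * x)]
    refine hJmul _ _ (fun c hc k hk => ?_) x hx
    rw [mul_one, mul_smul_comm, ← map_mul]
    exact hJ c hc _ (K.mul_mem hh hk)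
  have hJbound : ∀ x ∈ J, ∀ i j, ‖x i j‖ ≤ ε * C := by
    intro x hx i j
    have hC0 : 0 ≤ C := (norm_nonneg _).trans (hC 1 K.one_mem i j)
    induction hx using AddSubgroup.closure_induction with
    | mem x hx =>
      obtain ⟨c, hc, k, hk, rfl⟩ := hx
      rw [Matrix.smul_apply, norm_smul]
      exact mul_le_mul hc (hC k hk i j) (norm_nonneg _) hε.le
    | zero => simpa using mul_nonneg hε.le hC0
    | add x y _ _ hx hy => exact (IsUltrametricDist.norm_add_le_max _ _).trans (max_le hx hy)
    | neg x _ hx => rw [Matrix.neg_apply, norm_neg]; exact hx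
  have hinv : ∀ h : H, m h * m h⁻¹ = 1 := fun h => by rw [← map_mul, mul_inv_cancel, map_one]
  let N : Subgroup H :=
    { carrier := {k | k ∈ K ∧ m k - 1 ∈ J}
      one_mem' := ⟨K.one_mem, by rw [map_one, sub_self]; exact J.zero_mem⟩
      mul_mem' := fun {a b} ha hb => ⟨K.mul_mem ha.1 hb.1, by
        have := J.add_mem (hJleft a ha.1 _ hb.2) ha.2
        rwa [mul_sub, mul_one, sub_add_sub_cancel, ← map_mul] at this⟩
      inv_mem' := fun {a} ha => ⟨K.inv_mem ha.1, by
        have := J.neg_mem (hJleft a⁻¹ (K.inv_mem ha.1) _ ha.2)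
        rwa [mul_sub, mul_one, ← map_mul, inv_mul_cancel, map_one, neg_sub] at this⟩ }
  refine ⟨N, ⟨fun k hk h => ⟨hKn.conj_mem k hk.1 h, ?_⟩⟩, fun k hk => hk.1, ?_,
    fun h hh => hJbound _ hh.2⟩
  · have := hJconj h _ hk.2
    rwa [mul_sub, mul_one, sub_mul, hinv, ← map_mul, ← map_mul] at this
  · obtain ⟨s, c, hs, hc⟩ := exists_linear_coordinates (F := F) (m '' (K : Set H))
    refine Subgroup.isOpen_of_mem_nhds (g := 1) N ?_
    have hm : Continuous m := Units.continuous_val.comp continuous_subtype_val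
    have hev : ∀ᶠ k in 𝓝 (1 : H), ∀ b ∈ s, ‖c b (m k - 1)‖ ≤ ε := by
      refine (Filter.eventually_all_finset s).2 fun b _ => ?_
      have hcont : Continuous fun k : H => ‖c b (m k - 1)‖ :=
        ((c b).continuous_of_finiteDimensional.comp (hm.sub continuous_const)).norm
      exact (hcont.tendsto' 1 0 (by simp)).eventually_le_const hε
    filter_upwards [hev, hKo.mem_nhds K.one_mem] with k hk hkK
    refine ⟨hkK, ?_⟩
    rw [hc (m k - 1) (Submodule.sub_mem _ (Submodule.subset_span ⟨k, hkK, rfl⟩)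
      (Submodule.subset_span ⟨1, K.one_mem, map_one m⟩))]
    refine J.sum_mem fun b hb => ?_
    obtain ⟨k', hk', rfl⟩ := hs hb
    exact hJ _ (hk _ hb) k' hk'

end LinearGroup

lemma exists_quotient_nilpotent {G : Type*} [Group G] [TopologicalSpace G] [IsTopologicalGroup G]
    (hcg : (⊤ : Subgroup G).CompactlyGenerated) {G₁ K N : Subgroup G} [G₁.FiniteIndex]
    (hK : IsCompact (K : Set G)) (hKG : K ≤ G₁)
    (hcomm : ∀ x ∈ G₁, ∀ y ∈ G₁, x * y * x⁻¹ * y⁻¹ ∈ K) [N.Normal] (hN : IsOpen (N : Set G)) :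
    ∃ P : Subgroup (G ⧸ N), P.FiniteIndex ∧ Group.FG P ∧ Group.IsNilpotent P := by
  have hsurj := QuotientGroup.mk'_surjective N
  obtain ⟨S, hS, hcl⟩ := hcg
  have hfg : Group.FG (G ⧸ N) := Group.fg_iff.2 ⟨QuotientGroup.mk' N '' S, by
    rw [← MonoidHom.map_closure, hcl, Subgroup.map_top_of_surjective _ hsurj],
    hS.finite_image_mk hN⟩
  have hfin : Finite (K.map (QuotientGroup.mk' N)) := (hK.finite_image_mk hN).to_subtype
  have hind : (G₁.map (QuotientGroup.mk' N)).FiniteIndex :=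
    ⟨fun h => Subgroup.FiniteIndex.index_ne_zero (H := G₁)
      (zero_dvd_iff.1 (h ▸ G₁.index_map_dvd hsurj))⟩
  refine exists_finiteIndex_nilpotent (G₁.map (QuotientGroup.mk' N))
    (K.map (QuotientGroup.mk' N)) (Subgroup.map_mono hKG) ?_
  rintro _ ⟨x, hx, rfl⟩ _ ⟨y, hy, rfl⟩
  exact ⟨_, hcomm x hx y hy, by simp only [map_mul, map_inv]⟩

section LinearGroup

variable {F : Type*} [NontriviallyNormedField F] {n : ℕ} {H : Subgroup (GL (Fin n) F)}

lemma exists_bounded_commutators [LocallyCompactSpace F] [IsUltrametricDist F]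
    (hG : IsPolyGrowthGroup H) : ∃ (G₁ K : Subgroup H) (C : ℝ), G₁.FiniteIndex ∧
      IsOpen (K : Set H) ∧ K ≤ G₁ ∧ (∀ x ∈ G₁, ∀ y ∈ G₁, x * y * x⁻¹ * y⁻¹ ∈ K) ∧
      ∀ h ∈ K, ∀ i j, ‖((h : GL (Fin n) F) : Matrix (Fin n) (Fin n) F) i j‖ ≤ C := by
  let ρ : Representation F H (Fin n → F) :=
    ((Matrix.toLinAlgEquiv' : Matrix (Fin n) (Fin n) F ≃ₐ[F] _) : _ →* _).comp
      ((Units.coeHom _).comp H.subtype)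
  have hρ : ∀ (h : H) w, ρ h w = ((h : GL (Fin n) F) : Matrix (Fin n) (Fin n) F) *ᵥ w :=
    fun _ _ => rfl
  have : ProperSpace F := ProperSpace.of_locallyCompactSpace F
  have hcont : ρ.ContinuousCoeffs := fun v f => by
    refine f.continuous_of_finiteDimensional.comp ?_
    simp only [hρ]
    exact (Units.continuous_val.comp continuous_subtype_val).matrix_mulVec continuous_const
  obtain ⟨G₁, K, -, hG₁, hK, hKG, hcomm, -, hb⟩ :=
    IsPolyGrowthGroup.hasBoundedCommutators _ hG ρ hcont rfl
  choose C hC using fun i j : Fin n => hb (Pi.single j 1) (LinearMap.proj i)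
  refine ⟨G₁, K, ∑ i, ∑ j, |C i j|, hG₁, hK, hKG, hcomm, fun h hh i j => ?_⟩
  have h1 := hC i j h hh
  rw [LinearMap.proj_apply, hρ, Matrix.mulVec_single_one, Matrix.col_apply] at h1
  refine h1.trans ((le_abs_self _).trans ?_)
  refine (Finset.single_le_sum (f := fun j => |C i j|) (fun _ _ => abs_nonneg _)
    (Finset.mem_univ j)).trans ?_
  exact Finset.single_le_sum (f := fun i => ∑ j, |C i j|)
    (fun _ _ => Finset.sum_nonneg fun _ _ => abs_nonneg _) (Finset.mem_univ i)

end LinearGroup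

/-- Let `G` be a compactly generated, totally disconnected, closed subgroup of
`GL(n, F)` (`F` a non-archimedean local field) of polynomial growth in which every
closed subgroup is unimodular. Then `G` has a neighborhood basis of the identity of
compact open normal subgroups `K` such that each quotient `G/K` has a finitely
generated nilpotent subgroup of finite index. -/
theorem stmt14 {F : Type u} [NontriviallyNormedField F] [LocallyCompactSpace F]
    [IsUltrametricDist F] (n : ℕ)
    (H : Subgroup (GL (Fin n) F)) (hHclosed : IsClosed (H : Set (GL (Fin n) F)))
    [MeasurableSpace (GL (Fin n) F)] [BorelSpace (GL (Fin n) F)]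
    (hcg : ∃ S : Set (GL (Fin n) F), IsCompact S ∧ Subgroup.closure S = H)
    (hunim : ∀ K : Subgroup ↥H, IsClosed (K : Set ↥H) →
      ∀ ν : Measure ↥K, ν.IsHaarMeasure → ν.IsMulRightInvariant)
    (μ : Measure ↥H) (hμ : μ.IsHaarMeasure)
    (hpoly : ∀ W : Set ↥H, IsCompact W → W ∈ nhds (1 : ↥H) →
      ∃ (c : ENNReal) (d : ℕ), c ≠ ⊤ ∧ ∀ m : ℕ, μ (W ^ m) ≤ c * (m : ENNReal) ^ d) :
    ∀ U ∈ nhds (1 : ↥H), ∃ K : Subgroup ↥H,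
      K.Normal ∧ IsCompact (K : Set ↥H) ∧ IsOpen (K : Set ↥H) ∧ (K : Set ↥H) ⊆ U ∧
      ∃ (Q : Type u) (_ : Group Q) (π : ↥H →* Q), Function.Surjective π ∧ π.ker = K ∧
        ∃ N : Subgroup Q, N.FiniteIndex ∧ Group.FG ↥N ∧ Group.IsNilpotent ↥N := by
  have : ProperSpace F := ProperSpace.of_locallyCompactSpace F
  intro U hU
  have hcg' : (⊤ : Subgroup H).CompactlyGenerated :=
    Subgroup.CompactlyGenerated.top_of_isClosed hHclosed hcg
  have hG : IsPolyGrowthGroup H :=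
    IsPolyGrowthGroup.of_measure μ hpoly (exists_compact_open_subgroup hHclosed) hcg'
  obtain ⟨G₁, K, C, hG₁, hKo, hKG, hcomm, hC⟩ := exists_bounded_commutators hG
  have hcpt : ∀ N : Subgroup H, IsOpen (N : Set H) → N ≤ K → IsCompact (N : Set H) :=
    fun N hN hNK => isCompact_of_entries_bounded hHclosed (N.isClosed_of_isOpen hN) C
      fun h hh i j => ⟨hC h (hNK hh) i j, hC h⁻¹ (K.inv_mem (hNK hh)) i j⟩
  have hcore : IsOpen (K.normalCore : Set H) := Subgroup.isOpen_normalCore (G₁ := G₁) hKo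
    fun x hx y hy => by simpa using K.mul_mem (hcomm x hx y (hKG hy)) hy
  obtain ⟨δ, hδ, hδU⟩ := exists_entries_subset_of_mem_nhds hHclosed hU
  obtain ⟨N, hNn, hNK, hNo, hN⟩ := exists_normal_subgroup_entries_le hcore (C := |C|)
    (fun h hh i j => (hC h (K.normalCore_le hh) i j).trans (le_abs_self C))
    (ε := δ / (|C| + 1)) (by positivity)
  have hle : δ / (|C| + 1) * |C| ≤ δ := by
    rw [div_mul_eq_mul_div, div_le_iff₀ (by positivity)]
    nlinarith [abs_nonneg C]
  refine ⟨N, hNn, hcpt N hNo (hNK.trans K.normalCore_le), hNo, fun h hh => hδU h fun i j =>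
    ⟨(hN h hh i j).trans hle, (hN h⁻¹ (N.inv_mem hh) i j).trans hle⟩, H ⧸ N, inferInstance,
    QuotientGroup.mk' N, QuotientGroup.mk'_surjective N, QuotientGroup.ker_mk' N, ?_⟩
  exact exists_quotient_nilpotent hcg' (hcpt K hKo le_rfl) hKG hcomm hNo
end
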